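/- arXiv:1203.2592 — 2 statements merged into one kernel-verified Lean document; each statement's English description precedes it below -/
import Mathlib

section
/- Let q ∈ ℂ^× with q² ≠ 1 and let m ∈ ℤ with [m] ≠ 0. Then the blob algebra b_n(m) possesses a family of Jucys–Murphy elements with respect to the order ⪰: there exists a cellular basis {m_{st} : λ ∈ bi(n), s, t ∈ Std(λ)} of b_n(m) with respect to the poset (bi(n), ⪰) and index sets T(λ) = Std(λ), such that for all λ ∈ bi(n), all s, t ∈ Std(λ), and all 1 ≤ k ≤ n there exist scalars a_u ∈ ℂ (u ∈ Std(λ), u ≻ s) with L_k · m_{st} ≡ c_s(k)·m_{st} + Σ_{u ≻ s} a_u m_{ut} modulo b_n^λ(m), where b_n^λ(m) is the span of all m_{uv} with u, v ∈ Std(μ) and μ ≻ λ. -/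
noncomputable section

namespace Statement5

/-- The Gaussian integer `[j] = (q^j - q^{-j})/(q - q⁻¹)`. -/
def gauss (q : ℂ) (j : ℤ) : ℂ := (q ^ j - q ^ (-j)) / (q - q⁻¹)

/-- Generators of the blob algebra: `e` and `U_1, …, U_{n-1}` (0-indexed). -/
inductive BlobGen (n : ℕ) : Type
  | e : BlobGen n
  | U : Fin (n - 1) → BlobGen n

/-- The generator `e` in the free algebra. -/
def eF (n : ℕ) : FreeAlgebra ℂ (BlobGen n) := FreeAlgebra.ι ℂ BlobGen.e

/-- The generator `U_i` in the free algebra. -/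
def UF (n : ℕ) (i : Fin (n - 1)) : FreeAlgebra ℂ (BlobGen n) :=
  FreeAlgebra.ι ℂ (BlobGen.U i)

/-- The defining relations of the blob algebra `b_n(m)`; here `y_e = -[m-1]/[m]`. -/
inductive BlobRel (q : ℂ) (m : ℤ) (n : ℕ) :
    FreeAlgebra ℂ (BlobGen n) → FreeAlgebra ℂ (BlobGen n) → Prop
  | Usq (i : Fin (n - 1)) : BlobRel q m n (UF n i * UF n i) ((-(q + q⁻¹)) • UF n i)
  | UUU (i j : Fin (n - 1)) (h : i.val + 1 = j.val ∨ j.val + 1 = i.val) :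
      BlobRel q m n (UF n i * UF n j * UF n i) (UF n i)
  | Ucomm (i j : Fin (n - 1)) (h : i.val + 1 < j.val ∨ j.val + 1 < i.val) :
      BlobRel q m n (UF n i * UF n j) (UF n j * UF n i)
  | UeU (i : Fin (n - 1)) (h : i.val = 0) :
      BlobRel q m n (UF n i * eF n * UF n i) ((-(gauss q (m - 1) / gauss q m)) • UF n i)
  | ee : BlobRel q m n (eF n * eF n) (eF n)
  | Ue (i : Fin (n - 1)) (h : 1 ≤ i.val) : BlobRel q m n (UF n i * eF n) (eF n * UF n i)

/-- The blob algebra `b_n(m)`. -/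
abbrev Blob (q : ℂ) (m : ℤ) (n : ℕ) := RingQuot (BlobRel q m n)

/-- The image of `e` in the blob algebra. -/
def emk (q : ℂ) (m : ℤ) (n : ℕ) : Blob q m n :=
  RingQuot.mkAlgHom ℂ (BlobRel q m n) (eF n)

/-- The image of `U_i` in the blob algebra. -/
def Umk (q : ℂ) (m : ℤ) (n : ℕ) (i : Fin (n - 1)) : Blob q m n :=
  RingQuot.mkAlgHom ℂ (BlobRel q m n) (UF n i)

/-- The rescaled generator `U_0 = -[m]·e`. -/
def U0el (q : ℂ) (m : ℤ) (n : ℕ) : Blob q m n := (-(gauss q m)) • emk q m n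

/-- `U_i` for a natural number index (junk value `0` out of range). -/
def Uel (q : ℂ) (m : ℤ) (n : ℕ) (i : ℕ) : Blob q m n :=
  if h : i < n - 1 then Umk q m n ⟨i, h⟩ else 0

/-- The Jucys–Murphy elements of the blob algebra (0-indexed):
`Lel k` is `L_{k+1} = (U_k + q) ⋯ (U_1 + q)·((q - q⁻¹)U_0 + q^m)·(U_1 + q) ⋯ (U_k + q)`. -/
def Lel (q : ℂ) (m : ℤ) (n : ℕ) : ℕ → Blob q m n
  | 0 => (q - q⁻¹) • U0el q m n + algebraMap ℂ (Blob q m n) (q ^ m)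
  | k + 1 =>
      (Uel q m n k + algebraMap ℂ (Blob q m n) q) * Lel q m n k *
        (Uel q m n k + algebraMap ℂ (Blob q m n) q)

/-- One-line bipartitions of `n`: pairs `((a), (b))` with `a + b = n`. -/
abbrev Bi (n : ℕ) := {p : ℕ × ℕ // p.1 + p.2 = n}

/-- The statistic `f((a),(b)) = a - b`. -/
def fBi {n : ℕ} (lam : Bi n) : ℤ := (lam.1.1 : ℤ) - (lam.1.2 : ℤ)

/-- The order `⪰` on one-line bipartitions: `lam ⪰ mu` iff `|f lam| < |f mu|`, or
`|f lam| = |f mu|` and `f lam ≤ f mu`. -/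
def biSucceq {n : ℕ} (lam mu : Bi n) : Prop :=
  |fBi lam| < |fBi mu| ∨ (|fBi lam| = |fBi mu| ∧ fBi lam ≤ fBi mu)

/-- Standard `lam`-bitableaux, encoded by the set of entries lying in the first component
(`1, …, n` are 0-indexed as `Fin n`). -/
abbrev Std (n : ℕ) (lam : Bi n) := {S : Finset (Fin n) // S.card = lam.1.1}

/-- The sequence `t(j)` associated with a bitableau: `t(j) = #(first-component entries ≤ j)
- #(second-component entries ≤ j)` (1-based `j`). -/
def seqI (n : ℕ) (S : Finset (Fin n)) (j : ℕ) : ℤ :=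
  2 * ((S.filter (fun x => x.val < j)).card : ℤ) - (j : ℤ)

/-- The order `⪰` on standard bitableaux of the same shape:  `s ⪰ t` iff for every `j`,
`|s(j)| ≤ |t(j)|` and, whenever `|s(j)| = |t(j)|`, `s(j) ≤ t(j)`. -/
def tabSucceq (n : ℕ) (S T : Finset (Fin n)) : Prop :=
  ∀ j : ℕ, 1 ≤ j → j ≤ n →
    |seqI n S j| ≤ |seqI n T j| ∧ (|seqI n S j| = |seqI n T j| → seqI n S j ≤ seqI n T j)

/-- The content `c_t(k)` of a standard one-line bitableau at `k`: `q^{2(c-1)}·q^m` if `k` is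
the `c`-th smallest entry of the first component, `q^{2(c-1)}·q^{-m}` if it is the `c`-th
smallest entry of the second component. -/
def content (q : ℂ) (m : ℤ) (n : ℕ) (S : Finset (Fin n)) (k : Fin n) : ℂ :=
  if k ∈ S then q ^ (2 * ((S.filter (fun x => x ≤ k)).card - 1)) * q ^ m
  else q ^ (2 * ((Sᶜ.filter (fun x => x ≤ k)).card - 1)) * q ^ (-m)

/-! ### Walks on the integers -/

/-- The increment of a step: `1` for `true`, `-1` for `false`. -/
def inc (b : Bool) : ℤ := if b then 1 else -1

@[simp] lemma inc_true : inc true = 1 := rfl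
@[simp] lemma inc_false : inc false = -1 := rfl

/-- The endpoint of a walk starting at `0`; the head of the list is the last step. -/
def pos : List Bool → ℤ
  | [] => 0
  | b :: w => pos w + inc b

@[simp] lemma pos_nil : pos [] = 0 := rfl
@[simp] lemma pos_cons (b : Bool) (w : List Bool) : pos (b :: w) = pos w + inc b := rfl

/-- The order `x ⪰ y` on integers: closer to `0`, with `-k` above `k`. -/
def Above (x y : ℤ) : Prop := |x| ≤ |y| ∧ (|x| = |y| → x ≤ y)

/-- The dominance order on walks of equal length. -/
def Dom : List Bool → List Bool → Prop
  | [], [] => True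
  | b :: v, c :: w => Dom v w ∧ Above (pos (b :: v)) (pos (c :: w))
  | _, _ => False

lemma Dom.length_eq : ∀ {v w : List Bool}, Dom v w → v.length = w.length
  | [], [], _ => rfl
  | b :: v, c :: w, h => by simp [Dom.length_eq h.1]
  | [], _ :: _, h => h.elim
  | _ :: _, [], h => h.elim

lemma Above.refl (x : ℤ) : Above x x := ⟨le_rfl, fun _ => le_rfl⟩

lemma Dom.refl : ∀ w : List Bool, Dom w w
  | [] => trivial
  | _ :: w => ⟨Dom.refl w, Above.refl _⟩

/-- A walk starts with a step to the left whenever `p` is negative. -/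
def StartsNeg (p : ℤ) (b : List Bool) : Prop := p < 0 → b.getLast? = some false

lemma abs_pos_le (b : List Bool) : |pos b| ≤ b.length := by
  induction b with
  | nil => simp
  | cons c b ih =>
    rw [abs_le] at ih ⊢
    cases c <;> simp <;> omega

lemma pos_le_of_getLast {b : List Bool} (h : b.getLast? = some false) :
    pos b ≤ b.length - 2 := by
  induction b with
  | nil => simp at h
  | cons c b ih =>
    cases b with
    | nil => simp at h; simp [h]
    | cons d b =>
      rw [List.getLast?_cons_cons] at h
      have := ih h
      cases c <;> simp at * <;> omega

lemma above_of_startsNeg {p : ℤ} {b : List Bool} (hl : b.length = p.natAbs)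
    (hs : StartsNeg p b) : Above (pos b) p := by
  have h1 := abs_pos_le b
  have h2 : |p| = b.length := by rw [Int.abs_eq_natAbs, hl]
  refine ⟨by omega, fun h => ?_⟩
  rcases lt_or_ge p 0 with hp | hp
  · have := pos_le_of_getLast (hs hp)
    rw [h2] at h
    rcases abs_cases (pos b) with h3 | h3 <;> rcases abs_cases p with h4 | h4 <;> omega
  · rcases abs_cases (pos b) with h3 | h3 <;> rcases abs_cases p with h4 | h4 <;> omega

lemma Dom.getLast : ∀ {v w : List Bool}, Dom v w → w.getLast? = some false →
    v.getLast? = some false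
  | [], [], _, h => h
  | [b], [c], hd, h => by
    simp at h
    subst h
    have := hd.2.2
    cases b <;> simp_all
  | b :: b' :: v, c :: c' :: w, hd, h => by
    rw [List.getLast?_cons_cons] at h ⊢
    exact Dom.getLast hd.1 h
  | [], _ :: _, h, _ => h.elim
  | _ :: _, [], h, _ => h.elim
  | [_], _ :: _ :: _, h, _ => h.1.elim
  | _ :: _ :: _, [_], h, _ => h.1.elim

lemma int_cases (p : ℤ) : (∃ k : ℕ, p = k + 1) ∨ p = 0 ∨ ∃ k : ℕ, p = -(k + 1) := by
  rcases lt_trichotomy p 0 with h | h | h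
  · exact Or.inr (Or.inr ⟨p.natAbs - 1, by omega⟩)
  · exact Or.inr (Or.inl h)
  · exact Or.inl ⟨p.natAbs - 1, by omega⟩

/-! ### Systems of cups and caps -/

/-- Cups `u j` (creating a pair of adjacent points `j, j + 1`), a blob `e` on the first point
and an anti-involution `tr` turning cups into caps. -/
structure CupCap (q y : ℂ) (A : Type*) [Ring A] [Algebra ℂ A] where
  u : ℕ → A
  e : A
  tr : A →ₗ[ℂ] A
  tr_mul : ∀ x y, tr (x * y) = tr y * tr x
  tr_tr : ∀ x, tr (tr x) = x
  tr_e : tr e = e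
  du_self : ∀ j, tr (u j) * u j = algebraMap ℂ A (-(q + q⁻¹))
  du_succ : ∀ j, tr (u j) * u (j + 1) = 1
  du_far : ∀ i j, i ≤ j → tr (u i) * u (j + 2) = u j * tr (u i)
  uu : ∀ i j, i ≤ j → u (j + 2) * u i = u i * u j
  ee : e * e = e
  eu : ∀ j, e * u (j + 1) = u (j + 1) * e
  deu : tr (u 0) * e * u 0 = algebraMap ℂ A y

namespace CupCap

variable {q y : ℂ} {A : Type*} [Ring A] [Algebra ℂ A] (T : CupCap q y A)

/-- The caps. -/
def d (j : ℕ) : A := T.tr (T.u j)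

lemma tr_u (j : ℕ) : T.tr (T.u j) = T.d j := rfl
lemma tr_d (j : ℕ) : T.tr (T.d j) = T.u j := T.tr_tr _

lemma tr_one : T.tr 1 = 1 := by
  have h := T.tr_mul (T.tr 1) 1
  rw [mul_one, T.tr_tr, mul_one] at h
  exact h.symm

lemma du (j : ℕ) : T.d j * T.u j = algebraMap ℂ A (-(q + q⁻¹)) := T.du_self j
lemma du_up (j : ℕ) : T.d j * T.u (j + 1) = 1 := T.du_succ j
lemma du_down (j : ℕ) : T.d (j + 1) * T.u j = 1 := by
  have := congrArg T.tr (T.du_succ j)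
  rwa [T.tr_mul, T.tr_tr, T.tr_one] at this
lemma du_lt {i j : ℕ} (h : i ≤ j) : T.d i * T.u (j + 2) = T.u j * T.d i := T.du_far i j h
lemma du_gt {i j : ℕ} (h : i ≤ j) : T.d (j + 2) * T.u i = T.u i * T.d j := by
  have := congrArg T.tr (T.du_far i j h)
  rw [T.tr_mul, T.tr_mul, T.tr_tr] at this
  exact this
lemma ed (j : ℕ) : T.e * T.d (j + 1) = T.d (j + 1) * T.e := by
  have := congrArg T.tr (T.eu j)
  simpa only [T.tr_mul, T.tr_e, tr_u] using this.symm

/-- The elementary operator attached to a step of a walk at position `p`. -/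
def st : ℤ → Bool → A
  | Int.ofNat _, true => 1
  | Int.negSucc k, true => T.u k
  | Int.ofNat 0, false => T.e
  | Int.ofNat (k + 1), false => T.u k
  | Int.negSucc _, false => 1

lemma st_up (k : ℕ) : T.st k true = 1 := rfl
lemma st_up_zero : T.st 0 true = 1 := rfl
lemma st_up_pos (k : ℕ) : T.st (k + 1) true = 1 := rfl
lemma st_up_neg (k : ℕ) : T.st (-(k + 1)) true = T.u k := by
  rw [← Int.negSucc_eq]; rfl
lemma st_down_zero : T.st 0 false = T.e := rfl
lemma st_down_pos (k : ℕ) : T.st (k + 1) false = T.u k := rfl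
lemma st_down_neg (k : ℕ) : T.st (-(k + 1)) false = 1 := by
  rw [← Int.negSucc_eq]; rfl

/-- The half diagram of a walk. -/
def Y : List Bool → A
  | [] => 1
  | b :: w => Y w * T.st (pos w) b

@[simp] lemma Y_nil : T.Y [] = 1 := rfl
lemma Y_cons (b : Bool) (w : List Bool) : T.Y (b :: w) = T.Y w * T.st (pos w) b := rfl

lemma natAbs_succ (k : ℕ) : ((k : ℤ) + 1).natAbs = k + 1 := by omega
lemma natAbs_neg_succ (k : ℕ) : (-((k : ℤ) + 1)).natAbs = k + 1 := by omega

lemma Y_mul_e {w : List Bool} (h : pos w < 0) : T.Y w * T.e = T.Y w := by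
  induction w with
  | nil => simp at h
  | cons b w ih =>
    rw [Y_cons]
    rcases int_cases (pos w) with ⟨k, hk⟩ | hk | ⟨k, hk⟩
    · cases b <;> simp [hk] at h <;> omega
    · cases b
      · rw [hk, st_down_zero, mul_assoc, T.ee]
      · simp [hk] at h
    · have hw : pos w < 0 := by omega
      cases b
      · rw [hk, st_down_neg, mul_one, ih hw]
      · cases k with
        | zero => simp [hk] at h
        | succ k => rw [hk, st_up_neg, mul_assoc, ← T.eu, ← mul_assoc, ih hw]

lemma e_mul_trY {w : List Bool} (h : pos w < 0) : T.e * T.tr (T.Y w) = T.tr (T.Y w) := by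
  have := congrArg T.tr (T.Y_mul_e h)
  rwa [T.tr_mul, T.tr_e] at this

/-- Elements acting on points to the right of a half diagram slide through it. -/
lemma shift_of {x : ℕ → A} (hxe : ∀ j, T.e * x (j + 1) = x (j + 1) * T.e)
    (hxu : ∀ i j, i ≤ j → x (j + 2) * T.u i = T.u i * x j) (w : List Bool) (j : ℕ) :
    x (j + w.length) * T.Y w = T.Y w * x (j + (pos w).natAbs) := by
  induction w generalizing j with
  | nil => simp
  | cons b w ih =>
    have h1 : j + (b :: w).length = (j + 1) + w.length := by simp; omega
    rw [Y_cons, ← mul_assoc, h1, ih, mul_assoc, mul_assoc]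
    congr 1
    rcases int_cases (pos w) with ⟨k, hk⟩ | hk | ⟨k, hk⟩ <;> cases b
    · rw [pos_cons, hk, st_down_pos, natAbs_succ, inc_false,
        show ((k : ℤ) + 1 + -1).natAbs = k by omega,
        show j + 1 + (k + 1) = (j + k) + 2 by ring, hxu _ _ (by omega)]
    · rw [pos_cons, hk, st_up_pos, natAbs_succ, inc_true,
        show ((k : ℤ) + 1 + 1).natAbs = k + 2 by omega]
      simp [add_comm, add_left_comm]
    · rw [pos_cons, hk, st_down_zero]
      simp [hxe]
    · rw [pos_cons, hk, st_up_zero]; simp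
    · rw [pos_cons, hk, st_down_neg, natAbs_neg_succ, inc_false,
        show (-((k : ℤ) + 1) + -1).natAbs = k + 2 by omega]
      simp [add_comm, add_left_comm]
    · rw [pos_cons, hk, st_up_neg, natAbs_neg_succ, inc_true,
        show (-((k : ℤ) + 1) + 1).natAbs = k by omega,
        show j + 1 + (k + 1) = (j + k) + 2 by ring, hxu _ _ (by omega)]

lemma shift_u (w : List Bool) (j : ℕ) :
    T.u (j + w.length) * T.Y w = T.Y w * T.u (j + (pos w).natAbs) :=
  T.shift_of T.eu T.uu w j

lemma shift_d (w : List Bool) (j : ℕ) :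
    T.d (j + w.length) * T.Y w = T.Y w * T.d (j + (pos w).natAbs) :=
  T.shift_of T.ed (fun _ _ h => T.du_gt h) w j

lemma trY_mul_u (w : List Bool) (j : ℕ) :
    T.tr (T.Y w) * T.u (j + w.length) = T.u (j + (pos w).natAbs) * T.tr (T.Y w) := by
  have := congrArg T.tr (T.shift_d w j)
  rwa [T.tr_mul, T.tr_mul, tr_d, tr_d] at this

/-- Reversing the last step of a walk by bending. -/
lemma bend_step {s t : List Bool} {c : Bool} (h : pos s = pos (c :: t)) :
    T.Y s * T.tr (T.st (pos t) c) * T.u (pos t).natAbs * T.tr (T.Y t) =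
      T.Y ((!c) :: s) * T.tr (T.Y t) := by
  rw [Y_cons, h, pos_cons]
  rcases int_cases (pos t) with ⟨k, hk⟩ | hk | ⟨k, hk⟩ <;> cases c
  · rw [hk, st_down_pos, natAbs_succ, tr_u, mul_assoc (T.Y s), du_up]
    simp [st_up]
  · rw [hk, st_up_pos, natAbs_succ, tr_one, mul_one, inc_true,
      show (k : ℤ) + 1 + 1 = ((k + 1 : ℕ) : ℤ) + 1 by push_cast; ring]
    rfl
  · have hs : pos s < 0 := by rw [h, pos_cons, hk]; simp
    rw [hk, st_down_zero, T.tr_e, T.Y_mul_e hs]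
    rfl
  · rw [hk, st_up_zero, tr_one, mul_one]
    rfl
  · rw [hk, st_down_neg, tr_one, mul_one, natAbs_neg_succ, inc_false,
      show -((k : ℤ) + 1) + -1 = -(((k + 1 : ℕ) : ℤ) + 1) by push_cast; ring, Bool.not_false,
      st_up_neg]
  · rw [hk, st_up_neg, natAbs_neg_succ, tr_u, mul_assoc (T.Y s), du_up, mul_one, inc_true,
      Bool.not_true]
    cases k with
    | zero =>
      have ht : pos t < 0 := by omega
      rw [show -(((0 : ℕ) : ℤ) + 1) + 1 = 0 by simp, st_down_zero, mul_assoc, T.e_mul_trY ht]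
    | succ k =>
      rw [show -(((k + 1 : ℕ) : ℤ) + 1) + 1 = -((k : ℤ) + 1) by push_cast; ring, st_down_neg,
        mul_one]

end CupCap

/-- The direction leading away from the origin. -/
def away (p : ℤ) : Bool := decide (0 ≤ p)

lemma away_nonneg {p : ℤ} (h : 0 ≤ p) : away p = true := by simp [away, h]
lemma away_neg {p : ℤ} (h : p < 0) : away p = false := by simp [away, h]

lemma inc_not (c : Bool) : inc (!c) = -inc c := by cases c <;> rfl

lemma natAbs_add_away (p : ℤ) : (p + inc (away p)).natAbs = p.natAbs + 1 := by
  rcases lt_or_ge p 0 with h | h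
  · rw [away_neg h, inc_false]; omega
  · rw [away_nonneg h, inc_true]; omega

lemma natAbs_add_not_away {p : ℤ} {k : ℕ} (hk : p.natAbs = k + 1) :
    (p + inc (!away p)).natAbs = k := by
  rcases lt_or_ge p 0 with h | h
  · rw [away_neg h, Bool.not_false, inc_true]; omega
  · rw [away_nonneg h, Bool.not_true, inc_false]; omega

lemma away_add_away (p : ℤ) : away (p + inc (away p)) = away p := by
  rcases lt_or_ge p 0 with h | h
  · rw [away_neg h, inc_false, away_neg (by omega)]
  · rw [away_nonneg h, inc_true, away_nonneg (by omega)]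

lemma direction_cases (p : ℤ) (c : Bool) :
    (p = 0 ∧ c = false) ∨ c = away p ∨ ∃ k, p.natAbs = k + 1 ∧ c = !away p := by
  rcases int_cases p with ⟨k, hk⟩ | hk | ⟨k, hk⟩
  · rw [away_nonneg (by omega)]
    cases c
    · exact Or.inr (Or.inr ⟨k, by omega, rfl⟩)
    · exact Or.inr (Or.inl rfl)
  · rw [away_nonneg (by omega)]
    cases c <;> simp [hk]
  · rw [away_neg (by omega)]
    cases c
    · exact Or.inr (Or.inl rfl)
    · exact Or.inr (Or.inr ⟨k, by omega, rfl⟩)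

/-- The shortest walk ending at `p`. -/
def straight (p : ℤ) : List Bool := List.replicate p.natAbs (away p)

@[simp] lemma length_straight (p : ℤ) : (straight p).length = p.natAbs := by simp [straight]

lemma pos_replicate (k : ℕ) (b : Bool) : pos (List.replicate k b) = k * inc b := by
  induction k with
  | zero => simp
  | succ k ih => rw [List.replicate_succ, pos_cons, ih]; push_cast; ring

@[simp] lemma pos_straight (p : ℤ) : pos (straight p) = p := by
  rw [straight, pos_replicate]
  rcases lt_or_ge p 0 with h | h
  · rw [away_neg h, inc_false]; omega
  · rw [away_nonneg h, inc_true]; omega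

lemma getLast?_replicate_false (k : ℕ) :
    (List.replicate (k + 1) false).getLast? = some false := by
  induction k with
  | zero => rfl
  | succ k ih => rw [List.replicate_succ, List.replicate_succ, List.getLast?_cons_cons]; exact ih

lemma startsNeg_straight (p : ℤ) : StartsNeg p (straight p) := by
  intro h
  obtain ⟨k, hk⟩ : ∃ k, p.natAbs = k + 1 := ⟨p.natAbs - 1, by omega⟩
  rw [straight, away_neg h, hk, getLast?_replicate_false]

lemma getLast?_cons_of_ne_nil {b : List Bool} (h : b ≠ []) (c : Bool) :
    (c :: b).getLast? = b.getLast? := by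
  cases b with
  | nil => exact (h rfl).elim
  | cons d b => rw [List.getLast?_cons_cons]

lemma ne_nil_of_length {b : List Bool} {k : ℕ} (h : b.length = k + 1) : b ≠ [] := by
  rintro rfl; simp at h

namespace CupCap

variable {q y : ℂ} {A : Type*} [Ring A] [Algebra ℂ A] (T : CupCap q y A)

lemma st_away (p : ℤ) : T.st p (away p) = 1 := by
  rcases int_cases p with ⟨k, rfl⟩ | rfl | ⟨k, rfl⟩
  · rw [away_nonneg (by omega), st_up_pos]
  · rw [away_nonneg (by omega), st_up_zero]
  · rw [away_neg (by omega), st_down_neg]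

lemma st_toward {p : ℤ} {k : ℕ} (h : p.natAbs = k + 1) : T.st p (!away p) = T.u k := by
  rcases int_cases p with ⟨j, rfl⟩ | rfl | ⟨j, rfl⟩
  · obtain rfl : j = k := by omega
    rw [away_nonneg (by omega), Bool.not_true, st_down_pos]
  · simp at h
  · obtain rfl : j = k := by omega
    rw [away_neg (by omega), Bool.not_false, st_up_neg]

lemma st_back (p : ℤ) : T.st (p + inc (away p)) (!away p) = T.u p.natAbs := by
  rw [← T.st_toward (natAbs_add_away p), away_add_away]

lemma Y_away (w : List Bool) : T.Y (away (pos w) :: w) = T.Y w := by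
  rw [Y_cons, st_away, mul_one]

lemma Y_back (w : List Bool) :
    T.Y ((!away (pos w)) :: away (pos w) :: w) = T.Y w * T.u (pos w).natAbs := by
  rw [Y_cons, Y_away, pos_cons, st_back]

lemma Y_replicate_true (k : ℕ) : T.Y (List.replicate k true) = 1 := by
  induction k with
  | zero => rfl
  | succ k ih =>
    rw [List.replicate_succ, Y_cons, ih, pos_replicate, inc_true, mul_one, st_up, mul_one]

lemma Y_replicate_false (k : ℕ) : T.Y (List.replicate (k + 1) false) = T.e := by
  induction k with
  | zero => rw [List.replicate_succ, Y_cons]; simp [st_down_zero]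
  | succ k ih =>
    rw [List.replicate_succ, Y_cons, ih, pos_replicate, inc_false,
      show ((k + 1 : ℕ) : ℤ) * -1 = -(k + 1) by push_cast; ring, st_down_neg, mul_one]

lemma Y_straight_nonneg {p : ℤ} (h : 0 ≤ p) : T.Y (straight p) = 1 := by
  rw [straight, away_nonneg h, Y_replicate_true]

lemma Y_straight_neg {p : ℤ} (h : p < 0) : T.Y (straight p) = T.e := by
  obtain ⟨k, hk⟩ : ∃ k, p.natAbs = k + 1 := ⟨p.natAbs - 1, by omega⟩
  rw [straight, away_neg h, hk, Y_replicate_false]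

lemma Y_mul_straight {w : List Bool} {p : ℤ} (h : pos w = p) :
    T.Y w * T.Y (straight p) = T.Y w := by
  rcases lt_or_ge p 0 with hp | hp
  · rw [Y_straight_neg _ hp, Y_mul_e _ (by omega)]
  · rw [Y_straight_nonneg _ hp, mul_one]

lemma tr_Y_straight (p : ℤ) : T.tr (T.Y (straight p)) = T.Y (straight p) := by
  rcases lt_or_ge p 0 with hp | hp
  · rw [Y_straight_neg _ hp, tr_e]
  · rw [Y_straight_nonneg _ hp, tr_one]

/-- A half diagram followed by a half diagram is a half diagram. -/
lemma Y_mul_Y (v x : List Bool) (hl : x.length = (pos v).natAbs) (hs : StartsNeg (pos v) x) :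
    ∃ w, Dom w v ∧ pos w = pos x ∧ T.Y v * T.Y x = T.Y w := by
  induction v generalizing x with
  | nil =>
    obtain rfl : x = [] := by simpa using hl
    exact ⟨[], trivial, rfl, by simp⟩
  | cons b v ih =>
    cases x with
    | nil =>
      refine ⟨b :: v, Dom.refl _, ?_, by simp⟩
      simp only [List.length_nil] at hl
      simp only [pos_nil]; omega
    | cons c x =>
      have hab := above_of_startsNeg hl hs
      rcases direction_cases (pos v) b with ⟨h0, rfl⟩ | rfl | ⟨k, hk, rfl⟩
      · obtain rfl : x = [] := by simpa [h0] using hl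
        have hc : c = false := by simpa using hs (by simp [h0])
        subst hc
        refine ⟨false :: v, Dom.refl _, by simp [h0], ?_⟩
        rw [Y_cons, Y_cons, h0, pos_nil, st_down_zero, Y_nil, one_mul, mul_assoc, T.ee]
      · have hl' : x.length = (pos v).natAbs := by
          rw [pos_cons, natAbs_add_away] at hl
          simpa using hl
        have hs' : StartsNeg (pos v) x := by
          intro h
          have hx : x ≠ [] := ne_nil_of_length (k := (pos v).natAbs - 1) (by omega)
          rw [← getLast?_cons_of_ne_nil hx c]
          exact hs (by rw [pos_cons, away_neg h, inc_false]; omega)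
        obtain ⟨w, hw1, hw2, hw3⟩ := ih x hl' hs'
        refine ⟨c :: w, ⟨hw1, ?_⟩, by simp [hw2], ?_⟩
        · rw [pos_cons, hw2]; exact hab
        · rw [Y_away, Y_cons, ← mul_assoc, hw3, Y_cons, hw2]
      · have hl' : (c :: x).length = k := by
          rw [pos_cons, natAbs_add_not_away hk] at hl; exact hl
        have hs' : StartsNeg (pos v) (away (pos (c :: x)) :: c :: x) := by
          intro h
          rw [List.getLast?_cons_cons]
          refine hs ?_
          rw [pos_cons, away_neg h]
          simp only [List.length_cons] at hl'
          simp only [Bool.not_false, inc_true]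
          omega
        obtain ⟨w, hw1, hw2, hw3⟩ := ih (away (pos (c :: x)) :: c :: x)
          (by rw [hk, List.length_cons, hl']) hs'
        have hp : pos ((!away (pos (c :: x))) :: w) = pos (c :: x) := by
          rw [pos_cons, hw2, pos_cons, inc_not]; ring
        refine ⟨(!away (pos (c :: x))) :: w, ⟨hw1, ?_⟩, hp, ?_⟩
        · rw [hp]; exact hab
        · have := T.shift_u (c :: x) 0
          rw [zero_add, zero_add, hl'] at this
          rw [Y_cons (b := !away (pos v)), T.st_toward hk, mul_assoc, this, ← mul_assoc,
            Y_cons (b := !away (pos (c :: x))), ← hw3, Y_away, hw2, pos_cons (away _), st_back]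

lemma extend {p : ℤ} {v b : List Bool} (hl : b.length = p.natAbs) (hs : StartsNeg p b)
    (hp : pos v = pos b) (c : Bool) :
    ∃ c' b', T.Y v * T.tr (T.Y b) * T.st p c = T.Y (c' :: v) * T.tr (T.Y b') ∧
      b'.length = (p + inc c).natAbs ∧ StartsNeg (p + inc c) b' ∧ pos (c' :: v) = pos b' := by
  rcases direction_cases p c with ⟨rfl, rfl⟩ | rfl | ⟨k, hk, rfl⟩
  · obtain rfl : b = [] := by simpa using hl
    refine ⟨false, [false], ?_, by simp, fun _ => rfl, by simp [hp]⟩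
    simp only [pos_nil] at hp
    rw [Y_cons, Y_cons, hp, Y_nil, tr_one, pos_nil, st_down_zero, one_mul, mul_one, T.tr_e,
      mul_assoc, T.ee]
  · refine ⟨away (pos v), away (pos b) :: b, ?_, ?_, ?_, ?_⟩
    · rw [st_away, Y_away, Y_away, mul_one]
    · rw [natAbs_add_away, List.length_cons, hl]
    · intro h
      have hp' : p < 0 := by
        by_contra h'
        rw [away_nonneg (by omega), inc_true] at h
        omega
      rw [getLast?_cons_of_ne_nil (ne_nil_of_length (k := p.natAbs - 1) (by omega))]
      exact hs hp'
    · rw [hp, pos_cons, pos_cons, hp]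
  · cases b with
    | nil => simp [hk] at hl
    | cons c b =>
      have hb : b.length = k := by rw [hk] at hl; simpa using hl
      refine ⟨!c, b, ?_, ?_, ?_, ?_⟩
      · have := T.trY_mul_u b 0
        rw [zero_add, zero_add, hb] at this
        rw [Y_cons, T.tr_mul, T.st_toward hk, ← T.bend_step hp, mul_assoc (T.Y v),
          mul_assoc (T.tr _), this]
        simp only [mul_assoc]
      · rw [natAbs_add_not_away hk, hb]
      · intro h
        have hp' : p < 0 := by
          by_contra h'
          rw [away_nonneg (by omega), Bool.not_true, inc_false] at h
          omega
        rw [away_neg hp', Bool.not_false, inc_true] at h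
        rw [← getLast?_cons_of_ne_nil (ne_nil_of_length (k := k - 1) (by omega)) c]
        exact hs hp'
      · rw [pos_cons, hp, pos_cons, inc_not]; ring

/-- The span of the morphisms ending in a given set of walks and starting at `p`. -/
def F (S : Set (List Bool)) (p : ℤ) : Submodule ℂ A :=
  Submodule.span ℂ {x | ∃ v b, v ∈ S ∧ b.length = p.natAbs ∧ StartsNeg p b ∧ pos v = pos b ∧
    x = T.Y v * T.tr (T.Y b)}

lemma mem_F {S : Set (List Bool)} {p : ℤ} {v b : List Bool} (hv : v ∈ S)
    (hl : b.length = p.natAbs) (hs : StartsNeg p b) (hp : pos v = pos b) :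
    T.Y v * T.tr (T.Y b) ∈ T.F S p :=
  Submodule.subset_span ⟨v, b, hv, hl, hs, hp, rfl⟩

lemma Y_mem_F {S : Set (List Bool)} {v : List Bool} (hv : v ∈ S) : T.Y v ∈ T.F S (pos v) := by
  have := T.mem_F hv (length_straight (pos v)) (startsNeg_straight _) (pos_straight _).symm
  rwa [tr_Y_straight, Y_mul_straight _ rfl] at this

lemma F_mono {S S' : Set (List Bool)} (h : S ⊆ S') (p : ℤ) : T.F S p ≤ T.F S' p := by
  apply Submodule.span_mono
  rintro x ⟨v, b, hv, h1, h2, h3, rfl⟩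
  exact ⟨v, b, h hv, h1, h2, h3, rfl⟩

lemma F_mul_st {S S' : Set (List Bool)} {p : ℤ} (c : Bool)
    (hS : ∀ v ∈ S, ∀ c', Above (pos v + inc c') (p + inc c) → c' :: v ∈ S') {x : A}
    (hx : x ∈ T.F S p) : x * T.st p c ∈ T.F S' (p + inc c) := by
  induction hx using Submodule.span_induction with
  | mem x hx =>
    obtain ⟨v, b, hv, h1, h2, h3, rfl⟩ := hx
    obtain ⟨c', b', e1, e2, e3, e4⟩ := T.extend h1 h2 h3 c
    rw [e1]
    refine T.mem_F (hS v hv c' ?_) e2 e3 e4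
    rw [← pos_cons, e4]
    exact above_of_startsNeg e2 e3
  | zero => rw [zero_mul]; exact zero_mem _
  | add x y _ _ hx hy => rw [add_mul]; exact add_mem hx hy
  | smul a x _ hx => rw [smul_mul_assoc]; exact Submodule.smul_mem _ _ hx

/-- Composing with the transpose of a half diagram. -/
lemma Y_mul_tr_mul_tr {p : ℤ} {v b t : List Bool} (hl : b.length = p.natAbs)
    (hs : StartsNeg p b) (ht : pos t = p) :
    ∃ t', Dom t' t ∧ pos t' = pos b ∧
      T.Y v * T.tr (T.Y b) * T.tr (T.Y t) = T.Y v * T.tr (T.Y t') := by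
  subst ht
  obtain ⟨t', h1, h2, h3⟩ := T.Y_mul_Y t b hl hs
  exact ⟨t', h1, h2, by rw [← h3, T.tr_mul, mul_assoc]⟩

lemma F_mul_trY {S : Set (List Bool)} {p p' : ℤ} {b : List Bool} (hl : b.length = p'.natAbs)
    (hs : StartsNeg p' b) (hp : pos b = p) {x : A} (hx : x ∈ T.F S p) :
    x * T.tr (T.Y b) ∈ T.F S p' := by
  induction hx using Submodule.span_induction with
  | mem x hx =>
    obtain ⟨v, c, hv, h1, h2, h3, rfl⟩ := hx
    obtain ⟨t', e1, e2, e3⟩ := T.Y_mul_tr_mul_tr (v := v) h1 h2 hp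
    rw [e3]
    exact T.mem_F hv (by rw [e1.length_eq, hl]) (fun h => e1.getLast (hs h)) (by rw [e2, h3])
  | zero => rw [zero_mul]; exact zero_mem _
  | add x y _ _ hx hy => rw [add_mul]; exact add_mem hx hy
  | smul a x _ hx => rw [smul_mul_assoc]; exact Submodule.smul_mem _ _ hx

end CupCap

namespace CupCap

variable {q y : ℂ} {A : Type*} [Ring A] [Algebra ℂ A] (T : CupCap q y A)

/-- The walks of length `n`. -/
def walks (n : ℕ) : Set (List Bool) := {v | v.length = n}

lemma F_walks_mul_st {n : ℕ} {p : ℤ} (c : Bool) {x : A} (hx : x ∈ T.F (walks n) p) :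
    x * T.st p c ∈ T.F (walks (n + 1)) (p + inc c) :=
  T.F_mul_st c (fun v hv c' _ => by simpa [walks] using hv) hx

/-- A half diagram followed by a morphism. -/
lemma Y_mul_mem_F {v x z : List Bool} {p : ℤ} (hl : x.length = (pos v).natAbs)
    (hs : StartsNeg (pos v) x) (hl' : z.length = p.natAbs) (hs' : StartsNeg p z)
    (hp : pos x = pos z) :
    T.Y v * T.Y x * T.tr (T.Y z) ∈ T.F (walks v.length) p := by
  obtain ⟨w, h1, h2, h3⟩ := T.Y_mul_Y v x hl hs
  rw [h3]
  exact T.mem_F (Dom.length_eq h1) hl' hs' (by rw [h2, hp])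

lemma Y_mul_d (w : List Bool) :
    T.Y w * T.tr (T.Y (straight (pos w))) * T.d (pos w).natAbs =
      T.Y w * T.d (pos w).natAbs * T.tr (T.Y (straight (pos w))) := by
  rcases lt_or_ge (pos w) 0 with hp | hp
  · obtain ⟨k, hk⟩ : ∃ k, (pos w).natAbs = k + 1 := ⟨(pos w).natAbs - 1, by omega⟩
    rw [tr_Y_straight, Y_straight_neg _ hp, hk, mul_assoc, T.ed, mul_assoc]
  · rw [tr_Y_straight, Y_straight_nonneg _ hp, mul_one, mul_one]

lemma ud_mul_Y_last (w : List Bool) (c1 c : Bool) :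
    T.u w.length * T.d w.length * T.Y (c :: c1 :: w) ∈
      T.F (walks (w.length + 2)) (pos (c :: c1 :: w)) := by
  set h := (pos w).natAbs with hh
  set v := (!away (pos w)) :: away (pos w) :: w with hv
  have hvl : v ∈ walks (w.length + 2) := by simp [hv, walks]
  have hvl' : v.length = w.length + 2 := hvl
  have hpv : pos v = pos w := by simp [hv, inc_not]
  have key : T.u w.length * T.d w.length * T.Y (c :: c1 :: w) =
      T.Y v * (T.d h * T.st (pos w) c1 * T.st (pos w + inc c1) c) := by
    have e1 := T.shift_d w 0
    have e2 := T.shift_u w 0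
    simp only [zero_add] at e1 e2
    rw [Y_cons, Y_cons, hv, Y_back, pos_cons]
    calc _ = T.u w.length * (T.d w.length * T.Y w) * T.st (pos w) c1 *
          T.st (pos w + inc c1) c := by simp only [mul_assoc]
      _ = _ := by rw [e1, ← mul_assoc, e2]; simp only [mul_assoc, hh]
  rw [key]
  clear_value v
  have hvs : T.Y v * T.tr (T.Y (straight (pos w))) = T.Y v := by
    rw [tr_Y_straight, T.Y_mul_straight hpv]
  have hsc (r : ℂ) (p : ℤ) (hp : p = pos w) :
      T.Y v * algebraMap ℂ A r ∈ T.F (walks (w.length + 2)) p := by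
    rw [← Algebra.commutes, ← Algebra.smul_def, hp, ← hpv]
    exact Submodule.smul_mem _ _ (T.Y_mem_F hvl)
  rcases direction_cases (pos w) c1 with ⟨h0, rfl⟩ | rfl | ⟨k, hk, rfl⟩
  · have hh0 : h = 0 := by simp [hh, h0]
    rw [h0, hh0, st_down_zero, inc_false, zero_add, show (-1 : ℤ) = -((0 : ℕ) + 1) by simp]
    cases c
    · rw [st_down_neg, mul_one]
      have : T.d 0 * T.e = T.tr (T.Y [true, false]) := by
        rw [Y_cons, Y_cons, Y_nil, one_mul, pos_cons, pos_nil, inc_false, st_down_zero, zero_add,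
          show (-1 : ℤ) = -((0 : ℕ) + 1) by simp, st_up_neg, T.tr_mul, T.tr_e, tr_u]
      rw [this]
      refine T.mem_F hvl ?_ ?_ ?_
      · simp [h0]
      · intro; rfl
      · simp [hpv, h0]
    · rw [st_up_neg, show T.d 0 = T.tr (T.u 0) from rfl, T.deu]
      exact hsc _ _ (by simp)
  · rw [st_away, mul_one]
    have hp1 : pos (away (pos w) :: w) = pos w + inc (away (pos w)) := rfl
    rcases direction_cases (pos w + inc (away (pos w))) c with ⟨h0, rfl⟩ | rfl | ⟨k, hk, rfl⟩
    · have := natAbs_add_away (pos w)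
      rw [h0] at this
      simp at this
    · rw [st_away, mul_one, ← hvs, hh, ← hpv, Y_mul_d, mul_assoc]
      have : T.d (pos v).natAbs * T.tr (T.Y (straight (pos v))) =
          T.tr (T.Y ((!away (pos v)) :: away (pos v) :: straight (pos v))) := by
        have := T.Y_back (straight (pos v))
        rw [pos_straight] at this
        rw [this, T.tr_mul, tr_u]
      rw [this]
      refine T.mem_F hvl ?_ ?_ ?_
      · rw [pos_cons, pos_cons, ← hpv, natAbs_add_away, natAbs_add_away]; simp
      · intro hneg
        rw [pos_cons, pos_cons, ← hpv, away_add_away] at hneg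
        have hneg' : pos v < 0 := by
          by_contra h'
          rw [away_nonneg (by omega), inc_true] at hneg
          omega
        rw [List.getLast?_cons_cons, getLast?_cons_of_ne_nil]
        · exact startsNeg_straight _ hneg'
        · exact ne_nil_of_length (k := (pos v).natAbs - 1) (by simp; omega)
      · simp [inc_not]
    · rw [away_add_away, st_back, T.du]
      exact hsc _ _ (by simp [inc_not])
  · rw [T.st_toward hk, hh, hk, T.du_down, one_mul]
    have hp1 : pos ((!away (pos w)) :: w) = pos w + inc (!away (pos w)) := rfl
    have hk1 := natAbs_add_not_away hk
    rcases direction_cases (pos w + inc (!away (pos w))) c with ⟨h0, rfl⟩ | rfl | ⟨j, hj, rfl⟩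
    · have hk0 : k = 0 := by rw [h0] at hk1; simpa using hk1.symm
      subst hk0
      rw [h0, st_down_zero, ← T.ee, ← mul_assoc, ← hvl']
      have he : T.Y [false] = T.e := T.Y_replicate_false 0
      have := T.Y_mul_mem_F (v := v) (x := [false]) (z := [false])
        (p := pos (false :: (!away (pos w)) :: w)) (by simp [hpv, hk]) (fun _ => rfl)
        (by rw [pos_cons, hp1, h0]; simp) (fun _ => rfl) rfl
      rwa [he, T.tr_e] at this
    · rw [st_away, mul_one, ← hvs]
      refine T.mem_F hvl ?_ ?_ (by simp [hpv])
      · rw [pos_cons, hp1, natAbs_add_away, hk1, length_straight, hk]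
      · intro hneg
        refine startsNeg_straight _ ?_
        rw [pos_cons, hp1] at hneg
        by_contra h'
        rw [away_nonneg (by omega), Bool.not_true, inc_false, away_nonneg (by omega),
          inc_true] at hneg
        omega
    · have hw : (pos w).natAbs = j + 2 := by omega
      have ha : away (pos w + inc (!away (pos w))) = away (pos w) := by
        rcases lt_or_ge (pos w) 0 with hp | hp
        · rw [away_neg hp, Bool.not_false, inc_true, away_neg (by omega)]
        · rw [away_nonneg hp, Bool.not_true, inc_false, away_nonneg (by omega)]
      rw [T.st_toward hj, ← hvl']
      set p := pos ((!away (pos w + inc (!away (pos w)))) :: (!away (pos w)) :: w) with hpdef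
      have hp2 : p + inc (away (pos w)) + inc (away (pos w)) = pos w := by
        rw [hpdef, pos_cons, hp1, ha, inc_not]; ring
      have hpn : p.natAbs = j := by
        rw [hpdef, pos_cons, hp1]; exact natAbs_add_not_away hj
      have hap : p = 0 ∨ away p = away (pos w) := by
        rcases lt_or_ge (pos w) 0 with hp | hp
        · rw [away_neg hp, inc_false] at hp2
          rw [away_neg hp]
          rcases eq_or_ne p 0 with h0 | h0
          · exact Or.inl h0
          · exact Or.inr (away_neg (by omega))
        · rw [away_nonneg hp, inc_true] at hp2
          rw [away_nonneg hp]
          exact Or.inr (away_nonneg (by omega))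
      set x := (!away (pos w)) :: List.replicate (j + 1) (away (pos w)) with hx
      have hxp : pos (List.replicate (j + 1) (away (pos w))) = p + inc (away (pos w)) := by
        have := pos_straight (pos w)
        rw [straight, hw, List.replicate_succ, pos_cons] at this
        linarith
      have hYx : T.Y v * T.u j = T.Y v * T.Y x * T.tr (T.Y (straight p)) := by
        have e1 : T.st (p + inc (away (pos w))) (!away (pos w)) = T.u j := by
          have : away (p + inc (away (pos w))) = away (pos w) := by
            rcases lt_or_ge (pos w) 0 with hp | hp
            · rw [away_neg hp] at hp2 ⊢
              exact away_neg (by simp at hp2 ⊢; omega)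
            · rw [away_nonneg hp] at hp2 ⊢
              exact away_nonneg (by simp at hp2 ⊢; omega)
          suffices hs : (p + inc (away (pos w))).natAbs = j + 1 by
            have := T.st_toward hs
            rwa [‹away (p + _) = _›] at this
          rcases hap with h0 | h0
          · rw [h0] at hpn ⊢
            cases away (pos w) <;> simp at * <;> omega
          · rw [← h0, natAbs_add_away, hpn]
        have hxx : pos x = p := by rw [hx, pos_cons, hxp, inc_not]; ring
        rw [tr_Y_straight, mul_assoc, T.Y_mul_straight hxx, hx, Y_cons, hxp, e1]
        rcases lt_or_ge (pos w) 0 with hp | hp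
        · rw [away_neg hp, Y_replicate_false, ← mul_assoc, Y_mul_e _ (by omega)]
        · rw [away_nonneg hp, Y_replicate_true, one_mul]
      rw [hYx]
      refine T.Y_mul_mem_F ?_ ?_ (by simp) (startsNeg_straight _) ?_
      · rw [hpv, hw, hx]; simp
      · intro hneg
        rw [hpv] at hneg
        rw [hx, away_neg hneg, getLast?_cons_of_ne_nil (by simp), getLast?_replicate_false]
      · rw [hx, pos_cons, hxp, pos_straight, inc_not]; ring

lemma ud_mul_Y (w : List Bool) {i : ℕ} (hi : i + 1 < w.length) :
    T.u i * T.d i * T.Y w ∈ T.F (walks w.length) (pos w) := by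
  induction w with
  | nil => simp at hi
  | cons c w ih =>
    by_cases h : i + 1 < w.length
    · rw [Y_cons, ← mul_assoc]
      exact T.F_walks_mul_st c (ih h)
    · cases w with
      | nil => simp at hi
      | cons c1 w =>
        obtain rfl : i = w.length := by simp at hi h; omega
        exact T.ud_mul_Y_last w c1 c

/-- The walks of length `n` starting with a step to the left. -/
def negWalks (n : ℕ) : Set (List Bool) := {v | v.length = n ∧ v.getLast? = some false}

lemma e_mul_Y_neg (w : List Bool) (hw : w ≠ []) :
    T.e * T.Y w ∈ T.F (negWalks w.length) (pos w) := by
  induction w with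
  | nil => exact (hw rfl).elim
  | cons c w ih =>
    cases w with
    | nil =>
      have : T.e * T.Y [c] = T.Y [false] * T.tr (T.Y [false]) := by
        rw [show T.Y [false] = T.e from T.Y_replicate_false 0, T.tr_e]
        cases c
        · rw [show T.Y [false] = T.e from T.Y_replicate_false 0]
        · rw [show T.Y [true] = 1 from T.Y_replicate_true 1, mul_one, T.ee]
      rw [this]
      refine T.mem_F ⟨rfl, rfl⟩ ?_ (fun _ => rfl) rfl
      cases c <;> simp
    | cons c1 w =>
      rw [Y_cons, ← mul_assoc]
      refine T.F_mul_st (S := negWalks (c1 :: w).length)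
        (S' := negWalks (c :: c1 :: w).length) c (fun v hv c' _ => ⟨?_, ?_⟩) (ih (by simp))
      · rw [List.length_cons, hv.1]; rfl
      · rw [getLast?_cons_of_ne_nil (ne_nil_of_length hv.1)]
        exact hv.2

lemma e_mul_Y (w : List Bool) (hw : w ≠ []) :
    T.e * T.Y w ∈ T.F (walks w.length) (pos w) :=
  T.F_mono (fun _ h => h.1) _ (T.e_mul_Y_neg w hw)

/-- Morphism spaces are stable under left multiplication once half diagrams are. -/
lemma mul_mem_F {n : ℕ} {a : A}
    (ha : ∀ w : List Bool, w.length = n → a * T.Y w ∈ T.F (walks n) (pos w)) {p : ℤ} {x : A}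
    (hx : x ∈ T.F (walks n) p) : a * x ∈ T.F (walks n) p := by
  induction hx using Submodule.span_induction with
  | mem x hx =>
    obtain ⟨v, b, hv, h1, h2, h3, rfl⟩ := hx
    rw [← mul_assoc]
    exact T.F_mul_trY h1 h2 h3.symm (ha v hv)
  | zero => rw [mul_zero]; exact zero_mem _
  | add x y _ _ hx hy => rw [mul_add]; exact add_mem hx hy
  | smul r x _ hx => rw [mul_smul_comm]; exact Submodule.smul_mem _ _ hx

/-- The diagram algebra on `n` points. -/
def alg (n : ℕ) : Subalgebra ℂ A :=
  Algebra.adjoin ℂ ({x | 1 ≤ n ∧ x = T.e} ∪ {x | ∃ i, i + 1 < n ∧ x = T.u i * T.d i})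

lemma alg_mul_mem_F {n : ℕ} {p : ℤ} {a x : A} (ha : a ∈ T.alg n)
    (hx : x ∈ T.F (walks n) p) : a * x ∈ T.F (walks n) p := by
  induction ha using Algebra.adjoin_induction generalizing x with
  | mem a ha =>
    rcases ha with ⟨hn, rfl⟩ | ⟨i, hi, rfl⟩
    · refine T.mul_mem_F (fun w hw => ?_) hx
      subst hw
      exact T.e_mul_Y w (by rintro rfl; simp at hn)
    · refine T.mul_mem_F (fun w hw => ?_) hx
      subst hw
      exact T.ud_mul_Y w hi
  | algebraMap r => rw [← Algebra.smul_def]; exact Submodule.smul_mem _ _ hx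
  | add a b _ _ ha hb => rw [add_mul]; exact add_mem (ha hx) (hb hx)
  | mul a b _ _ ha hb => rw [mul_assoc]; exact ha (hb hx)

lemma alg_mul_Y {n : ℕ} {a : A} (ha : a ∈ T.alg n) {w : List Bool} (hw : w.length = n) :
    a * T.Y w ∈ T.F (walks n) (pos w) :=
  T.alg_mul_mem_F ha (T.Y_mem_F hw)

lemma tr_mem_alg {n : ℕ} {a : A} (ha : a ∈ T.alg n) : T.tr a ∈ T.alg n := by
  induction ha using Algebra.adjoin_induction with
  | mem a ha =>
    rcases ha with ⟨hn, rfl⟩ | ⟨i, hi, rfl⟩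
    · rw [T.tr_e]; exact Algebra.subset_adjoin (Or.inl ⟨hn, rfl⟩)
    · rw [T.tr_mul, tr_d, tr_u]; exact Algebra.subset_adjoin (Or.inr ⟨i, hi, rfl⟩)
  | algebraMap r =>
    rw [Algebra.algebraMap_eq_smul_one, map_smul, tr_one]
    exact Subalgebra.smul_mem _ (one_mem _) _
  | add a b _ _ ha hb => rw [map_add]; exact add_mem ha hb
  | mul a b _ _ ha hb => rw [T.tr_mul]; exact mul_mem hb ha

end CupCap

namespace CupCap

variable {q y : ℂ} {A : Type*} [Ring A] [Algebra ℂ A] (T : CupCap q y A)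

lemma du_smul (j : ℕ) : T.d j * T.u j = (-(q + q⁻¹)) • 1 := by
  rw [T.du, Algebra.algebraMap_eq_smul_one]

lemma deu_smul : T.d 0 * (T.e * T.u 0) = y • 1 := by
  rw [← mul_assoc, ← Algebra.algebraMap_eq_smul_one]; exact T.deu

/-- The braid-like generator `U + r`. -/
def G (r : ℂ) (k : ℕ) : A := T.u k * T.d k + r • 1

/-- The Jucys–Murphy recursion with parameters `r` and `a`. -/
def jm (r a : ℂ) : ℕ → A
  | 0 => a • 1 - (a - a⁻¹) • T.e
  | k + 1 => T.G r k * jm r a k * T.G r k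

lemma jm_zero (r a : ℂ) : T.jm r a 0 = a • 1 - (a - a⁻¹) • T.e := rfl
lemma jm_succ (r a : ℂ) (k : ℕ) : T.jm r a (k + 1) = T.G r k * T.jm r a k * T.G r k := rfl

lemma tr_G (r : ℂ) (k : ℕ) : T.tr (T.G r k) = T.G r k := by
  rw [G, map_add, T.tr_mul, tr_d, tr_u, map_smul, tr_one]

lemma tr_jm (r a : ℂ) (k : ℕ) : T.tr (T.jm r a k) = T.jm r a k := by
  induction k with
  | zero => rw [jm_zero, map_sub, map_smul, map_smul, tr_one, tr_e]
  | succ k ih => rw [jm_succ, T.tr_mul, T.tr_mul, tr_G, ih, mul_assoc]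

lemma G_succ_mul_u (r : ℂ) (i : ℕ) : T.G r (i + 1) * T.u i = T.u (i + 1) + r • T.u i := by
  rw [G, add_mul, mul_assoc, du_down, mul_one, smul_mul_assoc, one_mul]

lemma G_mul_u_succ (r : ℂ) (i : ℕ) : T.G r i * T.u (i + 1) = T.u i + r • T.u (i + 1) := by
  rw [G, add_mul, mul_assoc, du_up, mul_one, smul_mul_assoc, one_mul]

lemma G_mul_u_far (r : ℂ) {i j : ℕ} (h : i ≤ j) :
    T.G r (j + 2) * T.u i = T.u i * T.G r j := by
  rw [G, G, add_mul, mul_add, mul_assoc, T.du_gt h, ← mul_assoc, T.uu _ _ h, mul_assoc,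
    smul_mul_assoc, mul_smul_comm, one_mul, mul_one]

lemma G_mul_u_lt (r : ℂ) {i j : ℕ} (h : i ≤ j) :
    T.G r i * T.u (j + 2) = T.u (j + 2) * T.G r i := by
  rw [G, add_mul, mul_add, mul_assoc, T.du_lt h, ← mul_assoc, ← mul_assoc, ← T.uu _ _ h,
    smul_mul_assoc, mul_smul_comm, one_mul, mul_one]

lemma e_mul_G (r : ℂ) (j : ℕ) : T.e * T.G r (j + 1) = T.G r (j + 1) * T.e := by
  rw [G, mul_add, add_mul, ← mul_assoc, T.eu, mul_assoc, T.ed, mul_assoc, smul_mul_assoc,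
    mul_smul_comm, one_mul, mul_one]

lemma jm_mul_u_far (r a : ℂ) {i j : ℕ} (h : i ≤ j) :
    T.jm r a i * T.u (j + 1) = T.u (j + 1) * T.jm r a i := by
  induction i with
  | zero =>
    rw [jm_zero, sub_mul, mul_sub, smul_mul_assoc, smul_mul_assoc, mul_smul_comm, mul_smul_comm,
      one_mul, mul_one, T.eu]
  | succ i ih =>
    obtain ⟨j, rfl⟩ : ∃ k, j = k + 1 := ⟨j - 1, by omega⟩
    rw [jm_succ, mul_assoc, T.G_mul_u_lt r (by omega), ← mul_assoc, mul_assoc (T.G r i),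
      ih (by omega), ← mul_assoc, T.G_mul_u_lt r (by omega)]
    simp only [mul_assoc]

section

variable {r a : ℂ} (hr : r ≠ 0) (hrq : r + r⁻¹ = q + q⁻¹)
include hrq

lemma G_mul_u : T.G r i * T.u i = (-r⁻¹) • T.u i := by
  rw [G, add_mul, mul_assoc, du_smul, ← hrq]
  simp only [mul_smul_comm, mul_one, smul_mul_assoc, one_mul]
  module

include hr

lemma G_mul_G_inv (i : ℕ) : T.G r i * T.G r⁻¹ i = 1 := by
  have : T.u i * T.d i * (T.u i * T.d i) = (-(r + r⁻¹)) • (T.u i * T.d i) := by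
    rw [mul_assoc, ← mul_assoc (T.d i), du_smul, hrq, smul_mul_assoc, one_mul, mul_smul_comm]
  rw [G, G, add_mul, mul_add, mul_add, this]
  simp only [mul_smul_comm, mul_one, smul_mul_assoc, one_mul, smul_smul]
  match_scalars
  · field_simp
    ring
  · field_simp

lemma G_mul_G_mul_u (i : ℕ) : T.G r i * (T.G r (i + 1) * T.u i) = r • T.u (i + 1) := by
  rw [G_succ_mul_u, mul_add, G_mul_u_succ, mul_smul_comm, T.G_mul_u hrq, smul_smul,
    mul_neg, mul_inv_cancel₀ hr]
  module

lemma G_mul_G_mul_u' (i : ℕ) : T.G r (i + 1) * (T.G r i * T.u (i + 1)) = r • T.u i := by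
  rw [G_mul_u_succ, mul_add, G_succ_mul_u, mul_smul_comm, T.G_mul_u hrq, smul_smul,
    mul_neg, mul_inv_cancel₀ hr]
  module

lemma jm_mul_u (i j : ℕ) :
    T.jm r a (j + i + 2) * T.u i = r ^ 2 • (T.u i * T.jm r a (j + i)) := by
  induction j with
  | zero =>
    rw [zero_add, jm_succ, jm_succ]
    calc _ = T.G r (i + 1) * (T.G r i * (T.jm r a i * (T.G r i * (T.G r (i + 1) * T.u i)))) := by
          simp only [mul_assoc]
      _ = _ := by
        rw [T.G_mul_G_mul_u hr hrq, mul_smul_comm, T.jm_mul_u_far _ _ le_rfl]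
        simp only [mul_smul_comm]
        rw [← mul_assoc (T.G r i), ← mul_assoc (T.G r (i + 1)), T.G_mul_G_mul_u' hr hrq,
          smul_mul_assoc, smul_smul, sq]
  | succ j ih =>
    rw [show j + 1 + i + 2 = (j + i + 2) + 1 by ring, jm_succ, mul_assoc,
      T.G_mul_u_far r (by omega), ← mul_assoc, mul_assoc (T.G r _), ih, mul_smul_comm,
      ← mul_assoc, T.G_mul_u_far r (by omega), show j + 1 + i = j + i + 1 by ring, jm_succ]
    simp only [smul_mul_assoc, mul_assoc]

lemma jm_mul_ud (i j : ℕ) :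
    T.jm r a (j + i + 2) * (T.u i * T.d i) = T.u i * T.d i * T.jm r a (j + i + 2) := by
  have h := T.jm_mul_u (a := a) hr hrq i j
  have h' := congrArg T.tr h
  rw [T.tr_mul, map_smul, T.tr_mul, tr_jm, tr_jm, tr_u] at h'
  rw [← mul_assoc, h, mul_assoc, h', mul_smul_comm, smul_mul_assoc, mul_assoc]

lemma jm_mul_G (s : ℂ) (i j : ℕ) :
    T.jm r a (j + i + 2) * T.G s i = T.G s i * T.jm r a (j + i + 2) := by
  rw [G, mul_add, add_mul, T.jm_mul_ud hr hrq, mul_smul_comm, smul_mul_assoc, one_mul, mul_one]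

variable (ha : a ≠ 0) (hy : (a - a⁻¹) * y = -(r⁻¹ * a - r * a⁻¹))
include hy

omit hr in
lemma jm_one_mul_e : T.jm r a 1 * T.e = T.e * T.jm r a 1 := by
  have h1 : T.u 0 * T.d 0 * (T.u 0 * T.d 0) = (-(r + r⁻¹)) • (T.u 0 * T.d 0) := by
    rw [mul_assoc, ← mul_assoc (T.d 0), du_smul, hrq, smul_mul_assoc, one_mul, mul_smul_comm]
  have h2 : T.u 0 * T.d 0 * T.e * (T.u 0 * T.d 0) = y • (T.u 0 * T.d 0) := by
    rw [mul_assoc (T.u 0), mul_assoc (T.u 0), ← mul_assoc (T.d 0 * T.e), mul_assoc (T.d 0),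
      deu_smul, smul_mul_assoc, one_mul, mul_smul_comm]
  have hl : T.jm r a 1 = (a * r ^ 2) • 1 + (a * (r - r⁻¹) + r⁻¹ * a - r * a⁻¹) • (T.u 0 * T.d 0)
      - ((a - a⁻¹) * r) • (T.u 0 * T.d 0 * T.e + T.e * (T.u 0 * T.d 0))
      - ((a - a⁻¹) * r ^ 2) • T.e := by
    have : a * (r - r⁻¹) + r⁻¹ * a - r * a⁻¹ = a * (r - r⁻¹) - (a - a⁻¹) * y := by
      rw [hy]; ring
    rw [jm_succ, jm_zero, G, this]
    simp only [mul_sub, sub_mul, mul_add, add_mul, mul_smul_comm, smul_mul_assoc, mul_one, one_mul,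
      h1, h2]
    module
  generalize T.u 0 * T.d 0 = U at hl
  rw [hl]
  simp only [mul_sub, sub_mul, mul_add, add_mul, mul_smul_comm, smul_mul_assoc, mul_one, one_mul,
    ← mul_assoc, T.ee, mul_assoc U]
  module

omit hr in
lemma jm_mul_e (k : ℕ) : T.jm r a k * T.e = T.e * T.jm r a k := by
  cases k with
  | zero =>
    rw [jm_zero, sub_mul, mul_sub, smul_mul_assoc, smul_mul_assoc, mul_smul_comm, mul_smul_comm,
      one_mul, mul_one]
  | succ k =>
    induction k with
    | zero => exact T.jm_one_mul_e hrq hy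
    | succ k ih =>
      rw [jm_succ, mul_assoc, ← T.e_mul_G, ← mul_assoc, mul_assoc (T.G r _), ih, ← mul_assoc,
        ← T.e_mul_G]
      simp only [mul_assoc]

/-- The Jucys–Murphy elements slide through half diagrams. -/
lemma jm_mul_Y (w : List Bool) (j : ℕ) :
    r ^ (pos w).natAbs • (T.jm r a (j + w.length) * T.Y w) =
      r ^ w.length • (T.Y w * T.jm r a (j + (pos w).natAbs)) := by
  induction w generalizing j with
  | nil => simp
  | cons b w ih =>
    have ih := ih (j + 1)
    rw [show j + 1 + w.length = j + (b :: w).length by simp; omega] at ih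
    have h1 : r ^ (pos w).natAbs • (T.jm r a (j + (b :: w).length) * T.Y (b :: w)) =
        r ^ w.length • (T.Y w * (T.jm r a (j + 1 + (pos w).natAbs) * T.st (pos w) b)) := by
      rw [Y_cons, ← mul_assoc, ← smul_mul_assoc, ih, smul_mul_assoc, mul_assoc]
    rcases direction_cases (pos w) b with ⟨h0, rfl⟩ | rfl | ⟨k, hk, rfl⟩
    · rw [h0, Int.natAbs_zero, pow_zero, one_smul, st_down_zero, add_zero,
        T.jm_mul_e hrq hy] at h1
      rw [h1, Y_cons, pos_cons, h0, st_down_zero, smul_smul, List.length_cons, mul_assoc,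
        pow_succ']
      simp
    · rw [pos_cons, natAbs_add_away, pow_succ', ← smul_smul, h1, Y_away, st_away, mul_one,
        smul_smul, List.length_cons, pow_succ', add_assoc, add_comm 1]
    · rw [hk, T.st_toward hk, show j + 1 + (k + 1) = j + k + 2 by ring, T.jm_mul_u hr hrq,
        mul_smul_comm, smul_smul] at h1
      rw [pos_cons, natAbs_add_not_away hk, Y_cons, T.st_toward hk]
      rw [Y_cons, T.st_toward hk] at h1
      have h2 := congrArg (fun x => r⁻¹ • x) h1
      simp only [smul_smul] at h2
      rw [pow_succ', ← mul_assoc, inv_mul_cancel₀ hr, one_mul] at h2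
      rw [h2, mul_assoc, List.length_cons]
      congr 1
      field_simp
      ring

include ha

lemma jm_succ_mul_u (h : ℕ) :
    T.jm r a (h + 1) * T.u h = r ^ (2 * h) • (T.jm r⁻¹ a⁻¹ h * T.u h) := by
  have hr' : r⁻¹ + r⁻¹⁻¹ = q + q⁻¹ := by rw [inv_inv, add_comm, hrq]
  induction h with
  | zero =>
    rw [jm_succ, jm_zero, jm_zero, mul_assoc, mul_assoc, T.G_mul_u hrq, mul_smul_comm,
      mul_smul_comm, sub_mul, mul_sub, smul_mul_assoc, smul_mul_assoc, mul_smul_comm,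
      mul_smul_comm, one_mul, T.G_mul_u hrq, G, add_mul, mul_assoc (T.u 0), deu_smul,
      sub_mul, smul_mul_assoc, smul_mul_assoc, smul_mul_assoc, mul_smul_comm, one_mul, one_mul,
      mul_one, inv_inv, smul_add, smul_smul _ y, hy]
    match_scalars
    · field_simp; ring
    · field_simp; ring
  | succ h ih =>
    have e1 := T.G_mul_G_mul_u (inv_ne_zero hr) hr' h
    have e2 : T.G r (h + 1) * T.u h = r • (T.G r⁻¹ h * T.u (h + 1)) := by
      rw [G_succ_mul_u, G_mul_u_succ, smul_add, smul_smul, mul_inv_cancel₀ hr, one_smul, add_comm]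
    have e3 : T.u (h + 1) = r • (T.G r⁻¹ h * (T.G r⁻¹ (h + 1) * T.u h)) := by
      rw [e1, smul_smul, mul_inv_cancel₀ hr, one_smul]
    have e4 := T.jm_mul_G (a := a) hr hrq r⁻¹ h 0
    rw [zero_add] at e4
    have e5 : T.jm r⁻¹ a⁻¹ h * T.G r (h + 1) = T.G r (h + 1) * T.jm r⁻¹ a⁻¹ h := by
      have f1 := T.jm_mul_u_far r⁻¹ a⁻¹ (le_refl h)
      have f2 := congrArg T.tr f1
      rw [T.tr_mul, T.tr_mul, tr_jm, tr_u] at f2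
      rw [G, mul_add, add_mul, ← mul_assoc, f1, mul_assoc, ← f2, mul_assoc, smul_mul_assoc,
        mul_smul_comm, one_mul, mul_one]
    calc _ = r • (T.G r⁻¹ h * (T.jm r a (h + 2) * (T.G r⁻¹ (h + 1) * T.u h))) := by
          rw [e3, mul_smul_comm, ← mul_assoc, e4, mul_assoc]
      _ = r • (T.G r⁻¹ h * (T.G r (h + 1) * (T.jm r a (h + 1) * T.u h))) := by
          rw [T.jm_succ _ _ (h + 1), mul_assoc _ (T.G r (h + 1)), ← mul_assoc (T.G r (h + 1)) (T.G r⁻¹ _),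
            T.G_mul_G_inv hr hrq, one_mul, mul_assoc]
      _ = _ := by
          rw [ih, mul_smul_comm, mul_smul_comm, ← mul_assoc (T.G r _), ← e5, mul_assoc, e2,
            jm_succ, show 2 * (h + 1) = 2 * h + 1 + 1 by ring]
          simp only [mul_smul_comm, smul_smul, mul_assoc]
          congr 1
          ring

end

end CupCap

namespace CupCap

variable {q y : ℂ} {A : Type*} [Ring A] [Algebra ℂ A] (T : CupCap q y A)

/-- The span of the diagrams with upper half in `S` and lower half in `S'`. -/
def M (S S' : Set (List Bool)) : Submodule ℂ A :=
  Submodule.span ℂ {x | ∃ a b, a ∈ S ∧ b ∈ S' ∧ pos a = pos b ∧ x = T.Y a * T.tr (T.Y b)}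

lemma mem_M {S S' : Set (List Bool)} {a b : List Bool} (ha : a ∈ S) (hb : b ∈ S')
    (h : pos a = pos b) : T.Y a * T.tr (T.Y b) ∈ T.M S S' :=
  Submodule.subset_span ⟨a, b, ha, hb, h, rfl⟩

lemma tr_mem_M {S S' : Set (List Bool)} {x : A} (hx : x ∈ T.M S S') : T.tr x ∈ T.M S' S := by
  induction hx using Submodule.span_induction with
  | mem x hx =>
    obtain ⟨a, b, ha, hb, h, rfl⟩ := hx
    rw [T.tr_mul, T.tr_tr]
    exact T.mem_M hb ha h.symm
  | zero => rw [map_zero]; exact zero_mem _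
  | add x y _ _ hx hy => rw [map_add]; exact add_mem hx hy
  | smul r x _ hx => rw [map_smul]; exact Submodule.smul_mem _ _ hx

lemma F_mul_tr_mem_M {S₀ S S' : Set (List Bool)} {b : List Bool}
    (h1 : ∀ v ∈ S₀, Above (pos v) (pos b) → v ∈ S)
    (h2 : ∀ t, Dom t b → Above (pos t) (pos b) → t ∈ S') {x : A} (hx : x ∈ T.F S₀ (pos b)) :
    x * T.tr (T.Y b) ∈ T.M S S' := by
  induction hx using Submodule.span_induction with
  | mem x hx =>
    obtain ⟨v, c, hv, e1, e2, e3, rfl⟩ := hx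
    obtain ⟨t, f1, f2, f3⟩ := T.Y_mul_tr_mul_tr (v := v) e1 e2 rfl
    have := above_of_startsNeg e1 e2
    rw [f3]
    exact T.mem_M (h1 v hv (e3 ▸ this)) (h2 t f1 (f2 ▸ this)) (by rw [e3, f2])
  | zero => rw [zero_mul]; exact zero_mem _
  | add x y _ _ hx hy => rw [add_mul]; exact add_mem hx hy
  | smul r x _ hx => rw [smul_mul_assoc]; exact Submodule.smul_mem _ _ hx

/-- Sets of positions closed under moving up in the order `Above`. -/
def UpClosed (n : ℕ) (P : ℤ → Prop) : Prop := ∀ x p : ℤ, |p| ≤ n → Above x p → P p → P x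

/-- The walks of length `n` ending in `P`. -/
def endsIn (n : ℕ) (P : ℤ → Prop) : Set (List Bool) := {v | v.length = n ∧ P (pos v)}

/-- The walks of length `n` starting to the left and ending in `P`. -/
def negEndsIn (n : ℕ) (P : ℤ → Prop) : Set (List Bool) :=
  {v | v.length = n ∧ P (pos v) ∧ v.getLast? = some false}

section

variable {n : ℕ} {P : ℤ → Prop} (hP : UpClosed n P)
include hP

lemma mem_endsIn_of_dom {t b : List Bool} (hb : b ∈ endsIn n P) (h : Dom t b)
    (h' : Above (pos t) (pos b)) : t ∈ endsIn n P :=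
  ⟨h.length_eq.trans hb.1, hP _ _ (hb.1 ▸ abs_pos_le b) h' hb.2⟩

lemma mem_negEndsIn_of_dom {t b : List Bool} (hb : b ∈ negEndsIn n P) (h : Dom t b)
    (h' : Above (pos t) (pos b)) : t ∈ negEndsIn n P :=
  ⟨h.length_eq.trans hb.1, hP _ _ (hb.1 ▸ abs_pos_le b) h' hb.2.1, h.getLast hb.2.2⟩

lemma alg_mul_mem_M {a x : A} (ha : a ∈ T.alg n) (hx : x ∈ T.M (endsIn n P) (endsIn n P)) :
    a * x ∈ T.M (endsIn n P) (endsIn n P) := by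
  induction hx using Submodule.span_induction with
  | mem x hx =>
    obtain ⟨v, b, hv, hb, h, rfl⟩ := hx
    rw [← mul_assoc]
    have := T.alg_mul_Y ha hv.1
    rw [h] at this
    exact T.F_mul_tr_mem_M (S₀ := walks n) (S := endsIn n P) (S' := endsIn n P)
      (fun v hv h' => ⟨hv, hP _ _ (hb.1 ▸ abs_pos_le b) h' hb.2⟩)
      (fun t => mem_endsIn_of_dom hP hb) this
  | zero => rw [mul_zero]; exact zero_mem _
  | add x y _ _ hx hy => rw [mul_add]; exact add_mem hx hy
  | smul r x _ hx => rw [mul_smul_comm]; exact Submodule.smul_mem _ _ hx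

lemma mul_alg_mem_M {a x : A} (ha : a ∈ T.alg n) (hx : x ∈ T.M (endsIn n P) (endsIn n P)) :
    x * a ∈ T.M (endsIn n P) (endsIn n P) := by
  rw [← T.tr_tr (x * a), T.tr_mul]
  exact T.tr_mem_M (T.alg_mul_mem_M hP (T.tr_mem_alg ha) (T.tr_mem_M hx))

lemma e_mul_mem_M (hn : 1 ≤ n) {S' : Set (List Bool)}
    (hS' : ∀ b ∈ S', ∀ t, Dom t b → Above (pos t) (pos b) → t ∈ S') {x : A}
    (hx : x ∈ T.M (endsIn n P) S') : T.e * x ∈ T.M (negEndsIn n P) S' := by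
  induction hx using Submodule.span_induction with
  | mem x hx =>
    obtain ⟨v, b, hv, hb, h, rfl⟩ := hx
    rw [← mul_assoc]
    have := T.e_mul_Y_neg v (by rintro rfl; have := hv.1; simp at this; omega)
    rw [h] at this
    refine T.F_mul_tr_mem_M (S₀ := negWalks v.length) (S := negEndsIn n P)
      (fun w hw h' => ⟨hw.1.trans hv.1, ?_, hw.2⟩) (hS' b hb) this
    exact hP _ _ (hv.1 ▸ abs_pos_le v) (h ▸ h') hv.2
  | zero => rw [mul_zero]; exact zero_mem _
  | add x y _ _ hx hy => rw [mul_add]; exact add_mem hx hy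
  | smul r x _ hx => rw [mul_smul_comm]; exact Submodule.smul_mem _ _ hx

lemma e_mul_e_mem_M (hn : 1 ≤ n) {x : A} (hx : x ∈ T.M (endsIn n P) (endsIn n P)) :
    T.e * x * T.e ∈ T.M (negEndsIn n P) (negEndsIn n P) := by
  have h1 := T.e_mul_mem_M hP hn (fun b hb t => mem_endsIn_of_dom hP hb) hx
  have h2 := T.e_mul_mem_M hP hn (fun b hb t => mem_negEndsIn_of_dom hP hb) (T.tr_mem_M h1)
  have h3 := T.tr_mem_M h2
  rwa [T.tr_mul, T.tr_tr, T.tr_e] at h3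

end

lemma e_mem_alg {n : ℕ} (hn : 1 ≤ n) : T.e ∈ T.alg n := Algebra.subset_adjoin (Or.inl ⟨hn, rfl⟩)

lemma ud_mem_alg {n i : ℕ} (hi : i + 1 < n) : T.u i * T.d i ∈ T.alg n :=
  Algebra.subset_adjoin (Or.inr ⟨i, hi, rfl⟩)

lemma G_mem_alg {n i : ℕ} (r : ℂ) (hi : i + 1 < n) : T.G r i ∈ T.alg n :=
  add_mem (T.ud_mem_alg hi) (Subalgebra.smul_mem _ (one_mem _) _)

lemma Y_replicate_append {w : List Bool} (h : 0 ≤ pos w) (k : ℕ) :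
    T.Y (List.replicate k true ++ w) = T.Y w ∧
      pos (List.replicate k true ++ w) = pos w + k := by
  induction k with
  | zero => simp
  | succ k ih =>
    rw [List.replicate_succ, List.cons_append, Y_cons, pos_cons, ih.1, ih.2]
    refine ⟨?_, by push_cast; simp [add_assoc]⟩
    have := T.st_away (pos w + k)
    rw [away_nonneg (by omega)] at this
    rw [this, mul_one]

lemma ud_mem_M {n i : ℕ} {P : ℤ → Prop} (hi : i + 1 < n) (hP : P (n - 2)) :
    T.u i * T.d i ∈ T.M (endsIn n P) (endsIn n P) := by
  set w := false :: List.replicate (i + 1) true with hw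
  have hpos : pos w = i := by rw [hw, pos_cons, pos_replicate]; simp
  have hY : T.Y w = T.u i := by
    rw [hw, Y_cons, Y_replicate_true, pos_replicate, one_mul,
      show ((i + 1 : ℕ) : ℤ) * inc true = (i : ℤ) + 1 by simp, st_down_pos]
  obtain ⟨h1, h2⟩ := T.Y_replicate_append (w := w) (by omega) (n - (i + 2))
  have hm : List.replicate (n - (i + 2)) true ++ w ∈ endsIn n P := by
    refine ⟨by simp [hw]; omega, ?_⟩
    rw [h2, hpos]
    convert hP using 1
    omega
  have := T.mem_M hm hm rfl
  rwa [h1, hY, tr_u] at this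

lemma e_mem_M {n : ℕ} {P : ℤ → Prop} (hn : 1 ≤ n) (hP : P (-n)) :
    T.e ∈ T.M (endsIn n P) (endsIn n P) := by
  obtain ⟨k, rfl⟩ : ∃ k, n = k + 1 := ⟨n - 1, by omega⟩
  have hm : List.replicate (k + 1) false ∈ endsIn (k + 1) P := by
    refine ⟨by simp, ?_⟩
    rw [pos_replicate]
    simpa using hP
  have := T.mem_M hm hm rfl
  rwa [Y_replicate_false, tr_e, T.ee] at this

lemma jm_sub_mem_M (r a : ℂ) {n : ℕ} {P : ℤ → Prop} (hP : UpClosed n P)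
    (hU : 2 ≤ n → P (n - 2)) {h : ℕ} (hn : h < n) :
    T.jm r a h - r ^ (2 * h) • T.jm r a 0 ∈ T.M (endsIn n P) (endsIn n P) := by
  induction h with
  | zero => simp
  | succ h ih =>
    have hG := T.G_mem_alg r hn
    have h0 : T.jm r a 0 ∈ T.alg n :=
      sub_mem (Subalgebra.smul_mem _ (one_mem _) _)
        (Subalgebra.smul_mem _ (T.e_mem_alg (by omega)) _)
    have h1 := T.mul_alg_mem_M hP hG (T.alg_mul_mem_M hP hG (ih (by omega)))
    have hud := T.ud_mem_M hn (hU (by omega))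
    have h2 := T.mul_alg_mem_M hP hG (T.mul_alg_mem_M hP h0 hud)
    have h3 := T.alg_mul_mem_M hP h0 hud
    have h4 := add_mem h1 (Submodule.smul_mem _ (r ^ (2 * h)) (add_mem h2
      (Submodule.smul_mem _ r h3)))
    convert h4 using 1
    rw [jm_succ]
    have hG' : T.G r h = T.u h * T.d h + r • 1 := rfl
    rw [show 2 * (h + 1) = 2 * h + 1 + 1 by ring]
    generalize T.jm r a 0 = L0
    generalize T.jm r a h = L
    rw [hG']
    generalize T.u h * T.d h = U
    simp only [mul_add, add_mul, mul_sub, sub_mul, mul_smul_comm, smul_mul_assoc, mul_one,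
      one_mul, mul_assoc]
    match_scalars <;> ring

/-- The walks strictly dominating `w`. -/
def strict (w : List Bool) : Set (List Bool) := {v | Dom v w ∧ v ≠ w}

lemma Y_mul_mem_strict {w : List Bool} {n : ℕ} (hn : (pos w).natAbs = n) {S : Set (List Bool)}
    (hS : ∀ v ∈ S, v.length = n ∧ pos v ≠ pos w ∧ StartsNeg (pos w) v) {x : A}
    (hx : x ∈ T.M S S) : T.Y w * x ∈ T.F (strict w) (pos w) := by
  induction hx using Submodule.span_induction with
  | mem x hx =>
    obtain ⟨a, b, ha, hb, h, rfl⟩ := hx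
    obtain ⟨v, e1, e2, e3⟩ := T.Y_mul_Y w a ((hS a ha).1.trans hn.symm) (hS a ha).2.2
    rw [← mul_assoc, e3]
    refine T.mem_F ⟨e1, ?_⟩ ((hS b hb).1.trans hn.symm) (hS b hb).2.2 (by rw [e2, h])
    rintro rfl
    exact (hS a ha).2.1 e2.symm
  | zero => rw [mul_zero]; exact zero_mem _
  | add x y _ _ hx hy => rw [mul_add]; exact add_mem hx hy
  | smul r x _ hx => rw [mul_smul_comm]; exact Submodule.smul_mem _ _ hx

lemma upClosed_ne (n : ℕ) : UpClosed n (fun x => x ≠ n) := by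
  rintro x p hp ⟨h1, h2⟩ hpn rfl
  rw [Nat.abs_cast] at h1 h2
  have := h2 (le_antisymm h1 hp)
  have := le_abs_self p
  exact hpn (by omega)

lemma upClosed_abs_ne (n : ℕ) : UpClosed n (fun x => |x| ≠ n) := by
  rintro x p hp ⟨h1, -⟩ hpn hx
  exact hpn (le_antisymm hp (hx ▸ h1))

section

variable {r a : ℂ} (hr : r ≠ 0) (hrq : r + r⁻¹ = q + q⁻¹) (ha : a ≠ 0)
  (hy : (a - a⁻¹) * y = -(r⁻¹ * a - r * a⁻¹))
include hrq hy

lemma Y_mul_jm {w : List Bool} {h : ℕ} (hw : (pos w).natAbs = h + 1) :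
    T.Y w * T.jm r a h - (r ^ (2 * h) * if 0 < pos w then a else a⁻¹) • T.Y w ∈
      T.F (strict w) (pos w) := by
  split_ifs with hpos
  · have h1 := T.jm_sub_mem_M r a (upClosed_ne (h + 1)) (fun _ => by push_cast; omega)
      (Nat.lt_succ_self h)
    have h2 := sub_mem h1 (Submodule.smul_mem _ (r ^ (2 * h) * (a - a⁻¹))
      (T.e_mem_M (P := fun x => x ≠ ((h + 1 : ℕ) : ℤ)) (by omega) (by omega)))
    have h3 := T.Y_mul_mem_strict hw (S := endsIn (h + 1) (fun x => x ≠ ((h + 1 : ℕ) : ℤ)))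
      (fun v hv => ⟨hv.1, fun e => hv.2 (by omega), fun hneg => by omega⟩) h2
    convert h3 using 1
    rw [jm_zero]
    simp only [mul_sub, mul_smul_comm, mul_one, smul_sub, smul_smul]
    match_scalars <;> ring
  · have hneg : pos w < 0 := by omega
    have h1 := T.jm_sub_mem_M r a (upClosed_abs_ne (h + 1)) (fun hh => by
      rw [abs_of_nonneg] <;> push_cast <;> omega) (Nat.lt_succ_self h)
    have h2 := T.e_mul_e_mem_M (upClosed_abs_ne (h + 1)) (by omega) h1
    have h3 := T.Y_mul_mem_strict hw (fun v hv => ⟨hv.1, fun e => hv.2.1 (by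
      rw [e, Int.abs_eq_natAbs, hw]), fun _ => hv.2.2⟩) h2
    convert h3 using 1
    rw [mul_sub, sub_mul, mul_assoc, T.jm_mul_e hrq hy, jm_zero]
    simp only [mul_sub, mul_smul_comm, mul_one, smul_sub, smul_smul, smul_mul_assoc, sub_mul,
      ← mul_assoc, T.ee, T.Y_mul_e hneg]
    match_scalars <;> ring

end

end CupCap

lemma two_mul_count (w : List Bool) (c : Bool) :
    (2 * w.count c : ℤ) = w.length + inc c * pos w := by
  induction w with
  | nil => simp
  | cons b w ih => cases b <;> cases c <;> simp at ih ⊢ <;> linarith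

/-- The content of the step following a walk. -/
def stepContent (r a : ℂ) (w : List Bool) (c : Bool) : ℂ :=
  r ^ (2 * w.count c) * if c then a else a⁻¹

namespace CupCap

variable {q y : ℂ} {A : Type*} [Ring A] [Algebra ℂ A] (T : CupCap q y A)

lemma F_strict_mul_st {w : List Bool} (c : Bool) {x : A} (hx : x ∈ T.F (strict w) (pos w)) :
    x * T.st (pos w) c ∈ T.F (strict (c :: w)) (pos (c :: w)) := by
  refine T.F_mul_st (S := strict w) (S' := strict (c :: w)) c (fun v hv c' h => ⟨⟨hv.1, h⟩, ?_⟩) hx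
  intro he
  exact hv.2 (List.cons.inj he).2

section

variable {r a : ℂ} (hr : r ≠ 0) (hrq : r + r⁻¹ = q + q⁻¹) (ha : a ≠ 0)
  (hy : (a - a⁻¹) * y = -(r⁻¹ * a - r * a⁻¹))
include hr hrq ha hy

omit hrq ha hy in
lemma sub_smul_mem_of_smul {N : Submodule ℂ A} {k : ℕ} {s t : ℂ} {z x : A} (h : r ^ k * s = t)
    (hm : r ^ k • z - t • x ∈ N) : z - s • x ∈ N := by
  have := Submodule.smul_mem N (r ^ k)⁻¹ hm
  rwa [smul_sub, smul_smul, smul_smul, inv_mul_cancel₀ (pow_ne_zero _ hr), one_smul, ← h,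
    ← mul_assoc, inv_mul_cancel₀ (pow_ne_zero _ hr), one_mul] at this

lemma jm_mul_Y_last (w : List Bool) (c : Bool) :
    T.jm r a w.length * T.Y (c :: w) - stepContent r a w c • T.Y (c :: w) ∈
      T.F (strict (c :: w)) (pos (c :: w)) := by
  have hN := T.jm_mul_Y (a := a) hr hrq hy w 0
  rw [zero_add, zero_add] at hN
  have hcount := two_mul_count w c
  by_cases hdir : ∃ k, (pos w).natAbs = k + 1 ∧ c = !away (pos w)
  · obtain ⟨h, hh, rfl⟩ := hdir
    have hr' : r⁻¹ + r⁻¹⁻¹ = q + q⁻¹ := by rw [inv_inv, add_comm, hrq]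
    have hy' : (a⁻¹ - a⁻¹⁻¹) * y = -(r⁻¹⁻¹ * a⁻¹ - r⁻¹ * a⁻¹⁻¹) := by
      rw [inv_inv, inv_inv]; linear_combination -hy
    have h1 := T.F_strict_mul_st (!away (pos w)) (T.Y_mul_jm hr' hy' hh)
    rw [sub_mul, smul_mul_assoc, ← Y_cons, mul_assoc, T.st_toward hh] at h1
    have h2 : r ^ (h + 1) • (T.jm r a w.length * T.Y ((!away (pos w)) :: w)) =
        (r ^ w.length * r ^ (2 * h)) • (T.Y w * (T.jm r⁻¹ a⁻¹ h * T.u h)) := by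
      rw [Y_cons, T.st_toward hh, ← mul_assoc, ← smul_mul_assoc, ← hh, hN, hh, smul_mul_assoc,
        mul_assoc, T.jm_succ_mul_u hr hrq ha hy, mul_smul_comm, smul_smul]
    have h3 := Submodule.smul_mem _ (r ^ w.length * r ^ (2 * h)) h1
    rw [smul_sub, ← h2, smul_smul] at h3
    refine sub_smul_mem_of_smul hr ?_ h3
    have hk : 2 * w.count (!away (pos w)) + (h + 1) = w.length := by
      rcases lt_or_ge (pos w) 0 with hp | hp
      · rw [away_neg hp] at hcount ⊢
        simp at hcount ⊢; omega
      · rw [away_nonneg hp] at hcount ⊢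
        simp at hcount ⊢; omega
    rw [stepContent, ← mul_assoc, ← pow_add, add_comm, hk, inv_inv]
    have hif : (if 0 < pos w then a⁻¹ else a) = if (!away (pos w)) = true then a else a⁻¹ := by
      rcases lt_or_ge (pos w) 0 with hp | hp
      · rw [away_neg hp, if_neg (by omega)]; simp
      · rw [away_nonneg hp, if_pos (by omega)]; simp
    rw [hif, inv_pow]
    field_simp
  · have hcomm (j : ℕ) : T.jm r a j * T.st (pos w) c = T.st (pos w) c * T.jm r a j := by
      rcases direction_cases (pos w) c with ⟨h0, rfl⟩ | rfl | h
      · rw [h0, st_down_zero, T.jm_mul_e hrq hy]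
      · rw [st_away, mul_one, one_mul]
      · exact (hdir h).elim
    have hdir' : (pos w + inc c).natAbs = (pos w).natAbs + 1 ∧ (0 < pos w + inc c ↔ c = true) ∧
        inc c * pos w = (pos w).natAbs := by
      rcases direction_cases (pos w) c with ⟨h0, rfl⟩ | rfl | h
      · simp [h0]
      · refine ⟨natAbs_add_away _, ?_⟩
        rcases lt_or_ge (pos w) 0 with hp | hp
        · rw [away_neg hp, inc_false]
          exact ⟨⟨fun _ => by omega, fun h => by simp at h⟩, by omega⟩
        · rw [away_nonneg hp, inc_true]
          exact ⟨⟨fun _ => rfl, fun _ => by omega⟩, by omega⟩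
      · exact (hdir h).elim
    obtain ⟨hh, hsgn, hinc⟩ := hdir'
    set h := (pos w).natAbs
    have h1 := T.Y_mul_jm (w := c :: w) hrq hy hh
    have h2 : r ^ h • (T.jm r a w.length * T.Y (c :: w)) =
        r ^ w.length • (T.Y (c :: w) * T.jm r a h) := by
      rw [Y_cons, ← mul_assoc, ← smul_mul_assoc, hN, smul_mul_assoc, mul_assoc, hcomm, mul_assoc]
    have h3 := Submodule.smul_mem _ (r ^ w.length) h1
    rw [smul_sub, ← h2, smul_smul] at h3
    refine sub_smul_mem_of_smul hr ?_ h3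
    have hk : h + 2 * w.count c = w.length + 2 * h := by omega
    rw [stepContent, ← mul_assoc, ← mul_assoc, ← pow_add, ← pow_add, hk, pos_cons]
    simp only [hsgn]

/-- Triangularity of the Jucys–Murphy elements on half diagrams. -/
lemma jm_mul_Y_append (x w : List Bool) (c : Bool) :
    T.jm r a w.length * T.Y (x ++ c :: w) - stepContent r a w c • T.Y (x ++ c :: w) ∈
      T.F (strict (x ++ c :: w)) (pos (x ++ c :: w)) := by
  induction x with
  | nil => exact T.jm_mul_Y_last hr hrq ha hy w c
  | cons b x ih =>
    have := T.F_strict_mul_st b ih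
    rwa [sub_mul, smul_mul_assoc, mul_assoc, ← Y_cons] at this

end

end CupCap

namespace CupCap

variable {q y : ℂ} {A : Type*} [Ring A] [Algebra ℂ A] (T : CupCap q y A)

/-! ### The cellular structure -/

lemma eq_straight {b : List Bool} {p : ℤ} (hl : b.length = p.natAbs) (hp : pos b = p) :
    b = straight p := by
  induction b generalizing p with
  | nil => simp [straight, ← hl]
  | cons c b ih =>
    have h := abs_pos_le b
    rw [abs_le] at h
    rw [List.length_cons] at hl
    rw [pos_cons] at hp
    cases c
    · rw [inc_false] at hp
      have h1 : p < 0 := by omega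
      rw [ih (p := p + 1) (by omega) (by omega), straight, straight, away_neg h1,
        show p.natAbs = (p + 1).natAbs + 1 by omega, List.replicate_succ]
      congr 1
      rcases lt_or_ge (p + 1) 0 with h2 | h2
      · rw [away_neg h2]
      · simp [show p + 1 = 0 by omega]
    · rw [inc_true] at hp
      have h1 : 0 < p := by omega
      rw [ih (p := p - 1) (by omega) (by omega), straight, straight, away_nonneg h1.le,
        away_nonneg (by omega), show p.natAbs = (p - 1).natAbs + 1 by omega,
        List.replicate_succ]

/-- Morphisms act on half diagrams triangularly. -/
lemma cell_of_mem_F {S : Set (List Bool)} {p : ℤ} {x : A} (hx : x ∈ T.F S p) :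
    ∃ r ∈ Finsupp.supported ℂ ℂ {v | v ∈ S ∧ pos v = p}, ∀ t, pos t = p →
      x * T.tr (T.Y t) - Finsupp.linearCombination ℂ (fun v => T.Y v * T.tr (T.Y t)) r ∈
        T.M S {b | b.length = t.length ∧ Above (pos b) p ∧ pos b ≠ p} := by
  induction hx using Submodule.span_induction with
  | mem x hx =>
    obtain ⟨v, b, hv, h1, h2, h3, rfl⟩ := hx
    by_cases hp : pos b = p
    · refine ⟨Finsupp.single v 1, Finsupp.single_mem_supported ℂ 1 ⟨hv, h3.trans hp⟩,
        fun t ht => ?_⟩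
      rw [Finsupp.linearCombination_single, one_smul, eq_straight h1 hp, tr_Y_straight,
        Y_mul_straight _ (h3.trans hp), sub_self]
      exact zero_mem _
    · refine ⟨0, zero_mem _, fun t ht => ?_⟩
      obtain ⟨t', e1, e2, e3⟩ := T.Y_mul_tr_mul_tr (v := v) h1 h2 ht
      rw [map_zero, sub_zero, e3]
      refine T.mem_M hv ⟨e1.length_eq, ?_, e2 ▸ hp⟩ (h3.trans e2.symm)
      rw [e2]
      exact above_of_startsNeg h1 h2
  | zero => exact ⟨0, zero_mem _, fun t _ => by simp⟩
  | add x z _ _ hx hz =>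
    obtain ⟨r, hr, hr'⟩ := hx
    obtain ⟨s, hs, hs'⟩ := hz
    refine ⟨r + s, add_mem hr hs, fun t ht => ?_⟩
    have := add_mem (hr' t ht) (hs' t ht)
    rwa [map_add, add_mul, add_sub_add_comm]
  | smul c x _ hx =>
    obtain ⟨r, hr, hr'⟩ := hx
    refine ⟨c • r, Submodule.smul_mem _ _ hr, fun t ht => ?_⟩
    have := Submodule.smul_mem _ c (hr' t ht)
    rwa [map_smul, smul_mul_assoc, ← smul_sub]

end CupCap

namespace CupCap

variable {q y : ℂ} {A : Type*} [Ring A] [Algebra ℂ A] (T : CupCap q y A)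

/-! ### Cellular elements lie in the subalgebra generated by the diagrams -/

lemma dd {i j : ℕ} (h : i ≤ j) : T.d i * T.d (j + 2) = T.d j * T.d i := by
  have := congrArg T.tr (T.uu i j h)
  rwa [T.tr_mul, T.tr_mul] at this

lemma pow_mul_of_shift {B : Type*} [Ring B] {x : ℕ → B} {z : B} {j : ℕ} (h : ∀ k, j ≤ k → z * x (k + 2) = x k * z)
    (r : ℕ) : z ^ r * x (j + 2 * r) = x j * z ^ r := by
  induction r with
  | zero => simp
  | succ r ih =>
    rw [pow_succ, mul_assoc, show j + 2 * (r + 1) = j + 2 * r + 2 by ring, h _ (by omega),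
      ← mul_assoc, ih, mul_assoc]

lemma d_pow_mul_ud_mul_u_pow (k r : ℕ) :
    T.d k ^ r * (T.u (k + 2 * r) * T.d (k + 2 * r)) * T.u (k + 1) ^ r = T.u k * T.d k := by
  rw [← mul_assoc, pow_mul_of_shift (fun j hj => T.du_lt hj), mul_assoc (T.u k),
    pow_mul_of_shift (fun j hj => T.dd hj), mul_assoc, mul_assoc,
    pow_mul_pow_eq_one _ (T.du_up k), mul_one]

lemma d_pow_succ_mul_ud_mul_u_pow (k r : ℕ) :
    T.d k ^ (r + 1) * (T.u (k + 1 + 2 * r) * T.d (k + 1 + 2 * r)) * T.u (k + 1) ^ r =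
      T.d (k + 1) := by
  rw [← mul_assoc, pow_succ', mul_assoc (T.d k),
    pow_mul_of_shift (fun j hj => T.du_lt (by omega)), ← mul_assoc, T.du_up, one_mul,
    pow_mul_of_shift (fun j hj => T.dd (by omega)), mul_assoc,
    pow_mul_pow_eq_one _ (T.du_up k), mul_one]

lemma d_pow_mul_e_mul_u_pow (r : ℕ) : T.d 1 ^ r * T.e * T.u 0 ^ r = T.e := by
  have h : Commute T.e (T.d 1 ^ r) := Commute.pow_right (T.ed 0) r
  rw [← h.eq, mul_assoc, pow_mul_pow_eq_one _ (T.du_down 0), mul_one]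

lemma tr_pow (x : A) (r : ℕ) : T.tr (x ^ r) = T.tr x ^ r := by
  induction r with
  | zero => simp [tr_one]
  | succ r ih => rw [pow_succ, T.tr_mul, ih, pow_succ']

/-- A straight walk to `p` followed by excursions away from `0`. -/
def loops (p : ℤ) : ℕ → List Bool
  | 0 => straight p
  | r + 1 => (!away p) :: away p :: loops p r

@[simp] lemma length_loops (p : ℤ) (r : ℕ) : (loops p r).length = p.natAbs + 2 * r := by
  induction r with
  | zero => simp [loops]
  | succ r ih => simp [loops, ih]; ring

@[simp] lemma pos_loops (p : ℤ) (r : ℕ) : pos (loops p r) = p := by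
  induction r with
  | zero => simp [loops]
  | succ r ih => simp [loops, ih, inc_not]

lemma Y_loops (p : ℤ) (r : ℕ) : T.Y (loops p r) = T.Y (straight p) * T.u p.natAbs ^ r := by
  induction r with
  | zero => simp [loops]
  | succ r ih =>
    rw [loops, Y_cons, Y_cons, pos_cons, pos_loops, st_away, st_back, mul_one, ih, pow_succ,
      mul_assoc]

lemma straight_commute_d (p : ℤ) {j : ℕ} (hj : p < 0 → j ≠ 0) (r : ℕ) :
    Commute (T.Y (straight p)) (T.d j ^ r) := by
  rcases lt_or_ge p 0 with h | h
  · obtain ⟨k, rfl⟩ := Nat.exists_eq_succ_of_ne_zero (hj h)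
    rw [Y_straight_neg _ h]
    exact Commute.pow_right (T.ed k) r
  · rw [Y_straight_nonneg _ h]
    exact Commute.one_left _

lemma Y_mul_tr_loops {s : List Bool} (r : ℕ) :
    T.Y s * T.tr (T.Y (loops (pos s) r)) = T.Y s * T.d (pos s).natAbs ^ r := by
  rw [Y_loops, T.tr_mul, tr_Y_straight, tr_pow, tr_u,
    ← (T.straight_commute_d (pos s) (by omega) r).eq, ← mul_assoc, Y_mul_straight _ rfl]

lemma alg_mono {n : ℕ} : T.alg n ≤ T.alg (n + 1) := by
  apply Algebra.adjoin_mono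
  rintro x (⟨h, rfl⟩ | ⟨i, h, rfl⟩)
  · exact Or.inl ⟨by omega, rfl⟩
  · exact Or.inr ⟨i, by omega, rfl⟩

/-- The half diagrams in `S` pair into the subalgebra generated by the diagrams. -/
def Pairs (n : ℕ) (P : ℤ → Prop) : Prop := ∀ s t : List Bool, s.length = n → t.length = n →
  pos s = pos t → P (pos s) → T.Y s * T.tr (T.Y t) ∈ T.alg n

section

variable {T} {n : ℕ} {P : ℤ → Prop} (hP : T.Pairs n P)
include hP

lemma Pairs.mul_d_pow {s : List Bool} {r : ℕ} (hs : s.length = n) (hr : (pos s).natAbs + 2 * r = n)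
    (hp : P (pos s)) : T.Y s * T.d (pos s).natAbs ^ r ∈ T.alg n := by
  rw [← T.Y_mul_tr_loops]
  exact hP _ _ hs (by simp [hr]) (by simp) hp

lemma Pairs.u_pow_mul {t : List Bool} {r : ℕ} (ht : t.length = n) (hr : (pos t).natAbs + 2 * r = n)
    (hp : P (pos t)) : T.u (pos t).natAbs ^ r * T.tr (T.Y t) ∈ T.alg n := by
  have := T.tr_mem_alg (hP.mul_d_pow ht hr hp)
  rwa [T.tr_mul, tr_pow, tr_d] at this

lemma Pairs.mul_d_pred_pow {s : List Bool} {k r : ℕ} (hs : s.length = n)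
    (hk : (pos s).natAbs = k + 1) (hr : k + 1 + 2 * r = n) (hp : P (pos s)) :
    T.Y s * T.d k ^ r ∈ T.alg n := by
  obtain ⟨c, g, h1, h2, h3, h4, h5⟩ : ∃ c g, pos s = g + inc c ∧ g.natAbs = k ∧
      T.Y s * T.tr (T.st g c) = T.Y s ∧ T.Y s * T.Y (straight g) = T.Y s ∧ (g < 0 → k ≠ 0) := by
    rcases lt_or_ge (pos s) 0 with h | h
    · refine ⟨false, pos s + 1, by simp, by omega, ?_, ?_, by omega⟩
      · cases k with
        | zero =>
          rw [show pos s + 1 = 0 by omega, st_down_zero, tr_e, T.Y_mul_e h]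
        | succ k =>
          rw [show pos s + 1 = -(k + 1) by omega, st_down_neg, tr_one, mul_one]
      · rcases lt_or_ge (pos s + 1) 0 with h' | h'
        · rw [Y_straight_neg _ h', T.Y_mul_e h]
        · rw [Y_straight_nonneg _ h', mul_one]
    · refine ⟨true, pos s - 1, by simp, by omega, ?_, ?_, by omega⟩
      · rw [show pos s - 1 = k by omega, st_up, tr_one, mul_one]
      · rw [Y_straight_nonneg _ (by omega), mul_one]
  have := hP s (c :: loops g r) hs (by simp [h2]; omega) (by simp [h1]) hp
  rwa [Y_cons, pos_loops, T.tr_mul, ← mul_assoc, h3, Y_loops, T.tr_mul, tr_Y_straight, tr_pow,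
    tr_u, ← (T.straight_commute_d g (h2 ▸ h5) r).eq, ← mul_assoc, h4, h2] at this

lemma Pairs.u_pred_pow_mul {t : List Bool} {k r : ℕ} (ht : t.length = n)
    (hk : (pos t).natAbs = k + 1) (hr : k + 1 + 2 * r = n) (hp : P (pos t)) :
    T.u k ^ r * T.tr (T.Y t) ∈ T.alg n := by
  have := T.tr_mem_alg (hP.mul_d_pred_pow ht hk hr hp)
  rwa [T.tr_mul, tr_pow, tr_d] at this

end

/-- A walk of length `n` makes excursions of total length `n - |pos|`. -/
lemma exists_excursion (w : List Bool) : ∃ r, (pos w).natAbs + 2 * r = w.length := by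
  induction w with
  | nil => exact ⟨0, by simp⟩
  | cons c w ih =>
    obtain ⟨r, hr⟩ := ih
    rw [pos_cons, List.length_cons]
    cases c <;> rw [← hr]
    · rw [inc_false]
      rcases lt_or_ge 0 (pos w) with h | h
      · exact ⟨r + 1, by omega⟩
      · exact ⟨r, by omega⟩
    · rw [inc_true]
      rcases lt_or_ge (pos w) 0 with h | h
      · exact ⟨r + 1, by omega⟩
      · exact ⟨r, by omega⟩

lemma toward_toward_mem {n : ℕ} (hP : T.Pairs n fun _ => True) {s t : List Bool} {k : ℕ}
    (hs : s.length = n) (ht : t.length = n) (hsk : (pos s).natAbs = k + 1)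
    (htk : (pos t).natAbs = k + 1) :
    T.Y s * (T.u k * T.d k) * T.tr (T.Y t) ∈ T.alg (n + 1) := by
  obtain ⟨r, hr⟩ := exists_excursion s
  rw [hsk, hs] at hr
  rw [← T.d_pow_mul_ud_mul_u_pow k r, ← mul_assoc, ← mul_assoc, mul_assoc _ (T.u (k + 1) ^ r)]
  refine mul_mem (mul_mem (T.alg_mono (hP.mul_d_pred_pow hs hsk hr trivial))
    (T.ud_mem_alg (by omega))) (T.alg_mono ?_)
  have := hP.u_pow_mul (r := r) ht (by omega) trivial
  rwa [htk] at this

lemma away_toward_mem {n : ℕ} (hP : T.Pairs n fun _ => True) {s t : List Bool} {k : ℕ}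
    (hs : s.length = n) (ht : t.length = n) (hsk : (pos s).natAbs = k)
    (htk : (pos t).natAbs = k + 2) :
    T.Y s * T.d (k + 1) * T.tr (T.Y t) ∈ T.alg (n + 1) := by
  obtain ⟨r, hr⟩ := exists_excursion t
  rw [htk, ht] at hr
  rw [← T.d_pow_succ_mul_ud_mul_u_pow k r, ← mul_assoc, ← mul_assoc,
    mul_assoc _ (T.u (k + 1) ^ r)]
  refine mul_mem (mul_mem (T.alg_mono ?_) (T.ud_mem_alg (by omega)))
    (T.alg_mono (hP.u_pred_pow_mul ht htk (by omega) trivial))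
  have := hP.mul_d_pow (r := r + 1) hs (by omega) trivial
  rwa [hsk] at this

lemma step_away_toward_mem {n : ℕ} (hP : T.Pairs n fun _ => True) {s t : List Bool} {c : Bool}
    (hs : s.length = n) (ht : t.length = n) (h : pos s + inc c = pos t - inc c)
    (hd : 0 ≤ inc c * pos s) :
    T.Y (c :: s) * T.tr (T.Y ((!c) :: t)) ∈ T.alg (n + 1) := by
  set k := (pos s).natAbs with hk
  have htk : (pos t).natAbs = k + 2 := by
    cases c <;> simp at * <;> omega
  have hdir : (!c) = !away (pos t) := by
    rcases lt_or_ge (pos t) 0 with h' | h'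
    · rw [away_neg h']
      (cases c <;> simp at *); omega
    · rw [away_nonneg h']
      (cases c <;> simp at *); omega
  rw [Y_cons _ (!c), hdir, T.st_toward htk, T.tr_mul, tr_u, ← mul_assoc]
  have key := T.away_toward_mem hP hs ht hk.symm htk
  rcases direction_cases (pos s) c with ⟨h0, rfl⟩ | rfl | ⟨j, hj, rfl⟩
  · have ht0 : pos t < 0 := by simp [h0] at h; omega
    rw [Y_cons, h0, st_down_zero, mul_assoc (T.Y s), T.ed, mul_assoc, mul_assoc,
      T.e_mul_trY ht0, ← mul_assoc]
    exact key
  · rwa [Y_away]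
  · rw [inc_not] at hd
    rcases lt_or_ge (pos s) 0 with h' | h'
    · rw [away_neg h', inc_false] at hd; omega
    · rw [away_nonneg h', inc_true] at hd; omega

lemma pairs_step {n : ℕ} (hP : T.Pairs n fun _ => True) {s t : List Bool} {c c' : Bool}
    (hs : s.length = n) (ht : t.length = n) (h : pos s + inc c = pos t + inc c')
    (hne : ¬ (pos s = 0 ∧ pos t = 0 ∧ c = false)) :
    T.Y (c :: s) * T.tr (T.Y (c' :: t)) ∈ T.alg (n + 1) := by
  rcases Bool.eq_or_eq_not c' c with rfl | rfl
  · have hst : pos s = pos t := by omega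
    rcases direction_cases (pos s) c' with ⟨h0, rfl⟩ | hc | ⟨k, hk, hc⟩
    · exact (hne ⟨h0, hst ▸ h0, rfl⟩).elim
    · rw [hc, Y_away, hst, Y_away]
      exact T.alg_mono (hP s t hs ht hst trivial)
    · rw [hc, Y_cons, Y_cons, ← hst, T.st_toward hk, T.tr_mul, tr_u, ← mul_assoc,
        mul_assoc (T.Y s)]
      exact T.toward_toward_mem hP hs ht hk (hst ▸ hk)
  · rw [inc_not, ← sub_eq_add_neg] at h
    rcases le_or_gt 0 (inc c * pos s) with h1 | h1
    · exact T.step_away_toward_mem hP hs ht h h1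
    rcases le_or_gt 0 (inc (!c) * pos t) with h2 | h2
    · have h3 : pos t + inc (!c) = pos s - inc (!c) := by rw [inc_not]; omega
      have := T.tr_mem_alg (T.step_away_toward_mem hP ht hs h3 h2)
      rwa [T.tr_mul, T.tr_tr, Bool.not_not] at this
    · have hcs : c = !away (pos s) := by
        rcases lt_or_ge (pos s) 0 with h' | h'
        · rw [away_neg h']; (cases c <;> simp at *); omega
        · rw [away_nonneg h']; (cases c <;> simp at *); omega
      have hct : (!c) = !away (pos t) := by
        rcases lt_or_ge (pos t) 0 with h' | h'
        · rw [away_neg h']; (cases c <;> simp at *); omega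
        · rw [away_nonneg h']; (cases c <;> simp at *); omega
      have hks : (pos s).natAbs = 0 + 1 := by cases c <;> simp at * <;> omega
      have hkt : (pos t).natAbs = 0 + 1 := by cases c <;> simp at * <;> omega
      rw [hct, hcs, Y_cons, Y_cons, T.st_toward hks, T.st_toward hkt, T.tr_mul, tr_u, ← mul_assoc,
        mul_assoc (T.Y s)]
      exact T.toward_toward_mem hP hs ht hks hkt

/-- Cellular elements lie in the subalgebra generated by the diagrams. -/
lemma pairs (n : ℕ) : T.Pairs n fun _ => True := by
  induction n with
  | zero =>
    rintro s t hs ht - -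
    rw [List.length_eq_zero_iff] at hs ht
    rw [hs, ht, Y_nil, tr_one, mul_one]
    exact one_mem _
  | succ n ih =>
    rintro s t hs ht h -
    obtain ⟨c, s, rfl⟩ := List.exists_cons_of_length_eq_add_one hs
    obtain ⟨c', t, rfl⟩ := List.exists_cons_of_length_eq_add_one ht
    simp only [List.length_cons, Nat.add_right_cancel_iff] at hs ht
    by_cases hne : pos s = 0 ∧ pos t = 0 ∧ c = false
    · obtain ⟨h0, h0', rfl⟩ := hne
      obtain rfl : c' = false := by
        rw [pos_cons, pos_cons, h0, h0'] at h
        cases c' <;> simp_all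
      obtain ⟨r, hr⟩ := exists_excursion t
      have hone : T.Pairs (n + 1) (fun p => p = 1) := by
        intro s t hs ht h h1
        obtain ⟨c, s, rfl⟩ := List.exists_cons_of_length_eq_add_one hs
        obtain ⟨c', t, rfl⟩ := List.exists_cons_of_length_eq_add_one ht
        simp only [List.length_cons, Nat.add_right_cancel_iff] at hs ht
        refine T.pairs_step ih hs ht h ?_
        rintro ⟨h2, -, rfl⟩
        simp [h2] at h1
      have hs1 : T.Y (true :: s) = T.Y s := by rw [Y_cons, h0, st_up_zero, mul_one]
      have h1 := hone.mul_d_pow (s := true :: s) (r := r) (by simp [hs])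
        (by simp [h0] at hr ⊢; omega) (by simp [h0])
      have h2 := ih.u_pow_mul (r := r) ht (by omega) trivial
      rw [hs1, pos_cons, h0, inc_true] at h1
      rw [h0'] at h2
      rw [Y_cons, Y_cons, h0, h0', st_down_zero, T.tr_mul, T.tr_e, ← mul_assoc, mul_assoc (T.Y s),
        T.ee, ← T.d_pow_mul_e_mul_u_pow r, ← mul_assoc, ← mul_assoc, mul_assoc _ (T.u 0 ^ r)]
      exact mul_mem (mul_mem h1 (T.e_mem_alg (by omega))) (T.alg_mono h2)
    · exact T.pairs_step ih hs ht h hne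

end CupCap

namespace CupCap

variable {q y : ℂ} {A : Type*} [Ring A] [Algebra ℂ A] (T : CupCap q y A)

/-! ### Linear independence of half diagrams -/

lemma pos_append (v w : List Bool) : pos (v ++ w) = pos v + pos w := by
  induction v with
  | nil => simp
  | cons c v ih => simp [ih]; ring

lemma pos_reverse (w : List Bool) : pos w.reverse = pos w := by
  induction w with
  | nil => rfl
  | cons c w ih => simp [pos_append, ih]

lemma pos_map_not (w : List Bool) : pos (w.map (!·)) = -pos w := by
  induction w with
  | nil => rfl
  | cons c w ih => simp only [List.map_cons, pos_cons, ih, inc_not]; ring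

/-- Nested cups on `2 * k` points. -/
def nest : ℕ → A
  | 0 => 1
  | k + 1 => T.u k * nest k

/-- Bending the right half of a cellular element to the left. -/
lemma Y_mul_tr_mul_nest {s t : List Bool} (h : pos s = pos t) :
    T.Y s * T.tr (T.Y t) * T.nest t.length = T.Y ((t.map (!·)).reverse ++ s) := by
  induction t generalizing s with
  | nil => simp [nest, tr_one]
  | cons c t ih =>
    have hp : pos ((!c) :: s) = pos t := by rw [pos_cons, h, pos_cons, inc_not]; ring
    have h0 := T.trY_mul_u t 0
    rw [zero_add, zero_add] at h0
    rw [Y_cons, T.tr_mul, List.length_cons, nest, ← mul_assoc, ← mul_assoc,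
      mul_assoc _ (T.tr (T.Y t)), h0, ← mul_assoc, T.bend_step h, ih hp]
    simp

/-- Linear functionals on the first point that are compatible with cups and the blob. -/
structure Letters where
  z₁ : A
  z₂ : A
  α : ℂ
  β : ℂ
  v₁ : ℂ
  v₂ : ℂ
  z₁_u : ∀ j, z₁ * T.u (j + 1) = T.u j * z₁
  z₂_u : ∀ j, z₂ * T.u (j + 1) = T.u j * z₂
  z₁_z₁ : z₁ * z₁ * T.u 0 = 0
  z₂_z₂ : z₂ * z₂ * T.u 0 = 0
  z₂_z₁ : z₂ * z₁ * T.u 0 = algebraMap ℂ A α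
  z₁_z₂ : z₁ * z₂ * T.u 0 = algebraMap ℂ A β
  kill_e : (v₂ • z₁ - v₁ • z₂) * T.e = 0
  keep_e : (v₁ • z₁ + v₂ • z₂) * T.e = v₁ • z₁ + v₂ • z₂
  α_ne : α ≠ 0
  v₁_ne : v₁ ≠ 0
  v₂_ne : v₂ ≠ 0

namespace Letters

variable {T} (L : T.Letters)

/-- The functional with given values on the two letters. -/
def D (ξ : ℂ × ℂ) : A := ξ.1 • L.z₁ + ξ.2 • L.z₂

lemma D_mul_u (ξ : ℂ × ℂ) (j : ℕ) : L.D ξ * T.u (j + 1) = T.u j * L.D ξ := by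
  simp only [D, add_mul, mul_add, smul_mul_assoc, mul_smul_comm, L.z₁_u, L.z₂_u]

lemma D_mul_D_mul_u (η ξ : ℂ × ℂ) :
    L.D η * L.D ξ * T.u 0 = algebraMap ℂ A (L.α * ξ.1 * η.2 + L.β * ξ.2 * η.1) := by
  simp only [D, add_mul, mul_add, smul_mul_assoc, mul_smul_comm, L.z₁_z₁, L.z₁_z₂, L.z₂_z₁,
    L.z₂_z₂, smul_zero, Algebra.algebraMap_eq_smul_one, smul_smul, zero_add, add_zero,
    ← add_smul]
  congr 1
  ring

/-- The functionals detecting a walk on the given side of the origin. -/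
def ξ (b : Bool) : ℕ → ℂ × ℂ
  | 0 => if b then (L.v₂, -L.v₁) else (L.v₁, L.v₂)
  | h + 1 => (L.α * (ξ b h).1, -(L.β * (ξ b h).2))

lemma ξ_ne (b : Bool) (h : ℕ) : (L.ξ b h).1 ≠ 0 := by
  induction h with
  | zero => cases b <;> simp [ξ, L.v₁_ne, L.v₂_ne]
  | succ h ih => exact mul_ne_zero L.α_ne ih

/-- The product of the first `h` detecting functionals. -/
def Ξ (b : Bool) : ℕ → A
  | 0 => 1
  | h + 1 => L.D (L.ξ b h) * Ξ b h

lemma Ξ_mul_u (b : Bool) (h j : ℕ) : L.Ξ b h * T.u (j + h) = T.u j * L.Ξ b h := by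
  induction h generalizing j with
  | zero => simp [Ξ]
  | succ h ih => rw [Ξ, mul_assoc, show j + (h + 1) = j + 1 + h by ring, ih, ← mul_assoc,
      D_mul_u, mul_assoc]

lemma Ξ_mul_u_self (b : Bool) (h : ℕ) : L.Ξ b (h + 2) * T.u h = 0 := by
  have := L.Ξ_mul_u b h 0
  rw [zero_add] at this
  rw [Ξ, Ξ, mul_assoc, mul_assoc, this, ← mul_assoc (L.D _), ← mul_assoc, D_mul_D_mul_u, ξ,
    show L.α * (L.ξ b h).1 * -(L.β * (L.ξ b h).2) + L.β * (L.ξ b h).2 * (L.α * (L.ξ b h).1) = 0 by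
      ring, map_zero, zero_mul]

lemma D_mul_Ξ_mul_u (b : Bool) (h : ℕ) :
    L.D (0, 1) * (L.Ξ b (h + 1) * T.u h) = (L.α * (L.ξ b h).1) • L.Ξ b h := by
  have := L.Ξ_mul_u b h 0
  rw [zero_add] at this
  rw [Ξ, mul_assoc, this, ← mul_assoc (L.D _), ← mul_assoc, D_mul_D_mul_u, Algebra.smul_def]
  simp

/-- The functional attached to a position. -/
def Φ (p : ℤ) : A := L.Ξ (away p) p.natAbs

lemma Φ_add_away (p : ℤ) :
    L.Φ (p + inc (away p)) = L.D (L.ξ (away p) p.natAbs) * L.Φ p := by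
  rw [Φ, away_add_away, natAbs_add_away, Ξ, Φ]

lemma Φ_toward {p : ℤ} {k : ℕ} (hk : p.natAbs = k + 1) :
    L.Φ (p + inc (!away p)) = L.Ξ (away p) k := by
  rw [Φ, natAbs_add_not_away hk]
  cases k with
  | zero => rfl
  | succ k =>
    congr 1
    rcases lt_or_ge p 0 with h | h
    · rw [away_neg h, Bool.not_false, inc_true, away_neg (by omega)]
    · rw [away_nonneg h, Bool.not_true, inc_false, away_nonneg (by omega)]

end Letters

/-- The combination of all walks of length `n` from `p` with given coefficients. -/
def walkSum : ℤ → ℕ → (List Bool → ℂ) → A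
  | _, 0, κ => κ [] • 1
  | p, n + 1, κ => T.st p (away p) * walkSum (p + inc (away p)) n (fun f => κ (away p :: f)) +
      T.st p (!away p) * walkSum (p + inc (!away p)) n (fun f => κ ((!away p) :: f))

lemma walkSum_zero (p : ℤ) (n : ℕ) : T.walkSum p n (fun _ => 0) = 0 := by
  induction n generalizing p with
  | zero => simp [walkSum]
  | succ n ih => simp [walkSum, ih]

lemma walkSum_congr {p : ℤ} {n : ℕ} {κ κ' : List Bool → ℂ}
    (h : ∀ f : List Bool, f.length = n → κ f = κ' f) : T.walkSum p n κ = T.walkSum p n κ' := by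
  induction n generalizing p κ κ' with
  | zero => simp [walkSum, h [] rfl]
  | succ n ih =>
    rw [walkSum, walkSum, ih fun f hf => h _ (by simp [hf]), ih fun f hf => h _ (by simp [hf])]

lemma eq_zero_of_walkSum [Nontrivial A] (L : T.Letters) {p : ℤ} {n : ℕ} {κ : List Bool → ℂ}
    (hκ : ∀ f : List Bool, f.length = n → p + pos f ≠ 0 → κ f = 0)
    (h : L.Φ p * T.walkSum p n κ = 0) : ∀ f : List Bool, f.length = n → κ f = 0 := by
  induction n generalizing p κ with
  | zero =>
    intro f hf
    by_cases hp : p = 0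
    · rw [List.length_eq_zero_iff] at hf
      rw [walkSum, hp, Letters.Φ, Int.natAbs_zero, Letters.Ξ, one_mul, smul_eq_zero] at h
      rw [hf]
      exact h.resolve_right one_ne_zero
    · rw [List.length_eq_zero_iff] at hf
      exact hκ f (by simp [hf]) (by simpa [hf] using hp)
  | succ n ih =>
    have hsub (c : Bool) (f : List Bool) (hf : f.length = n) (hp : p + inc c + pos f ≠ 0) :
        κ (c :: f) = 0 := hκ _ (by simp [hf]) (by rw [pos_cons]; omega)
    rw [walkSum, st_away, one_mul] at h
    have hkill : L.Φ (p + inc (away p)) * T.st p (!away p) = 0 := by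
      rcases Nat.eq_zero_or_pos p.natAbs with h0 | h0
      · obtain rfl : p = 0 := by omega
        rw [L.Φ_add_away, away_nonneg le_rfl, Bool.not_true, st_down_zero]
        have := L.kill_e
        simpa [Letters.Φ, Letters.Ξ, Letters.D, Letters.ξ, sub_eq_add_neg] using this
      · obtain ⟨k, hk⟩ := Nat.exists_eq_add_of_le' h0
        rw [Letters.Φ, away_add_away, natAbs_add_away, hk, T.st_toward hk, L.Ξ_mul_u_self]
    have h1 : ∀ f : List Bool, f.length = n → κ (away p :: f) = 0 := by
      refine ih (hsub _) ?_
      have := congrArg (L.D (L.ξ (away p) p.natAbs) * ·) h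
      simp only [mul_zero] at this
      rwa [← mul_assoc, ← L.Φ_add_away, mul_add, ← mul_assoc, hkill, zero_mul, add_zero] at this
    rw [T.walkSum_congr h1, walkSum_zero, zero_add] at h
    have h2 : ∀ f : List Bool, f.length = n → κ ((!away p) :: f) = 0 := by
      refine ih (hsub _) ?_
      rcases Nat.eq_zero_or_pos p.natAbs with h0 | h0
      · obtain rfl : p = 0 := by omega
        rw [away_nonneg le_rfl, Bool.not_true, st_down_zero] at h
        rw [away_nonneg le_rfl, Bool.not_true]
        have h3 := congrArg (L.D (L.v₁, L.v₂) * ·) h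
        have h4 : L.D (L.v₁, L.v₂) * T.e = L.D (L.v₁, L.v₂) := L.keep_e
        simp only [mul_zero] at h3
        rw [Letters.Φ, Int.natAbs_zero, Letters.Ξ, one_mul, ← mul_assoc, h4] at h3
        rw [zero_add, inc_false, Letters.Φ]
        simpa [away, Letters.Ξ, Letters.ξ] using h3
      · obtain ⟨k, hk⟩ := Nat.exists_eq_add_of_le' h0
        rw [T.st_toward hk, Letters.Φ, hk, ← mul_assoc] at h
        have h3 := congrArg (L.D (0, 1) * ·) h
        simp only [mul_zero] at h3
        rw [← mul_assoc, L.D_mul_Ξ_mul_u, smul_mul_assoc, smul_eq_zero] at h3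
        rw [L.Φ_toward hk]
        exact h3.resolve_left (mul_ne_zero L.α_ne (L.ξ_ne _ _))
    intro f hf
    obtain ⟨c, f, rfl⟩ := List.exists_cons_of_length_eq_add_one hf
    simp only [List.length_cons, Nat.add_right_cancel_iff] at hf
    rcases Bool.eq_or_eq_not c (away p) with rfl | rfl
    · exact h1 f hf
    · exact h2 f hf

lemma walkSum_smul (p : ℤ) (n : ℕ) (a : ℂ) (κ : List Bool → ℂ) :
    T.walkSum p n (fun f => a * κ f) = a • T.walkSum p n κ := by
  induction n generalizing p κ with
  | zero => simp [walkSum, smul_smul]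
  | succ n ih => simp [walkSum, ih]

lemma walkSum_sum {ι : Type*} (s : Finset ι) (p : ℤ) (n : ℕ) (κ : ι → List Bool → ℂ) :
    T.walkSum p n (fun f => ∑ i ∈ s, κ i f) = ∑ i ∈ s, T.walkSum p n (κ i) := by
  induction n generalizing p κ with
  | zero => simp [walkSum, Finset.sum_smul]
  | succ n ih => simp [walkSum, ih, Finset.mul_sum, Finset.sum_add_distrib]

lemma Y_append_mul_walkSum (w f : List Bool) :
    T.Y w * T.walkSum (pos w) f.length (fun g => if g = f then 1 else 0) =
      T.Y (f.reverse ++ w) := by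
  induction f generalizing w with
  | nil => simp [walkSum]
  | cons c f ih =>
    have h := ih (c :: w)
    rw [Y_cons, mul_assoc, pos_cons] at h
    rw [List.length_cons, walkSum, List.reverse_cons, List.append_assoc, List.singleton_append,
      ← h]
    rcases Bool.eq_or_eq_not c (away (pos w)) with rfl | rfl <;> simp [walkSum_zero]

lemma linearIndependent_Y [Nontrivial A] (L : T.Letters) {ι : Type*} [Fintype ι]
    {w : ι → List Bool} (hw : Function.Injective w) {n : ℕ} (hn : ∀ i, (w i).length = n)
    (h0 : ∀ i, pos (w i) = 0) : LinearIndependent ℂ fun i => T.Y (w i) := by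
  rw [Fintype.linearIndependent_iff]
  intro g hg i
  set κ : List Bool → ℂ :=
    fun f => ∑ i, g i * if f = (w i).reverse then 1 else 0 with hκ
  have hsum : T.walkSum 0 n κ = 0 := by
    rw [hκ, walkSum_sum, ← hg]
    refine Finset.sum_congr rfl fun i _ => ?_
    have := T.Y_append_mul_walkSum [] (w i).reverse
    rw [List.length_reverse, hn, Y_nil, one_mul, List.reverse_reverse, List.append_nil,
      pos_nil] at this
    rw [walkSum_smul, this]
  have hval : κ (w i).reverse = g i := by
    rw [hκ]
    refine (Finset.sum_eq_single i (fun j _ hj => ?_) (by simp)).trans (by simp)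
    rw [if_neg (fun h => hj (hw (List.reverse_injective h)).symm), mul_zero]
  rw [← hval]
  refine T.eq_zero_of_walkSum L (p := 0) (n := n) (fun f _ hf => ?_) (by rw [hsum, mul_zero]) _
    (by simp [hn])
  refine Finset.sum_eq_zero fun j _ => ?_
  rw [if_neg, mul_zero]
  rintro rfl
  rw [pos_reverse, h0, zero_add] at hf
  exact hf rfl

/-- The cellular elements are linearly independent. -/
lemma linearIndependent_Y_mul_tr [Nontrivial A] (L : T.Letters) {ι : Type*} [Fintype ι]
    {s t : ι → List Bool} (hst : Function.Injective fun i => (s i, t i)) {n : ℕ}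
    (hs : ∀ i, (s i).length = n) (ht : ∀ i, (t i).length = n) (hp : ∀ i, pos (s i) = pos (t i)) :
    LinearIndependent ℂ fun i => T.Y (s i) * T.tr (T.Y (t i)) := by
  have key := T.linearIndependent_Y L (w := fun i => ((t i).map (!·)).reverse ++ s i)
    (n := n + n) ?_ (fun i => by simp [hs, ht]) ?_
  · refine LinearIndependent.of_comp (LinearMap.mulRight ℂ (T.nest n)) ?_
    have : (fun i => T.Y (((t i).map (!·)).reverse ++ s i)) =
        LinearMap.mulRight ℂ (T.nest n) ∘ fun i => T.Y (s i) * T.tr (T.Y (t i)) := by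
      funext i
      rw [Function.comp_apply, LinearMap.mulRight_apply, ← T.Y_mul_tr_mul_nest (hp i), ht]
    rwa [← this]
  · intro i j h
    have h1 := List.append_inj h (by simp [ht])
    refine hst (Prod.ext h1.2 (List.map_injective_iff.2 ?_ (List.reverse_injective h1.1)))
    exact fun a b hab => by simpa using hab
  · intro i
    rw [pos_append, pos_reverse, pos_map_not, hp, neg_add_cancel]

end CupCap

/-! ### A concrete system of cups and caps -/

/-- A representation of the Leavitt algebra of type `(1, 2)` with an anti-involution. -/
structure Leavitt (A : Type*) [Ring A] [Algebra ℂ A] where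
  x : Bool → A
  y : Bool → A
  tr : A →ₗ[ℂ] A
  tr_mul : ∀ a b, tr (a * b) = tr b * tr a
  tr_tr : ∀ a, tr (tr a) = a
  tr_x : ∀ b, tr (x b) = y b
  y_x : ∀ b c, y b * x c = if b = c then 1 else 0
  x_y : x true * y true + x false * y false = 1

namespace Leavitt

variable {A : Type*} [Ring A] [Algebra ℂ A] (V : Leavitt A)

lemma tr_y (b : Bool) : V.tr (V.y b) = V.x b := by rw [← V.tr_x, V.tr_tr]

@[simp] lemma y_x_self (b : Bool) : V.y b * V.x b = 1 := by simp [V.y_x]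
@[simp] lemma y_x_tf : V.y true * V.x false = 0 := by simp [V.y_x]
@[simp] lemma y_x_ft : V.y false * V.x true = 0 := by simp [V.y_x]
@[simp] lemma y_x_self_assoc (b : Bool) (z : A) : V.y b * (V.x b * z) = z := by
  rw [← mul_assoc, y_x_self, one_mul]
@[simp] lemma y_x_tf_assoc (z : A) : V.y true * (V.x false * z) = 0 := by
  rw [← mul_assoc, y_x_tf, zero_mul]
@[simp] lemma y_x_ft_assoc (z : A) : V.y false * (V.x true * z) = 0 := by
  rw [← mul_assoc, y_x_ft, zero_mul]

/-- The shift endomorphism. -/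
def ρ (z : A) : A := V.x true * z * V.y true + V.x false * z * V.y false

lemma ρ_mul (a b : A) : V.ρ (a * b) = V.ρ a * V.ρ b := by
  simp [ρ, mul_add, add_mul, mul_assoc]

lemma ρ_algebraMap (c : ℂ) : V.ρ (algebraMap ℂ A c) = algebraMap ℂ A c := by
  rw [ρ, ← Algebra.commutes, ← Algebra.commutes, mul_assoc, mul_assoc, ← mul_add, V.x_y, mul_one]

lemma tr_ρ (z : A) : V.tr (V.ρ z) = V.ρ (V.tr z) := by
  simp [ρ, V.tr_mul, V.tr_x, V.tr_y, mul_assoc]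

lemma y_mul_ρ (b : Bool) (z : A) : V.y b * V.ρ z = z * V.y b := by
  cases b <;> simp [ρ, mul_add, mul_assoc]

lemma ρ_mul_x (b : Bool) (z : A) : V.ρ z * V.x b = V.x b * z := by
  cases b <;> simp [ρ, add_mul, mul_assoc]

/-- The cup at the leftmost position. -/
def cup₀ (α : ℂ) : A := α • (V.x true * V.x false) + α⁻¹ • (V.x false * V.x true)

/-- The cups. -/
def cup (α : ℂ) : ℕ → A
  | 0 => V.cup₀ α
  | j + 1 => V.ρ (cup α j)

lemma tr_cup₀ (α : ℂ) : V.tr (V.cup₀ α) =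
    α • (V.y false * V.y true) + α⁻¹ • (V.y true * V.y false) := by
  simp [cup₀, V.tr_mul, V.tr_x]

lemma ρ_ρ_mul_cup₀ (α : ℂ) (z : A) : V.ρ (V.ρ z) * V.cup₀ α = V.cup₀ α * z := by
  simp only [cup₀, mul_add, add_mul, mul_smul_comm, smul_mul_assoc, ← mul_assoc, ρ_mul_x]
  simp only [mul_assoc, ρ_mul_x]

lemma tr_cup₀_mul_ρ_ρ (α : ℂ) (z : A) :
    V.tr (V.cup₀ α) * V.ρ (V.ρ z) = z * V.tr (V.cup₀ α) := by
  have := congrArg V.tr (V.ρ_ρ_mul_cup₀ α (V.tr z))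
  rwa [V.tr_mul, V.tr_mul, tr_ρ, tr_ρ, V.tr_tr] at this

/-- The blob attached to the values `v₁, v₂` on the letters. -/
def blob (v₁ v₂ : ℂ) : A :=
  (v₁ • V.x true + v₂ • V.x false) * (v₁ • V.y true + v₂ • V.y false)

/-- The blob algebra diagrams inside a representation of the Leavitt algebra. -/
def cupCap {q y α v₁ v₂ : ℂ} (hα : α ≠ 0) (hq : α ^ 2 + α⁻¹ ^ 2 = -(q + q⁻¹))
    (hv : v₁ ^ 2 + v₂ ^ 2 = 1) (hy : α ^ 2 * v₁ ^ 2 + α⁻¹ ^ 2 * v₂ ^ 2 = y) : CupCap q y A where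
  u := V.cup α
  e := V.blob v₁ v₂
  tr := V.tr
  tr_mul := V.tr_mul
  tr_tr := V.tr_tr
  tr_e := by simp [blob, V.tr_mul, V.tr_x, V.tr_y]
  du_self j := by
    induction j with
    | zero =>
      rw [cup, tr_cup₀, cup₀, ← hq, Algebra.algebraMap_eq_smul_one]
      simp only [mul_add, add_mul, smul_mul_assoc, mul_smul_comm, mul_assoc, y_x_self_assoc,
        y_x_self, y_x_tf_assoc, y_x_ft_assoc, mul_zero, smul_zero, add_zero,
        zero_add, smul_smul, ← add_smul]
      ring_nf
    | succ j ih => rw [cup, tr_ρ, ← ρ_mul, ih, ρ_algebraMap]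
  du_succ j := by
    induction j with
    | zero =>
      have h1 : V.tr (V.cup α 0) * V.cup α 1 =
          (α * α⁻¹) • (V.x true * V.y true + V.x false * V.y false) := by
        rw [cup, cup, cup, tr_cup₀, cup₀]
        simp only [add_mul, smul_mul_assoc, mul_assoc, y_mul_ρ]
        simp only [mul_add, mul_smul_comm, y_x_self_assoc,
          y_x_tf_assoc, y_x_ft_assoc, smul_zero, add_zero,
          zero_add, smul_smul, smul_add, mul_comm α⁻¹ α]
      rw [h1, mul_inv_cancel₀ hα, V.x_y, one_smul]
    | succ j ih =>
      have h1 := V.ρ_algebraMap 1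
      rw [map_one] at h1
      rw [cup, cup, tr_ρ, ← ρ_mul, ih, h1]
  du_far i j h := by
    induction i generalizing j with
    | zero => exact V.tr_cup₀_mul_ρ_ρ α _
    | succ i ih =>
      obtain ⟨j, rfl⟩ : ∃ k, j = k + 1 := ⟨j - 1, by omega⟩
      change V.tr (V.ρ (V.cup α i)) * V.ρ (V.cup α (j + 2)) =
        V.ρ (V.cup α j) * V.tr (V.ρ (V.cup α i))
      rw [tr_ρ, ← ρ_mul, ← ρ_mul, ih j (by omega)]
  uu i j h := by
    induction i generalizing j with
    | zero => exact V.ρ_ρ_mul_cup₀ α _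
    | succ i ih =>
      obtain ⟨j, rfl⟩ : ∃ k, j = k + 1 := ⟨j - 1, by omega⟩
      change V.ρ (V.cup α (j + 2)) * V.ρ (V.cup α i) = V.ρ (V.cup α i) * V.ρ (V.cup α j)
      rw [← ρ_mul, ← ρ_mul, ih j (by omega)]
  ee := by
    have h : (v₁ • V.y true + v₂ • V.y false) * (v₁ • V.x true + v₂ • V.x false) = 1 := by
      rw [← one_smul ℂ (1 : A), ← hv]
      simp [add_mul, mul_add, smul_smul, add_smul, pow_two]
    rw [blob, mul_assoc, ← mul_assoc (v₁ • V.y true + v₂ • V.y false), h, one_mul]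
  eu j := by
    simp [blob, cup, mul_assoc, add_mul, mul_add, y_mul_ρ]
    simp [← mul_assoc, ρ_mul_x]
  deu := by
    rw [cup, tr_cup₀, cup₀, blob, ← hy, Algebra.algebraMap_eq_smul_one]
    simp only [mul_add, add_mul, smul_mul_assoc, mul_smul_comm, mul_assoc, y_x_self_assoc,
      y_x_self, y_x_tf_assoc, y_x_ft_assoc, y_x_tf, y_x_ft, mul_zero, smul_zero, add_zero,
      zero_add, smul_smul, ← add_smul]
    ring_nf

/-- The letters of a representation of the Leavitt algebra. -/
def letters {q y α v₁ v₂ : ℂ} (hα : α ≠ 0) (hq : α ^ 2 + α⁻¹ ^ 2 = -(q + q⁻¹))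
    (hv : v₁ ^ 2 + v₂ ^ 2 = 1) (hy : α ^ 2 * v₁ ^ 2 + α⁻¹ ^ 2 * v₂ ^ 2 = y) (h₁ : v₁ ≠ 0)
    (h₂ : v₂ ≠ 0) : (V.cupCap hα hq hv hy).Letters where
  z₁ := V.y true
  z₂ := V.y false
  α := α
  β := α⁻¹
  v₁ := v₁
  v₂ := v₂
  z₁_u _ := V.y_mul_ρ _ _
  z₂_u _ := V.y_mul_ρ _ _
  z₁_z₁ := by simp [cupCap, cup, cup₀, mul_assoc, mul_add]
  z₂_z₂ := by simp [cupCap, cup, cup₀, mul_assoc, mul_add]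
  z₂_z₁ := by simp [cupCap, cup, cup₀, mul_assoc, mul_add, Algebra.algebraMap_eq_smul_one]
  z₁_z₂ := by simp [cupCap, cup, cup₀, mul_assoc, mul_add, Algebra.algebraMap_eq_smul_one]
  kill_e := by
    have h : (v₂ • V.y true - v₁ • V.y false) * (v₁ • V.x true + v₂ • V.x false) = 0 := by
      simp [sub_mul, mul_add, smul_smul, mul_comm]
    simp only [cupCap, blob]
    rw [← mul_assoc, h, zero_mul]
  keep_e := by
    have h : (v₁ • V.y true + v₂ • V.y false) * (v₁ • V.x true + v₂ • V.x false) = 1 := by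
      rw [← one_smul ℂ (1 : A), ← hv]
      simp [add_mul, mul_add, smul_smul, add_smul, pow_two]
    simp only [cupCap, blob]
    rw [← mul_assoc, h, one_mul]
  α_ne := hα
  v₁_ne := h₁
  v₂_ne := h₂

end Leavitt

/-- The operator inserting a sequence in the even or odd places. -/
def interleave (b : Bool) : (ℕ → ℂ) →ₗ[ℂ] (ℕ → ℂ) where
  toFun f k := if k.bodd = b then f k.div2 else 0
  map_add' f g := by ext k; simp only [Pi.add_apply]; split_ifs <;> simp
  map_smul' c f := by ext k; simp

/-- The operator extracting the even or odd places of a sequence. -/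
def extract (b : Bool) : (ℕ → ℂ) →ₗ[ℂ] (ℕ → ℂ) := LinearMap.funLeft ℂ ℂ (Nat.bit b)

lemma extract_mul_interleave (b c : Bool) :
    extract b * interleave c = if b = c then 1 else 0 := by
  ext f k
  simp only [extract, interleave, Module.End.mul_apply, LinearMap.funLeft_apply, LinearMap.coe_mk,
    AddHom.coe_mk, Nat.bodd_bit, Nat.div2_bit]
  split_ifs <;> simp

lemma interleave_mul_extract :
    interleave true * extract true + interleave false * extract false = 1 := by
  ext f k
  have h := Nat.bit_bodd_div2 k
  cases hk : k.bodd <;> rw [hk] at h <;>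
    simp [extract, interleave, LinearMap.funLeft_apply, hk, -Nat.bit_true_apply,
      -Nat.bit_false_apply, -Nat.bit_false, -Nat.bit_true, h]

/-- Pairs of operators on sequences, the second composed in the opposite order. -/
abbrev SeqOp := Module.End ℂ (ℕ → ℂ) × (Module.End ℂ (ℕ → ℂ))ᵐᵒᵖ

/-- The standard representation of the Leavitt algebra. -/
def seqOp : Leavitt SeqOp where
  x b := (interleave b, MulOpposite.op (extract b))
  y b := (extract b, MulOpposite.op (interleave b))
  tr :=
    { toFun := fun p => (p.2.unop, MulOpposite.op p.1)
      map_add' := fun _ _ => rfl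
      map_smul' := fun _ _ => rfl }
  tr_mul _ _ := rfl
  tr_tr _ := rfl
  tr_x _ := rfl
  y_x b c := by
    rw [Prod.mk_mul_mk, ← MulOpposite.op_mul, extract_mul_interleave, extract_mul_interleave]
    by_cases h : b = c
    · simp only [h, if_true]
      rfl
    · simp [h, Ne.symm h]
  x_y := by
    rw [Prod.mk_mul_mk, Prod.mk_mul_mk, ← MulOpposite.op_mul, ← MulOpposite.op_mul,
      Prod.mk_add_mk, ← MulOpposite.op_add, interleave_mul_extract]
    rfl

/-! ### Normal words -/

section NormalWords

variable {A : Type*} [Ring A]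

/-- The descending product `g (j + r - 1) ⋯ g j`. -/
def run (g : ℕ → A) (j : ℕ) : ℕ → A
  | 0 => 1
  | r + 1 => g (j + r) * run g j r

/-- Products of `l` generators with index below `n`. -/
inductive Word (g : ℕ → A) (n : ℕ) : ℕ → A → Prop
  | nil : Word g n 0 1
  | snoc {l : ℕ} {x : A} {i : ℕ} : Word g n l x → i < n → Word g n (l + 1) (x * g i)

/-- Products of descending runs whose last indices increase and are at most `a`. -/
inductive Normal (g : ℕ → A) : ℕ → ℕ → ℕ → A → Prop
  | nil (a : ℕ) : Normal g 0 a 0 1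
  | skip {k a l : ℕ} {x : A} : Normal g k a l x → Normal g (k + 1) a l x
  | run {k a l j r : ℕ} {x : A} : Normal g k (j - 1) l x → k = j + r → j ≤ a →
      Normal g (k + 1) a (l + (r + 1)) (x * run g j (r + 1))

variable {g : ℕ → A} {n : ℕ}

lemma run_succ (j r : ℕ) : run g j (r + 1) = run g (j + 1) r * g j := by
  induction r with
  | zero => simp [run]
  | succ r ih =>
    rw [run, ih, run, mul_assoc, show j + (r + 1) = j + 1 + r by ring]

lemma run_add (j r s : ℕ) : run g j (r + s) = run g (j + r) s * run g j r := by
  induction s with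
  | zero => simp [run]
  | succ s ih => rw [← add_assoc, run, ih, run, mul_assoc, add_assoc]

lemma Word.mul {l l' : ℕ} {x y : A} (hx : Word g n l x) (hy : Word g n l' y) :
    Word g n (l + l') (x * y) := by
  induction hy with
  | nil => simpa using hx
  | snoc _ hi ih => rw [← mul_assoc, ← add_assoc]; exact ih.snoc hi

lemma word_gen {i : ℕ} (hi : i < n) : Word g n 1 (g i) := by
  simpa using Word.nil.snoc (g := g) hi

lemma word_run {j r : ℕ} (h : j + r ≤ n) : Word g n r (run g j r) := by
  induction r with
  | zero => exact .nil
  | succ r ih =>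
    rw [run, add_comm r 1]
    exact (word_gen (by omega)).mul (ih (by omega))

lemma Normal.word {k a l : ℕ} {x : A} (h : Normal g k a l x) (hk : k ≤ n) : Word g n l x := by
  induction h with
  | nil => exact .nil
  | skip _ ih => exact ih (by omega)
  | run _ hkr _ ih => exact (ih (by omega)).mul (word_run (by omega))

lemma Normal.mono {k a b l : ℕ} {x : A} (h : Normal g k a l x) (hb : a ≤ b ∨ k ≤ b + 1) :
    Normal g k b l x := by
  induction h with
  | nil => exact .nil _
  | skip _ ih => exact (ih (by omega)).skip
  | run hx hkr hj _ => exact hx.run hkr (by omega)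

/-- The number of normal words. -/
def count : ℕ → ℕ → ℕ
  | 0, _ => 1
  | k + 1, a => count k a + ∑ j ∈ Finset.range (min a k + 1), count k (j - 1)

lemma count_of_le {k : ℕ} : ∀ {a : ℕ}, k ≤ a + 1 → count k a = count k k := by
  induction k with
  | zero => exact fun _ => rfl
  | succ k ih =>
    intro a h
    rw [count, count, ih (a := a) (by omega), ih (a := k + 1) (by omega), show min a k = k by omega,
      show min (k + 1) k = k by omega]

lemma count_eq (k : ℕ) : ∀ a ≤ k, count k a = ∑ i ∈ Finset.Ico a (k + 1), (k + a).choose i := by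
  induction k with
  | zero =>
    intro a ha
    obtain rfl : a = 0 := by omega
    rfl
  | succ k ih =>
    have key : ∀ a ≤ k, count (k + 1) a =
        ∑ i ∈ Finset.Ico a (k + 1 + 1), (k + 1 + a).choose i := fun a => by
      induction a with
      | zero =>
        intro _
        rw [count, ih 0 (by omega), Nat.zero_min, Finset.sum_range_one, ih 0 (by omega)]
        simp only [add_zero, ← Finset.range_eq_Ico, Nat.sum_range_choose]
        ring
      | succ a iha =>
        intro ha
        have h1 : count (k + 1) (a + 1) = count (k + 1) a + count k (a + 1) := by
          rw [count, count, show min (a + 1) k = a + 1 by omega, show min a k = a by omega,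
            Finset.sum_range_succ _ (a + 1), Nat.add_sub_cancel]
          ring
        rw [h1, iha (by omega), ih _ ha, ← Finset.sum_Ico_add' _ a (k + 1) 1]
        simp only [show k + 1 + (a + 1) = k + 1 + a + 1 by ring, Nat.choose_succ_succ',
          Finset.sum_add_distrib]
        rw [Finset.sum_Ico_add' (fun i => (k + 1 + a).choose i) a (k + 1) 1,
          Finset.sum_Ico_succ_top (by omega), Finset.sum_Ico_succ_top (by omega : a + 1 ≤ k + 1),
          show k + (a + 1) = k + 1 + a by ring]
        ring
    intro a ha
    rcases ha.lt_or_eq with ha | rfl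
    · exact key a (by omega)
    · rw [← count_of_le (a := k) le_rfl, key k le_rfl, Finset.sum_Ico_succ_top (by omega),
        Nat.Ico_succ_singleton, Nat.Ico_succ_singleton, Finset.sum_singleton, Finset.sum_singleton,
        show k + 1 + (k + 1) = k + 1 + k + 1 by ring, Nat.choose_succ_succ']

lemma count_self (n : ℕ) : count n n = n.centralBinom := by
  rw [count_eq n n le_rfl, Nat.Ico_succ_singleton, Finset.sum_singleton, Nat.centralBinom, two_mul]

lemma exists_finset_normal (g : ℕ → A) (k : ℕ) : ∀ a, ∃ s : Finset A,
    s.card ≤ count k a ∧ ∀ l x, Normal g k a l x → x ∈ s := by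
  classical
  induction k with
  | zero =>
    refine fun a => ⟨{1}, by simp [count], fun l x h => ?_⟩
    cases h
    simp
  | succ k ih =>
    choose s hs hs' using ih
    refine fun a => ⟨s a ∪ (Finset.range (min a k + 1)).biUnion fun j =>
      (s (j - 1)).image fun x => x * run g j (k - j + 1), ?_, fun l x h => ?_⟩
    · refine (Finset.card_union_le _ _).trans (add_le_add (hs a) ?_)
      refine Finset.card_biUnion_le.trans (Finset.sum_le_sum fun j _ => ?_)
      exact Finset.card_image_le.trans (hs _)
    · cases h with
      | skip h => exact Finset.mem_union_left _ (hs' _ _ _ h)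
      | @run _ _ l j r x hx hk hj =>
        refine Finset.mem_union_right _ (Finset.mem_biUnion.mpr ⟨j, ?_, ?_⟩)
        · rw [Finset.mem_range]; omega
        · rw [show k - j = r by omega]
          exact Finset.mem_image_of_mem _ (hs' _ _ _ hx)

variable [Algebra ℂ A]

/-- The span of the products of fewer than `l` generators. -/
def shorter (g : ℕ → A) (n l : ℕ) : Submodule ℂ A :=
  Submodule.span ℂ {x | ∃ l' < l, Word g n l' x}

lemma shorter_mono {l l' : ℕ} (h : l ≤ l') : shorter g n l ≤ shorter g n l' :=
  Submodule.span_mono fun _ ⟨k, hk, hx⟩ => ⟨k, by omega, hx⟩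

lemma Word.mem {l l' : ℕ} {x : A} (hx : Word g n l x) (h : l < l') : x ∈ shorter g n l' :=
  Submodule.subset_span ⟨l, h, hx⟩

lemma shorter_mul {l r : ℕ} {x y : A} (hx : x ∈ shorter g n l) (hy : Word g n r y) :
    x * y ∈ shorter g n (l + r) := by
  induction hx using Submodule.span_induction with
  | mem x hx =>
    obtain ⟨k, hk, hx⟩ := hx
    exact (hx.mul hy).mem (by omega)
  | zero => simp
  | add x x' _ _ h h' => rw [add_mul]; exact add_mem h h'
  | smul c x _ h => rw [smul_mul_assoc]; exact Submodule.smul_mem _ _ h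

/-- The relations shared by the monomials in the generators of a blob algebra on `n` strands. -/
structure BlobLike {A : Type*} [Ring A] [Algebra ℂ A] (g : ℕ → A) (n : ℕ) : Prop where
  sq : ∀ i < n, ∃ c : ℂ, g i * g i = c • g i
  up : ∀ i, 1 ≤ i → i + 1 < n → ∃ c : ℂ, g i * g (i + 1) * g i = c • g i
  down : ∀ i, i + 1 < n → ∃ c : ℂ, g (i + 1) * g i * g (i + 1) = c • g (i + 1)
  comm : ∀ i j, i + 1 < j → j < n → g i * g j = g j * g i

namespace BlobLike

variable (hg : BlobLike g n)
include hg

lemma comm_run {i j r : ℕ} (h : j + r + 1 ≤ i ∨ i + 1 < j ∧ j + r ≤ n) (hi : i < n) :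
    g i * run g j r = run g j r * g i := by
  induction r with
  | zero => simp [run]
  | succ r ih =>
    have h1 : g i * g (j + r) = g (j + r) * g i := by
      rcases h with h | h
      · exact (hg.comm _ _ (by omega) (by omega)).symm
      · exact hg.comm _ _ (by omega) (by omega)
    rw [run, ← mul_assoc, h1, mul_assoc, ih (by omega), mul_assoc]

/-- A normal word followed by a run ending at its bound is shorter than expected, unless the
bound can be lowered. -/
lemma lower {k b l : ℕ} {x : A} (h : Normal g k b l x) (hb : 1 ≤ b) (hk : k ≤ n) :
    Normal g k (b - 1) l x ∨
      ∀ r, k ≤ b + r → b + r < n → x * run g b (r + 1) ∈ shorter g n (l + (r + 1)) := by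
  induction h with
  | nil => exact .inl (.nil _)
  | skip _ ih =>
    rcases ih hb (by omega) with h | h
    · exact .inl h.skip
    · exact .inr fun r hr hr' => h r (by omega) hr'
  | @run k b l j s x hx hks hj _ =>
    rcases hj.lt_or_eq with hj | rfl
    · exact .inl (hx.run hks (by omega))
    · refine .inr fun r hr hr' => ?_
      obtain ⟨r, rfl⟩ : ∃ r', r = r' + 1 := ⟨r - 1, by omega⟩
      obtain ⟨c, hc⟩ := hg.up j hb (by omega)
      have h1 : run g j (s + 1) * run g j (r + 1 + 1) =
          c • (run g j (s + 1) * run g (j + 2) r) := by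
        have h2 : g j * run g (j + 2) r = run g (j + 2) r * g j :=
          hg.comm_run (by omega) (by omega)
        calc run g j (s + 1) * run g j (r + 1 + 1)
            = run g (j + 1) s * (g j * run g (j + 2) r) * g (j + 1) * g j := by
              rw [run_succ, run_succ j (r + 1), run_succ (j + 1) r]
              simp only [mul_assoc]
          _ = run g (j + 1) s * run g (j + 2) r * (g j * g (j + 1) * g j) := by
              rw [h2]; simp only [mul_assoc]
          _ = _ := by
              rw [hc, run_succ j s, mul_smul_comm, mul_assoc, mul_assoc, h2]
      rw [mul_assoc, h1, mul_smul_comm, ← mul_assoc]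
      exact Submodule.smul_mem _ _ ((((hx.word (by omega)).mul (word_run (by omega))).mul
        (word_run (by omega))).mem (by omega))

lemma normal_mul {k a l i : ℕ} {x : A} (h : Normal g k a l x) (hk : k ≤ n) (hi : i < k)
    (hia : i ≤ a) : x * g i ∈ shorter g n (l + 1) ∨ Normal g k a (l + 1) (x * g i) := by
  induction h generalizing i with
  | nil => omega
  | @skip k a l x h ih =>
    rcases Nat.lt_succ_iff_lt_or_eq.mp hi with hi | rfl
    · exact (ih (by omega) hi hia).imp_right .skip
    · right
      have := (h.mono (b := i - 1) (by omega)).run (r := 0) rfl hia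
      simpa [run] using this
  | @run k a l j r x hx hkr hj ih =>
    have hw := hx.word (n := n) (by omega)
    rcases lt_trichotomy i j with h | rfl | h
    · rcases (Nat.succ_le_of_lt h).lt_or_eq with h | h
      · have h1 : g i * run g j (r + 1) = run g j (r + 1) * g i :=
          hg.comm_run (by omega) (by omega)
        rw [mul_assoc, ← h1, ← mul_assoc]
        rcases ih (i := i) (by omega) (by omega) (by omega) with h | h
        · left
          have := shorter_mul h (word_run (g := g) (n := n) (j := j) (r := r + 1) (by omega))
          exact shorter_mono (by omega) this
        · right
          have := h.run hkr hj
          rwa [show l + (r + 1) + 1 = l + 1 + (r + 1) by ring]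
      · have hij : j = i + 1 := by omega
        subst hij
        have h1 : run g (i + 1) (r + 1) * g i = run g i (r + 1 + 1) := (run_succ _ _).symm
        rw [mul_assoc, h1]
        have h2 : Normal g k (i - 1) l x → Normal g (k + 1) a (l + (r + 1) + 1)
            (x * run g i (r + 1 + 1)) := fun h => by
          have := h.run (j := i) (r := r + 1) (a := a) (by omega) (by omega)
          rwa [add_assoc l (r + 1) 1]
        rcases Nat.eq_zero_or_pos i with rfl | hi0
        · exact .inr (h2 hx)
        · rcases hg.lower hx (by omega) (by omega) with h | h
          · exact .inr (h2 h)
          · exact .inl (h (r + 1) (by omega) (by omega))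
    · obtain ⟨c, hc⟩ := hg.sq i (by omega)
      left
      rw [run_succ, mul_assoc, mul_assoc, hc, mul_smul_comm, ← run_succ, mul_smul_comm]
      exact Submodule.smul_mem _ _ ((hw.mul (word_run (by omega))).mem (by omega))
    · left
      obtain ⟨p, rfl⟩ : ∃ p, i = j + 1 + p := ⟨i - j - 1, by omega⟩
      obtain ⟨s, rfl⟩ : ∃ s, r = p + 1 + s := ⟨r - p - 1, by omega⟩
      obtain ⟨c, hc⟩ := hg.down (j + p) (by omega)
      have h1 : g (j + 1 + p) * run g j p = run g j p * g (j + 1 + p) :=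
        hg.comm_run (by omega) (by omega)
      have h2 : run g j (p + 1 + s + 1) * g (j + 1 + p) =
          c • (run g (j + 1 + p) (s + 1) * run g j p) := by
        have h3 : run g j (p + 1 + s + 1) =
            run g (j + 1 + p + 1) s * g (j + 1 + p) * (g (j + p) * run g j p) := by
          rw [show p + 1 + s + 1 = p + 1 + (s + 1) by ring, run_add j (p + 1),
            show j + (p + 1) = j + 1 + p by ring, run_succ (j + 1 + p) s]
          rfl
        rw [h3, run_succ (j + 1 + p) s]
        calc run g (j + 1 + p + 1) s * g (j + 1 + p) * (g (j + p) * run g j p) * g (j + 1 + p)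
            = run g (j + 1 + p + 1) s * g (j + 1 + p) * g (j + p) *
                (run g j p * g (j + 1 + p)) := by simp only [mul_assoc]
          _ = run g (j + 1 + p + 1) s * (g (j + 1 + p) * g (j + p) * g (j + 1 + p)) *
                run g j p := by rw [← h1]; simp only [mul_assoc]
          _ = _ := by
            rw [show j + 1 + p = j + p + 1 by ring, hc]
            simp only [mul_smul_comm, smul_mul_assoc]
      rw [mul_assoc, h2, mul_smul_comm]
      exact Submodule.smul_mem _ _ ((hw.mul ((word_run (by omega)).mul
        (word_run (by omega)))).mem (by omega))

lemma shorter_le (l : ℕ) :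
    shorter g n l ≤ Submodule.span ℂ {x | ∃ l' < l, Normal g n n l' x} := by
  induction l with
  | zero =>
    refine Submodule.span_le.mpr fun x hx => ?_
    obtain ⟨l', h, _⟩ := hx
    omega
  | succ l ih =>
    refine Submodule.span_le.mpr ?_
    rintro _ ⟨l', hl, h⟩
    cases h with
    | nil =>
      refine Submodule.subset_span ⟨0, hl, ?_⟩
      have : ∀ k, Normal g k n 0 1 := fun k => by
        induction k with
        | zero => exact .nil _
        | succ k ih => exact ih.skip
      exact this n
    | @snoc l' x i hx hi =>
      have hx' := ih (hx.mem (by omega))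
      clear hx
      induction hx' using Submodule.span_induction with
      | mem x hx =>
        obtain ⟨l'', h, hx⟩ := hx
        rcases hg.normal_mul hx le_rfl hi hi.le with h' | h'
        · refine Submodule.span_mono ?_ (ih (shorter_mono (by omega) h'))
          rintro y ⟨k, hk, hy⟩
          exact ⟨k, by omega, hy⟩
        · exact Submodule.subset_span ⟨_, by omega, h'⟩
      | zero => simp
      | add x x' _ _ h h' => rw [add_mul]; exact add_mem h h'
      | smul c x _ h => rw [smul_mul_assoc]; exact Submodule.smul_mem _ _ h

/-- The algebra generated by a family with the relations of the blob algebra has dimension at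
most that of the blob algebra. -/
lemma exists_span_eq (hgen : Algebra.adjoin ℂ {x | ∃ i < n, x = g i} = ⊤) :
    ∃ s : Finset A, s.card ≤ n.centralBinom ∧ Submodule.span ℂ (s : Set A) = ⊤ := by
  obtain ⟨s, hs, hs'⟩ := exists_finset_normal g n n
  refine ⟨s, hs.trans_eq (count_self n), ?_⟩
  have key : ∀ l x, Word g n l x → x ∈ Submodule.span ℂ (s : Set A) := fun l x hx =>
    Submodule.span_mono (fun y hy => by
      obtain ⟨k, _, hy⟩ := hy
      exact hs' _ _ hy) (hg.shorter_le (l + 1) (hx.mem l.lt_succ_self))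
  rw [eq_top_iff, ← Algebra.top_toSubmodule, ← hgen, Algebra.adjoin_eq_span, Submodule.span_le]
  intro x hx
  suffices ∃ l, Word g n l x from this.elim fun l h => key l x h
  induction hx using Submonoid.closure_induction with
  | mem x hx =>
    obtain ⟨i, hi, rfl⟩ := hx
    exact ⟨1, word_gen hi⟩
  | one => exact ⟨0, .nil⟩
  | mul x y _ _ hx hy =>
    obtain ⟨l, hx⟩ := hx
    obtain ⟨l', hy⟩ := hy
    exact ⟨_, hx.mul hy⟩

end BlobLike

end NormalWords

/-! ### Bitableaux as walks -/

section Bitableaux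

variable {n : ℕ}

/-- The walk formed by the first `j` entries of a bitableau. -/
def walk (S : Finset (Fin n)) : ℕ → List Bool
  | 0 => []
  | j + 1 => decide (∃ x ∈ S, x.val = j) :: walk S j

@[simp] lemma length_walk (S : Finset (Fin n)) (j : ℕ) : (walk S j).length = j := by
  induction j with
  | zero => rfl
  | succ j ih => rw [walk, List.length_cons, ih]

lemma walk_congr {S S' : Finset (Fin n)} {j : ℕ} (h : ∀ x : Fin n, x.val < j → (x ∈ S ↔ x ∈ S')) :
    walk S j = walk S' j := by
  induction j with
  | zero => rfl
  | succ j ih =>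
    have : (∃ x ∈ S, x.val = j) ↔ ∃ x ∈ S', x.val = j :=
      ⟨fun ⟨x, hx, hj⟩ => ⟨x, (h x (by omega)).1 hx, hj⟩,
        fun ⟨x, hx, hj⟩ => ⟨x, (h x (by omega)).2 hx, hj⟩⟩
    simp only [walk, this, ih fun x hx => h x (by omega)]

lemma mem_congr_of_walk {S S' : Finset (Fin n)} {j : ℕ} (h : walk S j = walk S' j) (x : Fin n)
    (hx : x.val < j) : x ∈ S ↔ x ∈ S' := by
  induction j with
  | zero => omega
  | succ j ih =>
    obtain ⟨h1, h2⟩ := List.cons.inj h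
    rcases Nat.lt_succ_iff_lt_or_eq.mp hx with hx | rfl
    · exact ih h2 hx
    · simpa [Fin.val_inj] using h1

lemma walk_injective : Function.Injective fun S : Finset (Fin n) => walk S n := fun S S' h => by
  ext x
  exact mem_congr_of_walk h x x.isLt

lemma exists_walk_eq : ∀ v : List Bool, v.length ≤ n → ∃ S : Finset (Fin n), walk S v.length = v
  | [], _ => ⟨∅, rfl⟩
  | b :: v, hv => by
    rw [List.length_cons] at hv
    obtain ⟨S, hS⟩ := exists_walk_eq v (by omega)
    let k : Fin n := ⟨v.length, by omega⟩
    let S' := if b then insert k S else S.erase k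
    have hk : k ∈ S' ↔ b = true := by cases b <;> simp [S']
    refine ⟨S', ?_⟩
    have h1 : walk S' v.length = walk S v.length := walk_congr fun x hx => by
      have hxk : x ≠ k := fun h => by simp [h, k] at hx
      cases b <;> simp [S', hxk]
    have h2 : (∃ x ∈ S', x.val = v.length) ↔ b = true := by
      rw [← hk]
      exact ⟨fun ⟨x, hx, h⟩ => (Fin.ext h : x = k) ▸ hx, fun h => ⟨k, h, rfl⟩⟩
    rw [List.length_cons, walk, h1, hS]
    simp [h2]

lemma card_filter_succ (S : Finset (Fin n)) (j : ℕ) :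
    (S.filter fun x => x.val < j + 1).card =
      (S.filter fun x => x.val < j).card + if ∃ x ∈ S, x.val = j then 1 else 0 := by
  split_ifs with h
  · obtain ⟨x, hx, rfl⟩ := h
    rw [← Finset.card_insert_of_notMem (a := x) (s := S.filter fun y => y.val < x.val) (by simp)]
    congr 1
    ext y
    simp only [Finset.mem_filter, Finset.mem_insert, Nat.lt_succ_iff_lt_or_eq, Fin.val_inj]
    constructor
    · tauto
    · rintro (rfl | h)
      · exact ⟨hx, .inr rfl⟩
      · tauto
  · rw [add_zero]
    congr 1
    refine Finset.filter_congr fun x hx => ?_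
    have : x.val ≠ j := fun h' => h ⟨x, hx, h'⟩
    omega

lemma pos_walk (S : Finset (Fin n)) (j : ℕ) : pos (walk S j) = seqI n S j := by
  induction j with
  | zero => simp [walk, seqI]
  | succ j ih =>
    rw [walk, pos_cons, ih, seqI, seqI, card_filter_succ]
    by_cases h : ∃ x ∈ S, x.val = j <;> simp [h, inc] <;> ring

lemma filter_val_lt_self (S : Finset (Fin n)) : S.filter (fun x => x.val < n) = S :=
  Finset.filter_true_of_mem fun x _ => x.isLt

lemma seqI_self (S : Finset (Fin n)) : seqI n S n = 2 * S.card - n := by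
  rw [seqI, filter_val_lt_self]

lemma count_true_walk (S : Finset (Fin n)) (j : ℕ) :
    (walk S j).count true = (S.filter fun x => x.val < j).card := by
  induction j with
  | zero => simp [walk]
  | succ j ih =>
    rw [walk, card_filter_succ, List.count_cons, ih]
    by_cases h : ∃ x ∈ S, x.val = j <;> simp [h]

lemma walk_compl (S : Finset (Fin n)) {j : ℕ} (h : j ≤ n) : walk Sᶜ j = (walk S j).map not := by
  induction j with
  | zero => rfl
  | succ j ih =>
    have h1 (S : Finset (Fin n)) : (∃ x ∈ S, x.val = j) ↔ ⟨j, h⟩ ∈ S :=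
      ⟨fun ⟨x, hx, hj⟩ => (Fin.ext hj : x = ⟨j, h⟩) ▸ hx, fun h => ⟨_, h, rfl⟩⟩
    have h2 : (∃ x ∈ Sᶜ, x.val = j) ↔ ¬∃ x ∈ S, x.val = j := by rw [h1, h1, Finset.mem_compl]
    simp only [walk, ih (by omega), h2, List.map_cons, decide_not]

lemma count_false_walk (S : Finset (Fin n)) {j : ℕ} (h : j ≤ n) :
    (walk S j).count false = (Sᶜ.filter fun x => x.val < j).card := by
  rw [← count_true_walk, walk_compl S h, ← Bool.not_false,
    List.count_map_of_injective _ _ Bool.not_injective]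

lemma dom_walk_iff (S S' : Finset (Fin n)) (j : ℕ) : Dom (walk S j) (walk S' j) ↔
    ∀ i, 1 ≤ i → i ≤ j → Above (seqI n S i) (seqI n S' i) := by
  induction j with
  | zero => exact iff_of_true trivial fun i _ _ => by omega
  | succ j ih =>
    change Dom (walk S j) (walk S' j) ∧ Above (pos (walk S (j + 1))) (pos (walk S' (j + 1))) ↔ _
    rw [ih, pos_walk, pos_walk]
    refine ⟨fun ⟨h, h'⟩ i hi hij => ?_, fun h => ⟨fun i hi hij => h i hi (by omega),
      h _ (by omega) le_rfl⟩⟩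
    rcases hij.lt_or_eq with hij | rfl
    · exact h i hi (by omega)
    · exact h'

lemma exists_walk_append (S : Finset (Fin n)) (k : Fin n) :
    ∃ x, walk S n = x ++ decide (k ∈ S) :: walk S k.val := by
  have h : ∀ d, ∃ x, walk S (k.val + 1 + d) = x ++ walk S (k.val + 1) := fun d => by
    induction d with
    | zero => exact ⟨[], rfl⟩
    | succ d ih =>
      obtain ⟨x, hx⟩ := ih
      exact ⟨_ :: x, by rw [← add_assoc, walk, hx]; rfl⟩
  obtain ⟨x, hx⟩ := h (n - (k.val + 1))
  refine ⟨x, ?_⟩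
  rw [show k.val + 1 + (n - (k.val + 1)) = n by omega] at hx
  rw [hx, walk]
  simp [Fin.val_inj]

lemma card_filter_le {S : Finset (Fin n)} {k : Fin n} (hk : k ∈ S) :
    (S.filter fun x => x ≤ k).card = (S.filter fun x => x.val < k.val).card + 1 := by
  have := card_filter_succ S k.val
  rw [if_pos ⟨k, hk, rfl⟩] at this
  rw [← this]
  simp only [Fin.le_def, Nat.lt_succ_iff]

lemma stepContent_walk (q : ℂ) (m : ℤ) (S : Finset (Fin n)) (k : Fin n) :
    stepContent q (q ^ m) (walk S k.val) (decide (k ∈ S)) = content q m n S k := by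
  by_cases h : k ∈ S
  · rw [stepContent, content, if_pos h, card_filter_le h, Nat.add_sub_cancel, ← count_true_walk]
    simp [h]
  · rw [stepContent, content, if_neg h, card_filter_le (Finset.mem_compl.mpr h),
      Nat.add_sub_cancel, ← count_false_walk S k.isLt.le, zpow_neg]
    simp [h]

/-- The walk of a bitableau. -/
def Std.walk {lam : Bi n} (s : Std n lam) : List Bool := Statement5.walk s.1 n

lemma Std.length_walk {lam : Bi n} (s : Std n lam) : s.walk.length = n :=
  Statement5.length_walk _ _

lemma Std.pos_walk {lam : Bi n} (s : Std n lam) : pos s.walk = fBi lam := by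
  rw [Std.walk, Statement5.pos_walk, seqI_self, s.2, fBi]
  have := lam.2
  omega

lemma Std.walk_injective {lam : Bi n} : Function.Injective (Std.walk (lam := lam)) :=
  fun _ _ h => Subtype.ext (Statement5.walk_injective h)

lemma fBi_injective : Function.Injective (fBi (n := n)) := fun lam mu h => by
  have h1 := lam.2
  have h2 := mu.2
  rw [fBi, fBi] at h
  exact Subtype.ext (Prod.ext (by omega) (by omega))

lemma exists_std (v : List Bool) (hv : v.length = n) :
    ∃ lam : Bi n, ∃ s : Std n lam, s.walk = v := by
  obtain ⟨S, hS⟩ := exists_walk_eq (n := n) v hv.le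
  have hc : S.card ≤ n := by simpa using S.card_le_univ
  refine ⟨⟨(S.card, n - S.card), by simp; omega⟩, ⟨S, rfl⟩, ?_⟩
  rw [Std.walk, ← hS, hv]

lemma exists_std_of_pos {v : List Bool} (hv : v.length = n) {lam : Bi n} (h : pos v = fBi lam) :
    ∃ s : Std n lam, s.walk = v := by
  obtain ⟨mu, s, hs⟩ := exists_std v hv
  obtain rfl : mu = lam := fBi_injective (by rw [← s.pos_walk, hs, h])
  exact ⟨s, hs⟩

lemma Std.dom_walk_iff {lam : Bi n} (s t : Std n lam) :
    Dom s.walk t.walk ↔ tabSucceq n s.1 t.1 :=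
  Statement5.dom_walk_iff _ _ _

lemma biSucceq_of_above {lam mu : Bi n} (h : Above (fBi lam) (fBi mu)) : biSucceq lam mu := by
  rcases h.1.lt_or_eq with hlt | heq
  · exact .inl hlt
  · exact .inr ⟨heq, h.2 heq⟩

/-- The indices of the diagram basis. -/
abbrev Idx (n : ℕ) := Σ lam : Bi n, Std n lam × Std n lam

/-- Indices of the diagram basis are pairs of subsets of equal cardinality. -/
def idxEquiv (n : ℕ) :
    Idx n ≃ {p : Finset (Fin n) × Finset (Fin n) // p.1.card = p.2.card} where
  toFun i := ⟨(i.2.1.1, i.2.2.1), i.2.1.2.trans i.2.2.2.symm⟩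
  invFun p := ⟨⟨(p.1.1.card, n - p.1.1.card),
    Nat.add_sub_of_le (by simpa using p.1.1.card_le_univ)⟩, ⟨p.1.1, rfl⟩, ⟨p.1.2, p.2.symm⟩⟩
  left_inv := by
    rintro ⟨⟨⟨a, b⟩, h⟩, ⟨s, hs⟩, ⟨t, ht⟩⟩
    dsimp at h hs ht
    subst hs
    obtain rfl : b = n - s.card := by omega
    rfl
  right_inv _ := rfl

instance : Fintype (Idx n) := Fintype.ofEquiv _ (idxEquiv n).symm

lemma card_idx (n : ℕ) : Fintype.card (Idx n) = n.centralBinom := by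
  rw [Fintype.card_congr (idxEquiv n), Fintype.card_subtype,
    Finset.card_eq_sum_card_fiberwise (f := fun p => p.1.card) (t := Finset.range (n + 1)),
    Nat.centralBinom, ← Nat.sum_range_choose_sq]
  · refine Finset.sum_congr rfl fun a _ => ?_
    have : Finset.filter (fun p : Finset (Fin n) × Finset (Fin n) => p.1.card = a)
        (Finset.filter (fun p => p.1.card = p.2.card) Finset.univ) =
        Finset.powersetCard a Finset.univ ×ˢ Finset.powersetCard a Finset.univ := by
      ext p
      simp only [Finset.mem_filter, Finset.mem_univ, true_and, Finset.mem_product,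
        Finset.mem_powersetCard, Finset.subset_univ]
      constructor <;> rintro ⟨h, h'⟩ <;> omega
    rw [this, Finset.card_product, Finset.card_powersetCard, Finset.card_univ, Fintype.card_fin,
      sq]
  · intro p _
    have : p.1.card ≤ n := by simpa using p.1.card_le_univ
    simpa using Nat.lt_succ_of_le this

end Bitableaux

/-! ### The blob algebra and its diagrams -/

section BlobAlgebra

variable {q : ℂ} {m : ℤ} {n : ℕ}

variable (q m n) in
/-- The generators of the blob algebra in one sequence. -/
def blobGen : ℕ → Blob q m n
  | 0 => emk q m n
  | i + 1 => Uel q m n i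

lemma uel_eq {i : ℕ} (h : i + 1 < n) : Uel q m n i = Umk q m n ⟨i, by omega⟩ :=
  dif_pos _

lemma blobLike : BlobLike (blobGen q m n) n where
  sq i hi := by
    cases i with
    | zero =>
      refine ⟨1, ?_⟩
      have := RingQuot.mkAlgHom_rel ℂ (BlobRel.ee (q := q) (m := m) (n := n))
      rw [map_mul] at this
      rw [one_smul]
      exact this
    | succ i =>
      refine ⟨-(q + q⁻¹), ?_⟩
      have := RingQuot.mkAlgHom_rel ℂ (BlobRel.Usq (q := q) (m := m) (n := n) ⟨i, by omega⟩)
      rw [map_mul, map_smul] at this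
      rw [blobGen, uel_eq hi]
      exact this
  up i hi hin := by
    obtain ⟨i, rfl⟩ : ∃ k, i = k + 1 := ⟨i - 1, by omega⟩
    refine ⟨1, ?_⟩
    have := RingQuot.mkAlgHom_rel ℂ (BlobRel.UUU (q := q) (m := m) (n := n)
      ⟨i, by omega⟩ ⟨i + 1, by omega⟩ (.inl rfl))
    rw [map_mul, map_mul] at this
    rw [blobGen, blobGen, uel_eq (by omega), uel_eq hin, one_smul]
    exact this
  down i hi := by
    cases i with
    | zero =>
      refine ⟨-(gauss q (m - 1) / gauss q m), ?_⟩
      have := RingQuot.mkAlgHom_rel ℂ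
        (BlobRel.UeU (q := q) (m := m) (n := n) ⟨0, by omega⟩ rfl)
      rw [map_mul, map_mul, map_smul] at this
      rw [blobGen, blobGen, uel_eq hi]
      exact this
    | succ i =>
      refine ⟨1, ?_⟩
      have := RingQuot.mkAlgHom_rel ℂ (BlobRel.UUU (q := q) (m := m) (n := n)
        ⟨i + 1, by omega⟩ ⟨i, by omega⟩ (.inr rfl))
      rw [map_mul, map_mul] at this
      rw [blobGen, blobGen, uel_eq hi, uel_eq (by omega), one_smul]
      exact this
  comm i j hij hj := by
    obtain ⟨j, rfl⟩ : ∃ k, j = k + 1 := ⟨j - 1, by omega⟩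
    cases i with
    | zero =>
      have := RingQuot.mkAlgHom_rel ℂ
        (BlobRel.Ue (q := q) (m := m) (n := n) ⟨j, by omega⟩ (by simp only; omega))
      rw [map_mul, map_mul] at this
      rw [blobGen, blobGen, uel_eq hj]
      exact this.symm
    | succ i =>
      have := RingQuot.mkAlgHom_rel ℂ (BlobRel.Ucomm (q := q) (m := m) (n := n)
        ⟨i, by omega⟩ ⟨j, by omega⟩ (.inl (by simp only; omega)))
      rw [map_mul, map_mul] at this
      rw [blobGen, blobGen, uel_eq hj, uel_eq (by omega)]
      exact this

lemma adjoin_blobGen (hn : 1 ≤ n) :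
    Algebra.adjoin ℂ {x | ∃ i < n, x = blobGen q m n i} = ⊤ := by
  have h : Algebra.adjoin ℂ (RingQuot.mkAlgHom ℂ (BlobRel q m n) ''
      Set.range (FreeAlgebra.ι ℂ)) = ⊤ := by
    rw [← AlgHom.map_adjoin, FreeAlgebra.adjoin_range_ι, Algebra.map_top,
      AlgHom.range_eq_top]
    exact RingQuot.mkAlgHom_surjective ℂ _
  rw [eq_top_iff, ← h]
  refine Algebra.adjoin_mono ?_
  rintro _ ⟨_, ⟨_ | i, rfl⟩, rfl⟩
  · exact ⟨0, hn, rfl⟩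
  · have := i.isLt
    refine ⟨i.val + 1, by omega, ?_⟩
    rw [blobGen, uel_eq (by omega)]
    rfl

namespace CupCap

variable {A : Type*} [Ring A] [Algebra ℂ A] {y : ℂ} (T : CupCap q y A)

lemma ud_mul_ud (i : ℕ) : T.u i * T.d i * (T.u i * T.d i) = (-(q + q⁻¹)) • (T.u i * T.d i) := by
  rw [mul_assoc, ← mul_assoc (T.d i), T.du_smul, smul_mul_assoc, one_mul, mul_smul_comm]

variable (hy : y = -(gauss q (m - 1) / gauss q m))

variable (n) in
/-- The realisation of the blob algebra by diagrams. -/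
def ofBlob : Blob q m n →ₐ[ℂ] A :=
  RingQuot.liftAlgHom ℂ ⟨FreeAlgebra.lift ℂ fun g => match g with
    | .e => T.e
    | .U i => T.u i * T.d i, fun x z h => by
      induction h with
      | Usq i =>
        simp only [UF, map_mul, map_smul, FreeAlgebra.lift_ι_apply]
        exact T.ud_mul_ud i
      | UUU i j h =>
        simp only [UF, map_mul, FreeAlgebra.lift_ι_apply]
        have h1 : T.d i * T.u j = 1 ∧ T.d j * T.u i = 1 := by
          rcases h with h | h
          · rw [← h]
            exact ⟨T.du_up _, T.du_down _⟩
          · rw [← h]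
            exact ⟨T.du_down _, T.du_up _⟩
        calc T.u i * T.d i * (T.u j * T.d j) * (T.u i * T.d i)
            = T.u i * (T.d i * T.u j) * (T.d j * T.u i) * T.d i := by simp only [mul_assoc]
          _ = T.u i * T.d i := by rw [h1.1, h1.2, mul_one, mul_one]
      | Ucomm i j h =>
        simp only [UF, map_mul, FreeAlgebra.lift_ι_apply]
        have key : ∀ i j : ℕ, i ≤ j → T.u i * T.d i * (T.u (j + 2) * T.d (j + 2)) =
            T.u (j + 2) * T.d (j + 2) * (T.u i * T.d i) := fun i j h => by
          calc T.u i * T.d i * (T.u (j + 2) * T.d (j + 2))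
              = T.u i * (T.d i * T.u (j + 2)) * T.d (j + 2) := by simp only [mul_assoc]
            _ = T.u (j + 2) * (T.u i * T.d j) * T.d i := by
                rw [T.du_lt h, ← mul_assoc, ← T.uu _ _ h, mul_assoc, T.dd h]
                simp only [mul_assoc]
            _ = _ := by rw [← T.du_gt h]; simp only [mul_assoc]
        rcases h with h | h
        · have := key i (j - 2) (by omega)
          rwa [show j.val - 2 + 2 = j by omega] at this
        · have := key j (i - 2) (by omega)
          rw [show i.val - 2 + 2 = i by omega] at this
          exact this.symm
      | UeU i h =>
        simp only [UF, eF, map_mul, map_smul, FreeAlgebra.lift_ι_apply]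
        rw [h, ← hy]
        calc T.u 0 * T.d 0 * T.e * (T.u 0 * T.d 0)
            = T.u 0 * (T.d 0 * (T.e * T.u 0)) * T.d 0 := by simp only [mul_assoc]
          _ = _ := by rw [T.deu_smul, mul_smul_comm, mul_one, smul_mul_assoc]
      | ee =>
        simp only [eF, map_mul, FreeAlgebra.lift_ι_apply]
        exact T.ee
      | Ue i h =>
        simp only [UF, eF, map_mul, FreeAlgebra.lift_ι_apply]
        rw [show i.val = i.val - 1 + 1 by omega, mul_assoc, ← T.ed, ← mul_assoc, ← T.eu,
          mul_assoc]⟩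

lemma ofBlob_emk : T.ofBlob n hy (emk q m n) = T.e := by
  simp [ofBlob, emk, eF]

lemma ofBlob_uel {i : ℕ} (h : i + 1 < n) : T.ofBlob n hy (Uel q m n i) = T.u i * T.d i := by
  rw [uel_eq h]
  simp [ofBlob, Umk, UF]

lemma range_ofBlob (hn : 1 ≤ n) : (T.ofBlob n hy).range = T.alg n := by
  rw [← Algebra.map_top, ← adjoin_blobGen hn, AlgHom.map_adjoin]
  refine le_antisymm (Algebra.adjoin_le ?_) (Algebra.adjoin_mono ?_)
  · rintro _ ⟨_, ⟨_ | i, hi, rfl⟩, rfl⟩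
    · rw [blobGen, SetLike.mem_coe, ofBlob_emk]
      exact T.e_mem_alg hn
    · rw [blobGen, SetLike.mem_coe, T.ofBlob_uel hy hi]
      exact T.ud_mem_alg hi
  · rintro x (⟨_, rfl⟩ | ⟨i, hi, rfl⟩)
    · exact ⟨_, ⟨0, hn, rfl⟩, T.ofBlob_emk hy⟩
    · exact ⟨_, ⟨i + 1, hi, rfl⟩, T.ofBlob_uel hy hi⟩

lemma ofBlob_lel (hq : q ≠ 0) (hq2 : q ^ 2 ≠ 1) (k : ℕ) (hk : k < n) :
    T.ofBlob n hy (Lel q m n k) = T.jm q (q ^ m) k := by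
  induction k with
  | zero =>
    have h : q - q⁻¹ ≠ 0 := fun h => hq2 (by
      have := congrArg (· * q) h
      simp only [sub_mul, inv_mul_cancel₀ hq, zero_mul] at this
      linear_combination this)
    rw [Lel, jm_zero, U0el, map_add, map_smul, map_smul, ofBlob_emk, AlgHom.commutes,
      Algebra.algebraMap_eq_smul_one, smul_smul, gauss, mul_neg, mul_div_cancel₀ _ h, zpow_neg]
    module
  | succ k ih =>
    rw [Lel, jm_succ, map_mul, map_mul, map_add, T.ofBlob_uel hy hk, AlgHom.commutes,
      Algebra.algebraMap_eq_smul_one, ih (by omega), G]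

variable (hn : 1 ≤ n)

include hn hy in
lemma exists_ofBlob_eq (i : Idx n) : ∃ x : Blob q m n,
    T.ofBlob n hy x = T.Y i.2.1.walk * T.tr (T.Y i.2.2.walk) := by
  have h := T.pairs n i.2.1.walk i.2.2.walk i.2.1.length_walk i.2.2.length_walk
    (i.2.1.pos_walk.trans i.2.2.pos_walk.symm) trivial
  rw [← T.range_ofBlob hy hn] at h
  exact h

/-- The diagram basis of the blob algebra. -/
def diagram (i : Idx n) : Blob q m n := (T.exists_ofBlob_eq hy hn i).choose

lemma ofBlob_diagram (i : Idx n) :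
    T.ofBlob n hy (T.diagram hy hn i) = T.Y i.2.1.walk * T.tr (T.Y i.2.2.walk) :=
  (T.exists_ofBlob_eq hy hn i).choose_spec

section Basis

variable [Nontrivial A] (L : T.Letters)
include L

lemma linearIndependent_ofBlob_diagram :
    LinearIndependent ℂ fun i => T.ofBlob n hy (T.diagram hy hn i) := by
  simp only [ofBlob_diagram]
  refine T.linearIndependent_Y_mul_tr L ?_ (fun i => i.2.1.length_walk)
    (fun i => i.2.2.length_walk) (fun i => i.2.1.pos_walk.trans i.2.2.pos_walk.symm)
  rintro ⟨lam, s, t⟩ ⟨mu, s', t'⟩ h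
  obtain ⟨h1, h2⟩ := Prod.mk.inj h
  obtain rfl : lam = mu := fBi_injective (by
    rw [← s.pos_walk, ← s'.pos_walk]; exact congrArg pos h1)
  obtain rfl := Std.walk_injective h1
  obtain rfl := Std.walk_injective h2
  rfl

lemma linearIndependent_diagram : LinearIndependent ℂ (T.diagram (n := n) hy hn) :=
  LinearIndependent.of_comp (T.ofBlob n hy).toLinearMap
    (T.linearIndependent_ofBlob_diagram hy hn L)

lemma span_diagram : Submodule.span ℂ (Set.range (T.diagram (n := n) hy hn)) = ⊤ := by
  obtain ⟨s, hs, hs'⟩ := (blobLike (q := q) (m := m) (n := n)).exists_span_eq (adjoin_blobGen hn)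
  have : Module.Finite ℂ (Blob q m n) := ⟨⟨s, hs'⟩⟩
  refine (T.linearIndependent_diagram hy hn L).span_eq_top_of_card_eq_finrank' ?_
  refine le_antisymm (T.linearIndependent_diagram hy hn L).fintype_card_le_finrank ?_
  rw [card_idx, ← finrank_top, ← hs']
  exact (finrank_span_finset_le_card s).trans hs

include hn in
lemma ofBlob_injective : Function.Injective (T.ofBlob n hy) := by
  rw [injective_iff_map_eq_zero]
  intro x hx
  have hmem : x ∈ Submodule.span ℂ (Set.range (T.diagram (n := n) hy hn)) := by
    rw [T.span_diagram hy hn L]; trivial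
  obtain ⟨r, rfl⟩ := (Submodule.mem_span_range_iff_exists_fun ℂ).mp hmem
  have := Fintype.linearIndependent_iff.mp (T.linearIndependent_ofBlob_diagram hy hn L) r
    (by simpa using hx)
  simp [this]

include hn in
lemma exists_anti_automorphism : ∃ σ : Blob q m n ≃ₗ[ℂ] Blob q m n,
    (∀ x z, σ (x * z) = σ z * σ x) ∧
      ∀ x, T.ofBlob n hy (σ x) = T.tr (T.ofBlob n hy x) := by
  have hinj := T.ofBlob_injective hy hn L
  have hex : ∀ x, ∃ z, T.ofBlob n hy z = T.tr (T.ofBlob n hy x) := fun x => by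
    have h : T.tr (T.ofBlob n hy x) ∈ (T.ofBlob n hy).range := by
      rw [T.range_ofBlob hy hn]
      refine T.tr_mem_alg ?_
      rw [← T.range_ofBlob hy hn]
      exact ⟨x, rfl⟩
    exact h
  choose f hf using hex
  let σ : Blob q m n →ₗ[ℂ] Blob q m n :=
    { toFun := f
      map_add' := fun x z => hinj (by simp only [map_add, hf])
      map_smul' := fun c x => hinj (by simp only [map_smul, hf, RingHom.id_apply]) }
  have hσ : Function.Involutive σ := fun x => hinj (by
    change T.ofBlob n hy (f (f x)) = _
    rw [hf, hf, T.tr_tr])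
  refine ⟨LinearEquiv.ofInvolutive σ hσ, fun x z => hinj ?_, hf⟩
  change T.ofBlob n hy (f (x * z)) = T.ofBlob n hy (f z * f x)
  rw [hf, map_mul, T.tr_mul, map_mul, hf, hf]

end Basis

end CupCap

end BlobAlgebra

section CellularBasis

variable {q y : ℂ} {m : ℤ} {n : ℕ}

namespace CupCap

variable {A : Type*} [Ring A] [Algebra ℂ A] (T : CupCap q y A)

lemma exists_coeff {lam : Bi n} {S : Set (List Bool)} (hS : S ⊆ walks n) {x : A}
    (hx : x ∈ T.F S (fBi lam)) : ∃ r : Std n lam → ℂ, (∀ u, u.walk ∉ S → r u = 0) ∧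
      ∀ t : Std n lam, x * T.tr (T.Y t.walk) - ∑ u, r u • (T.Y u.walk * T.tr (T.Y t.walk)) ∈
        T.M (walks n) {b | b.length = n ∧ Above (pos b) (fBi lam) ∧ pos b ≠ fBi lam} := by
  classical
  obtain ⟨r, hr, h⟩ := T.cell_of_mem_F hx
  rw [Finsupp.mem_supported] at hr
  refine ⟨fun u => r u.walk, fun u hu => ?_, fun t => ?_⟩
  · by_contra hne
    exact hu (hr (Finsupp.mem_support_iff.mpr hne)).1
  · have h1 := h t.walk t.pos_walk
    rw [t.length_walk] at h1
    have h2 : Finsupp.linearCombination ℂ (fun v => T.Y v * T.tr (T.Y t.walk)) r =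
        ∑ u : Std n lam, r u.walk • (T.Y u.walk * T.tr (T.Y t.walk)) := by
      rw [Finsupp.linearCombination_apply,
        Finsupp.sum_of_support_subset r (s := Finset.univ.image (Std.walk (lam := lam))) ?_ _
          (by simp), Finset.sum_image Std.walk_injective.injOn]
      intro v hv
      obtain ⟨hv, hp⟩ := hr hv
      obtain ⟨s, hs⟩ := exists_std_of_pos (hS hv) hp
      exact Finset.mem_image.mpr ⟨s, Finset.mem_univ _, hs⟩
    rw [h2] at h1
    refine Submodule.span_mono ?_ h1
    rintro _ ⟨a, b, ha, hb, hab, rfl⟩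
    exact ⟨a, b, hS ha, hb, hab, rfl⟩

variable (hy : y = -(gauss q (m - 1) / gauss q m)) (hn : 1 ≤ n)

/-- The span of the diagrams of shape strictly above `lam`. -/
def higher (lam : Bi n) : Submodule ℂ (Blob q m n) :=
  Submodule.span ℂ {x | ∃ (mu : Bi n) (_ : biSucceq mu lam ∧ mu ≠ lam) (u v : Std n mu),
    x = T.diagram hy hn ⟨mu, u, v⟩}

lemma M_le_map_higher (lam : Bi n) :
    T.M (walks n) {b | b.length = n ∧ Above (pos b) (fBi lam) ∧ pos b ≠ fBi lam} ≤
      (T.higher hy hn lam).map (T.ofBlob n hy).toLinearMap := by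
  refine Submodule.span_le.mpr ?_
  rintro _ ⟨a, b, ha, ⟨hb, hab, hne⟩, hp, rfl⟩
  obtain ⟨mu, u, rfl⟩ := exists_std a ha
  obtain ⟨v, rfl⟩ := exists_std_of_pos hb (hp.symm.trans u.pos_walk)
  rw [v.pos_walk] at hab hne
  exact ⟨T.diagram hy hn ⟨mu, u, v⟩, Submodule.subset_span
    ⟨mu, ⟨biSucceq_of_above hab, fun h => hne (h ▸ rfl)⟩, u, v, rfl⟩, T.ofBlob_diagram hy hn _⟩

variable [Nontrivial A] (L : T.Letters)
include L

lemma exists_coeff_diagram {lam : Bi n} {S : Set (List Bool)} (hS : S ⊆ walks n)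
    {x : Blob q m n} {s : Std n lam} {c : ℂ}
    (hx : T.ofBlob n hy x * T.Y s.walk - c • T.Y s.walk ∈ T.F S (fBi lam)) :
    ∃ r : Std n lam → ℂ, (∀ u, u.walk ∉ S → r u = 0) ∧ ∀ t : Std n lam,
      x * T.diagram hy hn ⟨lam, s, t⟩ - c • T.diagram hy hn ⟨lam, s, t⟩ -
        ∑ u, r u • T.diagram hy hn ⟨lam, u, t⟩ ∈ T.higher hy hn lam := by
  obtain ⟨r, hr, h⟩ := T.exists_coeff hS hx
  refine ⟨r, hr, fun t => ?_⟩
  obtain ⟨z, hz, h⟩ := T.M_le_map_higher hy hn lam (h t)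
  suffices x * T.diagram hy hn ⟨lam, s, t⟩ - c • T.diagram hy hn ⟨lam, s, t⟩ -
      ∑ u, r u • T.diagram hy hn ⟨lam, u, t⟩ = z from this ▸ hz
  refine T.ofBlob_injective hy hn L (Eq.trans ?_ h.symm)
  simp only [map_sub, map_mul, map_sum, map_smul, ofBlob_diagram, sub_mul, mul_assoc,
    smul_mul_assoc]

include hy hn in
theorem jucysMurphy_cellular (hq : q ≠ 0) (hq2 : q ^ 2 ≠ 1) (hm : gauss q m ≠ 0) :
    ∃ c : (lam : Bi n) → Std n lam → Std n lam → Blob q m n,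
      LinearIndependent ℂ
        (fun p : Σ lam : Bi n, Std n lam × Std n lam => c p.1 p.2.1 p.2.2) ∧
      Submodule.span ℂ
        (Set.range (fun p : Σ lam : Bi n, Std n lam × Std n lam => c p.1 p.2.1 p.2.2)) = ⊤ ∧
      (∃ σ : Blob q m n ≃ₗ[ℂ] Blob q m n,
        (∀ x y, σ (x * y) = σ y * σ x) ∧
        ∀ (lam : Bi n) (s t : Std n lam), σ (c lam s t) = c lam t s) ∧
      (∀ (a : Blob q m n) (lam : Bi n) (s : Std n lam),
        ∃ r : Std n lam → ℂ, ∀ t : Std n lam,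
          a * c lam s t - ∑ u : Std n lam, r u • c lam u t ∈
            Submodule.span ℂ
              {x | ∃ (mu : Bi n) (_ : biSucceq mu lam ∧ mu ≠ lam)
                  (u v : Std n mu), x = c mu u v}) ∧
      (∀ (lam : Bi n) (s t : Std n lam) (k : Fin n),
        ∃ a : Std n lam → ℂ,
          (∀ u : Std n lam, ¬ (tabSucceq n u.1 s.1 ∧ u ≠ s) → a u = 0) ∧
          Lel q m n k.val * c lam s t - content q m n s.1 k • c lam s t -
              ∑ u : Std n lam, a u • c lam u t ∈
            Submodule.span ℂ
              {x | ∃ (mu : Bi n) (_ : biSucceq mu lam ∧ mu ≠ lam)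
                  (u v : Std n mu), x = c mu u v}) := by
  refine ⟨fun lam s t => T.diagram hy hn ⟨lam, s, t⟩, T.linearIndependent_diagram hy hn L,
    T.span_diagram hy hn L, ?_, fun a lam s => ?_, fun lam s t k => ?_⟩
  · obtain ⟨σ, h1, h2⟩ := T.exists_anti_automorphism hy hn L
    refine ⟨σ, h1, fun lam s t => T.ofBlob_injective hy hn L ?_⟩
    rw [h2, ofBlob_diagram, ofBlob_diagram, T.tr_mul, T.tr_tr]
  · have ha : T.ofBlob n hy a ∈ T.alg n := by
      rw [← T.range_ofBlob hy hn]
      exact ⟨a, rfl⟩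
    have h := T.alg_mul_Y ha s.length_walk
    rw [s.pos_walk] at h
    obtain ⟨r, -, hr⟩ := T.exists_coeff_diagram hy hn L (c := 0) subset_rfl
      (by rwa [zero_smul, sub_zero])
    refine ⟨r, fun t => ?_⟩
    have := hr t
    rwa [zero_smul, sub_zero] at this
  · have hne : q - q⁻¹ ≠ 0 := fun h => hm (by rw [gauss, h, div_zero])
    have hqm : q ^ m ≠ 0 := zpow_ne_zero m hq
    have hy' : (q ^ m - (q ^ m)⁻¹) * y = -(q⁻¹ * q ^ m - q * (q ^ m)⁻¹) := by
      have h1 : q ^ m - (q ^ m)⁻¹ = gauss q m * (q - q⁻¹) := by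
        rw [gauss, div_mul_cancel₀ _ hne, zpow_neg]
      have h2 : q⁻¹ * q ^ m - q * (q ^ m)⁻¹ = gauss q (m - 1) * (q - q⁻¹) := by
        rw [gauss, div_mul_cancel₀ _ hne, zpow_neg, zpow_sub_one₀ hq, mul_inv, inv_inv]
        ring
      rw [h1, h2, hy]
      field_simp
    obtain ⟨x, hx⟩ := exists_walk_append s.1 k
    have h := T.jm_mul_Y_append hq rfl hqm hy' x (walk s.1 k.val) (decide (k ∈ s.1))
    rw [← hx, length_walk, stepContent_walk, ← T.ofBlob_lel hy hq hq2 k k.isLt] at h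
    change _ ∈ T.F (strict s.walk) (pos s.walk) at h
    rw [s.pos_walk] at h
    obtain ⟨r, hr, h⟩ := T.exists_coeff_diagram hy hn L
      (fun v hv => hv.1.length_eq.trans s.length_walk) h
    refine ⟨r, fun u hu => hr u fun hu' => hu ⟨?_, ?_⟩, h t⟩
    · exact (Std.dom_walk_iff u s).mp hu'.1
    · rintro rfl
      exact hu'.2 rfl

end CupCap

end CellularBasis

lemma exists_parameters {q : ℂ} (hq : q ≠ 0) {m : ℤ} (hm : gauss q m ≠ 0) :
    ∃ α v₁ v₂ : ℂ, α ≠ 0 ∧ v₁ ≠ 0 ∧ v₂ ≠ 0 ∧ α ^ 2 + α⁻¹ ^ 2 = -(q + q⁻¹) ∧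
      v₁ ^ 2 + v₂ ^ 2 = 1 ∧
      α ^ 2 * v₁ ^ 2 + α⁻¹ ^ 2 * v₂ ^ 2 = -(gauss q (m - 1) / gauss q m) := by
  have hne : q - q⁻¹ ≠ 0 := fun h => hm (by rw [gauss, h, div_zero])
  have hqm : q ^ m ≠ 0 := zpow_ne_zero m hq
  have hΔ : q ^ m - (q ^ m)⁻¹ ≠ 0 := fun h => hm (by rw [gauss, zpow_neg, h, zero_div])
  obtain ⟨α, hα⟩ := IsAlgClosed.exists_pow_nat_eq (-q) two_pos
  obtain ⟨v₁, h₁⟩ := IsAlgClosed.exists_pow_nat_eq (-(q ^ m)⁻¹ / (q ^ m - (q ^ m)⁻¹)) two_pos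
  obtain ⟨v₂, h₂⟩ := IsAlgClosed.exists_pow_nat_eq (q ^ m / (q ^ m - (q ^ m)⁻¹)) two_pos
  refine ⟨α, v₁, v₂, ?_, ?_, ?_, ?_, ?_, ?_⟩
  · rintro rfl
    exact hq (by simpa using hα.symm)
  · rintro rfl
    rw [zero_pow two_ne_zero] at h₁
    exact div_ne_zero (neg_ne_zero.mpr (inv_ne_zero hqm)) hΔ h₁.symm
  · rintro rfl
    rw [zero_pow two_ne_zero] at h₂
    exact div_ne_zero hqm hΔ h₂.symm
  · rw [inv_pow, hα, inv_neg]
    ring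
  · rw [h₁, h₂, ← add_div, neg_add_eq_sub, div_self hΔ]
  · rw [inv_pow, hα, h₁, h₂, gauss, gauss, div_div_div_cancel_right₀ hne, zpow_neg, zpow_neg,
      zpow_sub_one₀ hq, mul_inv, inv_inv, inv_neg, mul_div_assoc', mul_div_assoc', ← add_div,
      ← neg_div]
    congr 1
    ring

/-- The blob algebra `b_n(m)` possesses a family of Jucys–Murphy elements
with respect to the order `⪰`:  there is a cellular basis `{m_{st}}` with respect to the
poset `(bi(n), ⪰)` and index sets `Std(λ)` on which each `L_k` acts triangularly with
diagonal coefficients the contents `c_s(k)`. -/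
theorem statement5 (q : ℂ) (hq : q ≠ 0) (hq2 : q ^ 2 ≠ 1) (m : ℤ)
    (hm : gauss q m ≠ 0) (n : ℕ) (hn : 1 ≤ n) :
    ∃ c : (lam : Bi n) → Std n lam → Std n lam → Blob q m n,
      -- the m_{st} form a basis
      LinearIndependent ℂ
        (fun p : Σ lam : Bi n, Std n lam × Std n lam => c p.1 p.2.1 p.2.2) ∧
      Submodule.span ℂ
        (Set.range (fun p : Σ lam : Bi n, Std n lam × Std n lam => c p.1 p.2.1 p.2.2)) = ⊤ ∧
      -- the linear map `m_{st} ↦ m_{ts}` is an algebra anti-automorphism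
      (∃ σ : Blob q m n ≃ₗ[ℂ] Blob q m n,
        (∀ x y, σ (x * y) = σ y * σ x) ∧
        ∀ (lam : Bi n) (s t : Std n lam), σ (c lam s t) = c lam t s) ∧
      -- the cellular multiplication property
      (∀ (a : Blob q m n) (lam : Bi n) (s : Std n lam),
        ∃ r : Std n lam → ℂ, ∀ t : Std n lam,
          a * c lam s t - ∑ u : Std n lam, r u • c lam u t ∈
            Submodule.span ℂ
              {x | ∃ (mu : Bi n) (_ : biSucceq mu lam ∧ mu ≠ lam)
                  (u v : Std n mu), x = c mu u v}) ∧
      -- the Jucys–Murphy triangularity property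
      (∀ (lam : Bi n) (s t : Std n lam) (k : Fin n),
        ∃ a : Std n lam → ℂ,
          (∀ u : Std n lam, ¬ (tabSucceq n u.1 s.1 ∧ u ≠ s) → a u = 0) ∧
          Lel q m n k.val * c lam s t - content q m n s.1 k • c lam s t -
              ∑ u : Std n lam, a u • c lam u t ∈
            Submodule.span ℂ
              {x | ∃ (mu : Bi n) (_ : biSucceq mu lam ∧ mu ≠ lam)
                  (u v : Std n mu), x = c mu u v}) := by
  obtain ⟨α, v₁, v₂, hα, h₁, h₂, hq', hv, hy⟩ := exists_parameters hq hm
  exact (seqOp.cupCap hα hq' hv hy).jucysMurphy_cellular rfl hn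
    (seqOp.letters hα hq' hv hy h₁ h₂) hq hq2 hm

end Statement5
end
end

section
/- Let q ∈ ℂ with q ≠ 0 and q² ≠ 1, and let n ≥ 3. There is a unique ℂ-algebra homomorphism Φ₁ : H_n(q²) → Tl_n(q) with Φ₁(T_i) = qU_i + q² for all 1 ≤ i ≤ n−1. Moreover Φ₁ is surjective and its kernel is the two-sided ideal of H_n(q²) generated by the element q^{−6}T_1T_2T_1 − q^{−4}T_1T_2 − q^{−4}T_2T_1 + q^{−2}T_1 + q^{−2}T_2 − 1. -/
noncomputable section

namespace Statement6

/-- The generator `U_i` of the Temperley–Lieb algebra in the free algebra on `U_1, …, U_{n-1}`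
(0-indexed). -/
def UT (q : ℂ) (n : ℕ) (i : Fin (n - 1)) : FreeAlgebra ℂ (Fin (n - 1)) :=
  FreeAlgebra.ι ℂ i

/-- The defining relations of the Temperley–Lieb algebra `Tl_n(q)`. -/
inductive TLRel (q : ℂ) (n : ℕ) :
    FreeAlgebra ℂ (Fin (n - 1)) → FreeAlgebra ℂ (Fin (n - 1)) → Prop
  | Usq (i : Fin (n - 1)) : TLRel q n (UT q n i * UT q n i) ((-(q + q⁻¹)) • UT q n i)
  | UUU (i j : Fin (n - 1)) (h : i.val + 1 = j.val ∨ j.val + 1 = i.val) :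
      TLRel q n (UT q n i * UT q n j * UT q n i) (UT q n i)
  | Ucomm (i j : Fin (n - 1)) (h : i.val + 1 < j.val ∨ j.val + 1 < i.val) :
      TLRel q n (UT q n i * UT q n j) (UT q n j * UT q n i)

/-- The Temperley–Lieb algebra `Tl_n(q)`. -/
abbrev TL (q : ℂ) (n : ℕ) := RingQuot (TLRel q n)

/-- The image of `U_i` in the Temperley–Lieb algebra. -/
def UmkTL (q : ℂ) (n : ℕ) (i : Fin (n - 1)) : TL q n :=
  RingQuot.mkAlgHom ℂ (TLRel q n) (UT q n i)

/-- The generator `T_i` of the type `A` Hecke algebra in the free algebra (0-indexed). -/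
def TA (q0 : ℂ) (n : ℕ) (i : Fin (n - 1)) : FreeAlgebra ℂ (Fin (n - 1)) :=
  FreeAlgebra.ι ℂ i

/-- The defining relations of the Hecke algebra `H_n(q₀)` of type `A_{n-1}`. -/
inductive HARel (q0 : ℂ) (n : ℕ) :
    FreeAlgebra ℂ (Fin (n - 1)) → FreeAlgebra ℂ (Fin (n - 1)) → Prop
  | quad (i : Fin (n - 1)) :
      HARel q0 n ((TA q0 n i - algebraMap ℂ _ q0) * (TA q0 n i + 1)) 0
  | braid (i j : Fin (n - 1)) (h : j.val = i.val + 1) :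
      HARel q0 n (TA q0 n i * TA q0 n j * TA q0 n i) (TA q0 n j * TA q0 n i * TA q0 n j)
  | comm (i j : Fin (n - 1)) (h : i.val + 1 < j.val ∨ j.val + 1 < i.val) :
      HARel q0 n (TA q0 n i * TA q0 n j) (TA q0 n j * TA q0 n i)

/-- The Hecke algebra `H_n(q₀)` of type `A_{n-1}`. -/
abbrev HA (q0 : ℂ) (n : ℕ) := RingQuot (HARel q0 n)

/-- The image of `T_i` in the Hecke algebra. -/
def Tmk (q0 : ℂ) (n : ℕ) (i : Fin (n - 1)) : HA q0 n :=
  RingQuot.mkAlgHom ℂ (HARel q0 n) (TA q0 n i)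

/-- The element `q⁻⁶T₁T₂T₁ - q⁻⁴T₁T₂ - q⁻⁴T₂T₁ + q⁻²T₁ + q⁻²T₂ - 1` of `H_n(q²)`. -/
def kerGen1 (q : ℂ) (n : ℕ) (hn : 3 ≤ n) : HA (q ^ 2) n :=
  q ^ (-6 : ℤ) • (Tmk (q ^ 2) n ⟨0, by omega⟩ * Tmk (q ^ 2) n ⟨1, by omega⟩ *
      Tmk (q ^ 2) n ⟨0, by omega⟩) -
    q ^ (-4 : ℤ) • (Tmk (q ^ 2) n ⟨0, by omega⟩ * Tmk (q ^ 2) n ⟨1, by omega⟩) -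
    q ^ (-4 : ℤ) • (Tmk (q ^ 2) n ⟨1, by omega⟩ * Tmk (q ^ 2) n ⟨0, by omega⟩) +
    q ^ (-2 : ℤ) • Tmk (q ^ 2) n ⟨0, by omega⟩ +
    q ^ (-2 : ℤ) • Tmk (q ^ 2) n ⟨1, by omega⟩ - 1

variable {R : Type*} [Ring R] [Algebra ℂ R]

/-- The kernel generator as a polynomial in two elements of an arbitrary algebra. -/
def kerPoly (q : ℂ) (a b : R) : R :=
  q ^ (-6 : ℤ) • (a * b * a) - q ^ (-4 : ℤ) • (a * b) - q ^ (-4 : ℤ) • (b * a) +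
    q ^ (-2 : ℤ) • a + q ^ (-2 : ℤ) • b - 1

theorem map_kerPoly {S : Type*} [Ring S] [Algebra ℂ S] (f : R →ₐ[ℂ] S) (q : ℂ) (a b : R) :
    f (kerPoly q a b) = kerPoly q (f a) (f b) := by
  simp [kerPoly]

theorem hecke_quad_iff (q : ℂ) (t : R) :
    (t - algebraMap ℂ R (q ^ 2)) * (t + 1) = 0 ↔ t * t = (q ^ 2 - 1) • t + (q ^ 2) • 1 := by
  rw [← sub_eq_zero (a := t * t)]
  refine Eq.congr_left ?_
  simp only [Algebra.algebraMap_eq_smul_one, mul_add, sub_mul, smul_mul_assoc, one_mul, mul_one]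
  module

theorem hecke_quad_of_tl {q : ℂ} (hq : q ≠ 0) {u : R} (hu : u * u = (-(q + q⁻¹)) • u) :
    (q • u + algebraMap ℂ R (q ^ 2)) * (q • u + algebraMap ℂ R (q ^ 2)) =
      (q ^ 2 - 1) • (q • u + algebraMap ℂ R (q ^ 2)) + (q ^ 2) • 1 := by
  simp only [Algebra.algebraMap_eq_smul_one, mul_add, add_mul, smul_mul_assoc, mul_smul_comm,
    one_mul, mul_one, hu]
  match_scalars <;> field_simp <;> ring

theorem hecke_triple_of_tl {q : ℂ} (hq : q ≠ 0) {u v : R} (hu : u * u = (-(q + q⁻¹)) • u)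
    (huv : u * v * u = u) :
    (q • u + algebraMap ℂ R (q ^ 2)) * (q • v + algebraMap ℂ R (q ^ 2)) *
        (q • u + algebraMap ℂ R (q ^ 2)) =
      (q ^ 4) • (u * v) + (q ^ 4) • (v * u) + (q ^ 5) • u + (q ^ 5) • v + (q ^ 6) • 1 := by
  simp only [Algebra.algebraMap_eq_smul_one, mul_add, add_mul, smul_mul_assoc, mul_smul_comm,
    one_mul, mul_one, hu, huv]
  match_scalars <;> field_simp; ring

theorem kerPoly_of_tl {q : ℂ} (hq : q ≠ 0) {u v : R} (hu : u * u = (-(q + q⁻¹)) • u)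
    (huv : u * v * u = u) :
    kerPoly q (q • u + algebraMap ℂ R (q ^ 2)) (q • v + algebraMap ℂ R (q ^ 2)) = 0 := by
  rw [kerPoly, hecke_triple_of_tl hq hu huv]
  simp only [Algebra.algebraMap_eq_smul_one, mul_add, add_mul, smul_mul_assoc, mul_smul_comm,
    one_mul, mul_one]
  match_scalars <;> field_simp <;> ring

theorem tl_sq_of_hecke {q : ℂ} (hq : q ≠ 0) {t : R}
    (ht : t * t = (q ^ 2 - 1) • t + (q ^ 2) • 1) :
    (q⁻¹ • t - q • 1) * (q⁻¹ • t - q • 1) = (-(q + q⁻¹)) • (q⁻¹ • t - q • 1) := by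
  simp only [mul_sub, sub_mul, smul_mul_assoc, mul_smul_comm, one_mul, mul_one, ht]
  match_scalars <;> field_simp <;> ring

theorem tl_triple_of_kerPoly {q : ℂ} (hq : q ≠ 0) {s t : R}
    (hs : s * s = (q ^ 2 - 1) • s + (q ^ 2) • 1) (h : kerPoly q s t = 0) :
    (q⁻¹ • s - q • 1) * (q⁻¹ • t - q • 1) * (q⁻¹ • s - q • 1) = q⁻¹ • s - q • (1 : R) := by
  rw [← sub_eq_zero]
  trans (q ^ 3) • kerPoly q s t
  · simp only [kerPoly, mul_sub, sub_mul, smul_mul_assoc, mul_smul_comm, one_mul, mul_one, hs]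
    match_scalars <;> field_simp <;> ring
  · rw [h, smul_zero]

theorem kerPoly_comm_of_braid (q : ℂ) {s t : R} (h : s * t * s = t * s * t) :
    kerPoly q s t = kerPoly q t s := by
  rw [kerPoly, kerPoly, h]
  abel

theorem isUnit_of_hecke {q : ℂ} (hq : q ≠ 0) {t : R}
    (ht : t * t = (q ^ 2 - 1) • t + (q ^ 2) • 1) : IsUnit t := by
  refine isUnit_iff_exists.2 ⟨(q ^ 2)⁻¹ • (t - (q ^ 2 - 1) • 1), ?_, ?_⟩ <;>
  · simp only [mul_sub, sub_mul, smul_mul_assoc, mul_smul_comm, one_mul, mul_one, ht]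
    match_scalars <;> field_simp; ring

theorem SemiconjBy.kerPoly (q : ℂ) {w a b c d : R} (hac : SemiconjBy w a c)
    (hbd : SemiconjBy w b d) : SemiconjBy w (kerPoly q a b) (kerPoly q c d) := by
  have hab := hac.mul_right hbd
  have hba := hbd.mul_right hac
  have haba := hab.mul_right hac
  simp only [SemiconjBy] at *
  simp only [Statement6.kerPoly, mul_sub, sub_mul, mul_add, add_mul, smul_mul_assoc,
    mul_smul_comm, one_mul, mul_one, hac, hbd, hab, hba, haba]

theorem kerPoly_eq_zero_shift {q : ℂ} {a b c : R} (ha : IsUnit a) (hb : IsUnit b)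
    (hc : IsUnit c) (hab : a * b * a = b * a * b) (hbc : b * c * b = c * b * c)
    (hac : a * c = c * a) (h : kerPoly q a b = 0) : kerPoly q b c = 0 := by
  have h₁ : SemiconjBy (a * b * c) a b := by
    rw [SemiconjBy, mul_assoc, ← hac, ← mul_assoc, hab]
    simp only [mul_assoc]
  have h₂ : SemiconjBy (a * b * c) b c := by
    rw [SemiconjBy, mul_assoc, mul_assoc, ← mul_assoc b, hbc, mul_assoc, ← mul_assoc a, hac]
    simp only [mul_assoc]
  have h₃ := (SemiconjBy.kerPoly q h₁ h₂).eq
  rwa [h, mul_zero, eq_comm, ((ha.mul hb).mul hc).mul_left_eq_zero] at h₃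

theorem UmkTL_mul_self (q : ℂ) (n : ℕ) (i : Fin (n - 1)) :
    UmkTL q n i * UmkTL q n i = (-(q + q⁻¹)) • UmkTL q n i := by
  simpa only [UmkTL, map_mul, map_smul] using RingQuot.mkAlgHom_rel ℂ (TLRel.Usq (q := q) (n := n) i)

theorem UmkTL_triple (q : ℂ) (n : ℕ) (i j : Fin (n - 1))
    (h : i.val + 1 = j.val ∨ j.val + 1 = i.val) :
    UmkTL q n i * UmkTL q n j * UmkTL q n i = UmkTL q n i := by
  simpa only [UmkTL, map_mul] using RingQuot.mkAlgHom_rel ℂ (TLRel.UUU (q := q) (n := n) i j h)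

theorem UmkTL_comm (q : ℂ) (n : ℕ) (i j : Fin (n - 1))
    (h : i.val + 1 < j.val ∨ j.val + 1 < i.val) :
    UmkTL q n i * UmkTL q n j = UmkTL q n j * UmkTL q n i := by
  simpa only [UmkTL, map_mul] using RingQuot.mkAlgHom_rel ℂ (TLRel.Ucomm (q := q) (n := n) i j h)

theorem Tmk_mul_self (q : ℂ) (n : ℕ) (i : Fin (n - 1)) :
    Tmk (q ^ 2) n i * Tmk (q ^ 2) n i = (q ^ 2 - 1) • Tmk (q ^ 2) n i + (q ^ 2) • 1 := by
  rw [← hecke_quad_iff]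
  simpa only [Tmk, map_mul, map_sub, map_add, map_one, map_zero, AlgHom.commutes] using
    RingQuot.mkAlgHom_rel ℂ (HARel.quad (q0 := q ^ 2) (n := n) i)

theorem Tmk_braid (q0 : ℂ) (n : ℕ) (i j : Fin (n - 1)) (h : j.val = i.val + 1) :
    Tmk q0 n i * Tmk q0 n j * Tmk q0 n i = Tmk q0 n j * Tmk q0 n i * Tmk q0 n j := by
  simpa only [Tmk, map_mul] using RingQuot.mkAlgHom_rel ℂ (HARel.braid (q0 := q0) (n := n) i j h)

theorem Tmk_comm (q0 : ℂ) (n : ℕ) (i j : Fin (n - 1))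
    (h : i.val + 1 < j.val ∨ j.val + 1 < i.val) :
    Tmk q0 n i * Tmk q0 n j = Tmk q0 n j * Tmk q0 n i := by
  simpa only [Tmk, map_mul] using RingQuot.mkAlgHom_rel ℂ (HARel.comm (q0 := q0) (n := n) i j h)

theorem HA_hom_ext {q0 : ℂ} {n : ℕ} {f g : HA q0 n →ₐ[ℂ] R}
    (h : ∀ i, f (Tmk q0 n i) = g (Tmk q0 n i)) : f = g :=
  RingQuot.ringQuot_ext' _ _ _ (FreeAlgebra.hom_ext (funext h))

theorem exists_heckeToTL {q : ℂ} (hq : q ≠ 0) (n : ℕ) :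
    ∃ Φ : HA (q ^ 2) n →ₐ[ℂ] TL q n,
      ∀ i, Φ (Tmk (q ^ 2) n i) = q • UmkTL q n i + algebraMap ℂ _ (q ^ 2) := by
  let f : FreeAlgebra ℂ (Fin (n - 1)) →ₐ[ℂ] TL q n :=
    FreeAlgebra.lift ℂ fun i => q • UmkTL q n i + algebraMap ℂ _ (q ^ 2)
  have hf (i) : f (TA (q ^ 2) n i) = q • UmkTL q n i + algebraMap ℂ _ (q ^ 2) :=
    FreeAlgebra.lift_ι_apply _ _
  have hrel : ∀ ⦃x y⦄, HARel (q ^ 2) n x y → f x = f y := by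
    rintro _ _ (i | ⟨i, j, h⟩ | ⟨i, j, h⟩)
    · simp only [map_mul, map_sub, map_add, map_one, map_zero, AlgHom.commutes, hf]
      exact (hecke_quad_iff q _).2 (hecke_quad_of_tl hq (UmkTL_mul_self q n i))
    · simp only [map_mul, hf]
      rw [hecke_triple_of_tl hq (UmkTL_mul_self q n i) (UmkTL_triple q n i j (.inl h.symm)),
        hecke_triple_of_tl hq (UmkTL_mul_self q n j) (UmkTL_triple q n j i (.inr h.symm))]
      abel
    · simp only [map_mul, hf]
      have hc : Commute (UmkTL q n i) (UmkTL q n j) := UmkTL_comm q n i j h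
      exact ((((hc.smul_left q).smul_right q).add_right
        (Algebra.commutes _ _).symm).add_left (Algebra.commutes _ _)).eq
  refine ⟨RingQuot.liftAlgHom ℂ ⟨f, hrel⟩, fun i => ?_⟩
  rw [Tmk, RingQuot.liftAlgHom_mkAlgHom_apply, hf]

/-- Elements satisfying the Hecke relations at `q²` on which the kernel generator vanishes at one
adjacent pair yield a representation of the Temperley–Lieb algebra. -/
theorem exists_lift_TL {q : ℂ} (hq : q ≠ 0) {n : ℕ} (hn : 3 ≤ n) (t : Fin (n - 1) → R)
    (hquad : ∀ i, t i * t i = (q ^ 2 - 1) • t i + (q ^ 2) • 1)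
    (hbraid : ∀ i j : Fin (n - 1), j.val = i.val + 1 → t i * t j * t i = t j * t i * t j)
    (hcomm : ∀ i j : Fin (n - 1), i.val + 1 < j.val ∨ j.val + 1 < i.val →
      t i * t j = t j * t i)
    (hker : kerPoly q (t ⟨0, by omega⟩) (t ⟨1, by omega⟩) = 0) :
    ∃ Θ : TL q n →ₐ[ℂ] R, ∀ i, Θ (UmkTL q n i) = q⁻¹ • t i - q • 1 := by
  have hunit (i) : IsUnit (t i) := isUnit_of_hecke hq (hquad i)
  have hshift : ∀ (k : ℕ) (hk : k + 1 < n - 1), kerPoly q (t ⟨k, by omega⟩) (t ⟨k + 1, hk⟩) = 0 := by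
    intro k
    induction k with
    | zero => exact fun _ => hker
    | succ k ih =>
      intro hk
      exact kerPoly_eq_zero_shift (hunit _) (hunit _) (hunit _) (hbraid _ _ rfl) (hbraid _ _ rfl)
        (hcomm _ _ (.inl (by simp))) (ih (by omega))
  have hadj (i j : Fin (n - 1)) (h : i.val + 1 = j.val ∨ j.val + 1 = i.val) :
      kerPoly q (t i) (t j) = 0 := by
    obtain ⟨i, hi⟩ := i
    obtain ⟨j, hj⟩ := j
    rcases h with rfl | rfl
    · exact hshift i hj
    · rw [← kerPoly_comm_of_braid q (hbraid _ _ rfl)]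
      exact hshift j hi
  let f : FreeAlgebra ℂ (Fin (n - 1)) →ₐ[ℂ] R := FreeAlgebra.lift ℂ fun i => q⁻¹ • t i - q • 1
  have hf (i) : f (UT q n i) = q⁻¹ • t i - q • 1 := FreeAlgebra.lift_ι_apply _ _
  have hrel : ∀ ⦃x y⦄, TLRel q n x y → f x = f y := by
    rintro _ _ (i | ⟨i, j, h⟩ | ⟨i, j, h⟩)
    · simpa only [map_mul, map_smul, hf] using tl_sq_of_hecke hq (hquad i)
    · simpa only [map_mul, hf] using tl_triple_of_kerPoly hq (hquad i) (hadj i j h)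
    · simp only [map_mul, hf]
      have hc : Commute (t i) (t j) := hcomm i j h
      exact ((((hc.smul_left q⁻¹).smul_right q⁻¹).sub_right
        ((Commute.one_right _).smul_right q)).sub_left ((Commute.one_left _).smul_left q)).eq
  refine ⟨RingQuot.liftAlgHom ℂ ⟨f, hrel⟩, fun i => ?_⟩
  rw [UmkTL, RingQuot.liftAlgHom_mkAlgHom_apply, hf]

/-- For `q ≠ 0`, `q² ≠ 1` and `n ≥ 3` there is a unique `ℂ`-algebra
homomorphism `Φ₁ : H_n(q²) → Tl_n(q)` with `Φ₁(T_i) = qU_i + q²`; it is surjective and its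
kernel is the two-sided ideal generated by
`q⁻⁶T₁T₂T₁ - q⁻⁴T₁T₂ - q⁻⁴T₂T₁ + q⁻²T₁ + q⁻²T₂ - 1`. -/
theorem statement6 (q : ℂ) (hq : q ≠ 0) (hq2 : q ^ 2 ≠ 1) (n : ℕ) (hn : 3 ≤ n) :
    ∃ Φ : HA (q ^ 2) n →ₐ[ℂ] TL q n,
      (∀ i : Fin (n - 1), Φ (Tmk (q ^ 2) n i) = q • UmkTL q n i + algebraMap ℂ _ (q ^ 2)) ∧
      Function.Surjective Φ ∧
      (∀ x : HA (q ^ 2) n, Φ x = 0 ↔ x ∈ TwoSidedIdeal.span {kerGen1 q n hn}) ∧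
      (∀ Ψ : HA (q ^ 2) n →ₐ[ℂ] TL q n,
        (∀ i : Fin (n - 1), Ψ (Tmk (q ^ 2) n i) = q • UmkTL q n i + algebraMap ℂ _ (q ^ 2)) →
        Ψ = Φ) := by
  obtain ⟨Φ, hΦ⟩ := exists_heckeToTL hq n
  refine ⟨Φ, hΦ, ?_, fun x => ⟨fun hx => ?_, fun hx => ?_⟩,
    fun Ψ hΨ => HA_hom_ext fun i => (hΨ i).trans (hΦ i).symm⟩
  · have hU (i) : Φ (q⁻¹ • (Tmk (q ^ 2) n i - algebraMap ℂ _ (q ^ 2))) = UmkTL q n i := by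
      rw [map_smul, map_sub, hΦ, AlgHom.commutes, add_sub_cancel_right, inv_smul_smul₀ hq]
    let g : FreeAlgebra ℂ (Fin (n - 1)) →ₐ[ℂ] HA (q ^ 2) n :=
      FreeAlgebra.lift ℂ fun i => q⁻¹ • (Tmk (q ^ 2) n i - algebraMap ℂ _ (q ^ 2))
    have hg : Φ.comp g = RingQuot.mkAlgHom ℂ (TLRel q n) := by
      refine FreeAlgebra.hom_ext (funext fun i => ?_)
      simpa [g] using! hU i
    intro y
    obtain ⟨z, rfl⟩ := RingQuot.mkAlgHom_surjective ℂ (TLRel q n) y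
    exact ⟨g z, DFunLike.congr_fun hg z⟩
  · let I : TwoSidedIdeal (HA (q ^ 2) n) := TwoSidedIdeal.span {kerGen1 q n hn}
    let π : HA (q ^ 2) n →ₐ[ℂ] I.ringCon.Quotient := I.ringCon.mkₐ ℂ
    have hπ (y) : π y = 0 ↔ y ∈ I := I.ringCon.eq
    have hgen : π (kerGen1 q n hn) = 0 :=
      (hπ _).2 (TwoSidedIdeal.subset_span (Set.mem_singleton _))
    obtain ⟨Θ, hΘ⟩ := exists_lift_TL hq hn (fun i => π (Tmk (q ^ 2) n i))
      (fun i => by simpa only [map_mul, map_add, map_smul, map_one] using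
        DFunLike.congr_arg π (Tmk_mul_self q n i))
      (fun i j h => by simpa only [map_mul] using DFunLike.congr_arg π (Tmk_braid (q ^ 2) n i j h))
      (fun i j h => by simpa only [map_mul] using DFunLike.congr_arg π (Tmk_comm (q ^ 2) n i j h))
      ((map_kerPoly π q _ _).symm.trans hgen)
    have hcomp : Θ.comp Φ = π := HA_hom_ext fun i => by
      rw [AlgHom.comp_apply, hΦ, map_add, map_smul, hΘ, AlgHom.commutes,
        Algebra.algebraMap_eq_smul_one]
      match_scalars <;> field_simp; ring
    rw [← hπ, ← hcomp, AlgHom.comp_apply, hx, map_zero]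
  · have hle : TwoSidedIdeal.span {kerGen1 q n hn} ≤ TwoSidedIdeal.ker Φ := by
      rw [TwoSidedIdeal.span_le, Set.singleton_subset_iff, SetLike.mem_coe, TwoSidedIdeal.mem_ker]
      refine (map_kerPoly Φ q _ _).trans ?_
      rw [hΦ, hΦ]
      exact kerPoly_of_tl hq (UmkTL_mul_self q n _) (UmkTL_triple q n _ _ (.inl rfl))
    exact (TwoSidedIdeal.mem_ker Φ).1 (hle hx)

end Statement6
end
end
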